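/- The Kobayashi–Royden pseudonorm F_Ω : Ω × ℂⁿ → [0,∞] is upper semicontinuous: for every (p, v) ∈ Ω × ℂⁿ and every c > F_Ω(p, v) there is a neighborhood of (p, v) in Ω × ℂⁿ on which F_Ω < c. -/

import Mathlib

open Metric Set Filter
open scoped ENNReal Topology

noncomputable section

abbrev Cn (n : ℕ) := EuclideanSpace ℂ (Fin n)

def IsAlmostComplexOn (n : ℕ) (Ω : Set (Cn n)) (J : Cn n → (Cn n →L[ℝ] Cn n)) : Prop :=
  ContDiffOn ℝ (⊤ : ℕ∞) J Ω ∧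
    ∀ x ∈ Ω, (J x).comp (J x) = -ContinuousLinearMap.id ℝ (Cn n)

def IsJHolomorphicOn (n : ℕ) (Ω : Set (Cn n)) (J : Cn n → (Cn n →L[ℝ] Cn n))
    (R : ℝ) (f : ℂ → Cn n) : Prop :=
  MapsTo f (ball (0:ℂ) R) Ω ∧
    ∀ z ∈ ball (0:ℂ) R, DifferentiableAt ℝ f z ∧
      ∀ ξ : ℂ, fderiv ℝ f z (Complex.I * ξ) = J (f z) (fderiv ℝ f z ξ)

def kobayashiRoyden (n : ℕ) (Ω : Set (Cn n)) (J : Cn n → (Cn n →L[ℝ] Cn n))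
    (p v : Cn n) : ℝ≥0∞ :=
  sInf {c : ℝ≥0∞ | ∃ r : ℝ, 0 < r ∧
    (∃ f : ℂ → Cn n, IsJHolomorphicOn n Ω J 1 f ∧ f 0 = p ∧ fderiv ℝ f 0 1 = r • v) ∧
    c = ENNReal.ofReal (1 / r)}

/-- The inverse hyperbolic tangent, `arctanh x = ½ log((1 + x)/(1 - x))`. -/
def arctanh (x : ℝ) : ℝ := (1 / 2) * Real.log ((1 + x) / (1 - x))

/-- The Poincaré distance on the unit disc. -/
def poincareDist (z w : ℂ) : ℝ :=
  arctanh (‖z - w‖ / ‖1 - (starRingEnd ℂ) z * w‖)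

/-- The Kobayashi pseudodistance `d_Ω(p, q)` of the almost complex manifold `(Ω, J)`. -/
def kobayashiDist (n : ℕ) (Ω : Set (Cn n)) (J : Cn n → (Cn n →L[ℝ] Cn n))
    (p q : Cn n) : ℝ≥0∞ :=
  sInf {c : ℝ≥0∞ | ∃ m : ℕ, ∃ z w : Fin (m + 1) → ℂ, ∃ f : Fin (m + 1) → ℂ → Cn n,
    (∀ k, z k ∈ ball (0:ℂ) 1 ∧ w k ∈ ball (0:ℂ) 1 ∧ IsJHolomorphicOn n Ω J 1 (f k)) ∧
    f 0 (z 0) = p ∧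
    (∀ k : Fin m, f k.castSucc (w k.castSucc) = f k.succ (z k.succ)) ∧
    f (Fin.last m) (w (Fin.last m)) = q ∧
    c = ENNReal.ofReal (∑ k, poincareDist (z k) (w k))}

/-- `γ` is a piecewise continuously differentiable path in `Ω`, parametrized by `[0,1]`. -/
def IsPiecewiseC1PathIn (n : ℕ) (Ω : Set (Cn n)) (γ : ℝ → Cn n) : Prop :=
  ContinuousOn γ (Icc (0:ℝ) 1) ∧ MapsTo γ (Icc (0:ℝ) 1) Ω ∧
    ∃ (k : ℕ) (t : Fin (k + 1) → ℝ), StrictMono t ∧ t 0 = 0 ∧ t (Fin.last k) = 1 ∧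
      ∀ i : Fin k, ContDiffOn ℝ 1 γ (Icc (t i.castSucc) (t i.succ))

/-- The Kobayashi–Royden length `∫₀¹ F_Ω(γ(t), γ′(t)) dt` of a path. -/
def kobayashiRoydenLength (n : ℕ) (Ω : Set (Cn n)) (J : Cn n → (Cn n →L[ℝ] Cn n))
    (γ : ℝ → Cn n) : ℝ≥0∞ :=
  ∫⁻ t in Icc (0:ℝ) 1, kobayashiRoyden n Ω J (γ t) (deriv γ t)

/-- The integrated Kobayashi–Royden pseudodistance `d̄_Ω(p, q)`. -/
def integratedKRDist (n : ℕ) (Ω : Set (Cn n)) (J : Cn n → (Cn n →L[ℝ] Cn n))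
    (p q : Cn n) : ℝ≥0∞ :=
  ⨅ γ : {γ : ℝ → Cn n // IsPiecewiseC1PathIn n Ω γ ∧ γ 0 = p ∧ γ 1 = q},
    kobayashiRoydenLength n Ω J γ

set_option linter.all false
namespace KR
open MeasureTheory

variable {W : Type*} [NormedAddCommGroup W] [NormedSpace ℂ W] [CompleteSpace W]
  [SecondCountableTopology W]

/-- twice the Cauchy-Riemann operator -/
def dbar (F : ℂ → W) (z : ℂ) : W := fderiv ℝ F z 1 + Complex.I • fderiv ℝ F z Complex.I

/-- the Cauchy transform -/
def cT (h : ℂ → W) (z : ℂ) : W := (2 * Real.pi)⁻¹ • ∫ w, (z - w)⁻¹ • h w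

lemma stronglyMeasurable_dbar (F : ℂ → W) :
    StronglyMeasurable (dbar F) := by
  letI : MeasurableSpace W := borel W
  haveI : BorelSpace W := ⟨rfl⟩
  have h1 := (measurable_fderiv_apply_const ℝ F (1:ℂ)).stronglyMeasurable
  have h2 := (measurable_fderiv_apply_const ℝ F (Complex.I)).stronglyMeasurable
  exact h1.add (h2.const_smul _)

def pol (z : ℂ) (p : ℝ × ℝ) : ℂ := z + (p.1 : ℂ) * Complex.exp (p.2 * Complex.I)

def polD (p : ℝ × ℝ) : ℝ × ℝ →L[ℝ] ℂ :=
  (ContinuousLinearMap.fst ℝ ℝ ℝ).smulRight (Complex.exp (p.2 * Complex.I)) +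
  (ContinuousLinearMap.snd ℝ ℝ ℝ).smulRight ((p.1:ℂ) * (Complex.exp (p.2 * Complex.I) * Complex.I))

lemma hasFDerivAt_pol (z : ℂ) (p : ℝ × ℝ) : HasFDerivAt (pol z) (polD p) p := by
  have h1 : HasFDerivAt (fun p : ℝ × ℝ => (p.1 : ℂ))
      (Complex.ofRealCLM.comp (ContinuousLinearMap.fst ℝ ℝ ℝ)) p :=
    Complex.ofRealCLM.hasFDerivAt.comp p hasFDerivAt_fst
  have h2 : HasDerivAt (fun t : ℝ => Complex.exp (t * Complex.I))
      (Complex.exp (p.2 * Complex.I) * Complex.I) p.2 := by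
    have := ((hasDerivAt_id (p.2 : ℂ)).mul_const Complex.I).cexp.comp_ofReal
    simpa using this
  have h3 := h2.hasFDerivAt.comp p (hasFDerivAt_snd (𝕜 := ℝ) (E := ℝ) (F := ℝ))
  have h4 := (h1.mul h3).const_add z
  refine h4.congr_fderiv ?_
  ext <;> simp [polD]

lemma continuous_pol (z : ℂ) : Continuous (pol z) := by unfold pol; fun_prop

lemma polar_dbar (D : ℂ →L[ℝ] W) (r t : ℝ) (hr : r ≠ 0) :
    D (polD (r, t) (1, 0)) + ((r:ℂ)⁻¹ * Complex.I) • D (polD (r, t) (0, 1)) =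
      Complex.exp (-(t * Complex.I)) • (D 1 + Complex.I • D Complex.I) := by
  have e1 : polD (r,t) (1,0) = (Real.cos t) • (1:ℂ) + (Real.sin t) • Complex.I := by
    simp [polD, Complex.exp_mul_I]
  have e2 : polD (r,t) (0,1) = r • ((-Real.sin t) • (1:ℂ) + (Real.cos t) • Complex.I) := by
    simp [polD, Complex.exp_mul_I]
    linear_combination r * Complex.sin t * Complex.I_mul_I
  have e3 : Complex.exp (-(t * Complex.I)) = Real.cos t - Real.sin t * Complex.I := by
    rw [← neg_mul, Complex.exp_mul_I]; simp; ring
  have hr' : (r:ℂ) ≠ 0 := by exact_mod_cast hr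
  rw [e1, e2, e3]
  simp only [map_add, map_smul, smul_add]
  simp only [← Complex.coe_smul, smul_smul]
  have key : ∀ a b c d e f : ℂ, a + c = e → b + d = f →
      a • D 1 + b • D Complex.I + (c • D 1 + d • D Complex.I)
    = e • D 1 + f • D Complex.I := by
    intro a b c d e f h1 h2; rw [← h1, ← h2]; module
  apply key
  · field_simp
    push_cast; ring
  · field_simp
    push_cast
    linear_combination (Complex.sin t) * Complex.I_mul_I

theorem pompeiu (F : ℂ → W) (hF : Differentiable ℝ F) (R K : ℝ)
    (hR : ∀ w, R ≤ ‖w‖ → F w = 0) (hK : ∀ w, ‖dbar F w‖ ≤ K) (z : ℂ) :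
    F z = cT (dbar F) z := by
  have hR2 : ∀ w, R < ‖w‖ → dbar F w = 0 := by
    intro w hw
    have : F =ᶠ[𝓝 w] fun _ => 0 := by
      filter_upwards [(isOpen_lt continuous_const continuous_norm).mem_nhds hw] with y hy
      exact hR y (le_of_lt hy)
    simp [dbar, this.fderiv_eq]
  set Φ : ℝ × ℝ → W := fun p => Complex.exp (-(p.2 * Complex.I)) • dbar F (pol z p) with hΦ
  have hpm : Measurable (pol z) := (continuous_pol z).measurable
  have hΦm : StronglyMeasurable Φ := by
    apply StronglyMeasurable.smul
    · exact Continuous.stronglyMeasurable (by fun_prop)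
    · exact (stronglyMeasurable_dbar F).comp_measurable hpm
  have hΦn : ∀ p, ‖Φ p‖ ≤ K := by
    intro p
    rw [hΦ]; simp only [norm_smul]
    rw [show -(p.2 * Complex.I : ℂ) = ((-p.2 : ℝ) : ℂ) * Complex.I by push_cast; ring,
      Complex.norm_exp_ofReal_mul_I, one_mul]
    exact hK _
  have hnp : ∀ p : ℝ × ℝ, 0 ≤ p.1 → p.1 ≤ ‖pol z p‖ + ‖z‖ := by
    intro p hp
    have : ‖pol z p - z‖ = p.1 := by
      simp [pol, Complex.norm_exp_ofReal_mul_I, abs_of_nonneg hp]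
    rw [← this]; exact norm_sub_le _ _
  have hΦ0 : ∀ p : ℝ × ℝ, 0 ≤ p.1 → R + ‖z‖ < p.1 → Φ p = 0 := by
    intro p hp h
    have := hnp p hp
    simp only [hΦ]; rw [hR2 _ (by linarith), smul_zero]
  set S : ℕ → Set (ℝ × ℝ) := fun n => Icc ((1:ℝ)/(n+1), -Real.pi) ((n:ℝ)+1, Real.pi) with hS
  have hSmono : Monotone S := by
    intro m n hmn
    have : (m:ℝ) ≤ n := by exact_mod_cast hmn
    apply Icc_subset_Icc
    · exact ⟨one_div_le_one_div_of_le (by positivity) (by linarith), le_rfl⟩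
    · exact ⟨by simpa using hmn, le_rfl⟩
  have hSU : (⋃ n, S n) = Ioi (0:ℝ) ×ˢ Icc (-Real.pi) Real.pi := by
    ext ⟨r, t⟩
    simp only [hS, mem_iUnion, mem_Icc, Prod.le_def, mem_prod, mem_Ioi]
    constructor
    · rintro ⟨n, ⟨h1, h2⟩, h3, h4⟩
      exact ⟨lt_of_lt_of_le (by positivity) h1, h2, h4⟩
    · rintro ⟨h1, h2, h3⟩
      obtain ⟨n, hn⟩ := exists_nat_gt (max r (1/r))
      refine ⟨n, ⟨?_, h2⟩, ?_, h3⟩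
      · show 1 / ((n:ℝ)+1) ≤ r
        rw [div_le_iff₀ (by positivity)]
        have : 1 / r < n := lt_of_le_of_lt (le_max_right _ _) hn
        rw [div_lt_iff₀ h1] at this
        nlinarith
      · show r ≤ n + 1
        linarith [le_max_left r (1/r)]
  have hint : IntegrableOn Φ (Ioi (0:ℝ) ×ˢ Icc (-Real.pi) Real.pi) := by
    have h1 : IntegrableOn Φ (Icc (0, -Real.pi) (R + ‖z‖, Real.pi)) :=
      Measure.integrableOn_of_bounded (M := K) (isCompact_Icc.measure_lt_top.ne)
        hΦm.aestronglyMeasurable (ae_of_all _ hΦn)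
    refine h1.of_forall_sdiff_eq_zero (measurableSet_Ioi.prod measurableSet_Icc) ?_
    rintro ⟨r, t⟩ ⟨⟨h1, h2⟩, h3⟩
    apply hΦ0 _ (le_of_lt h1)
    by_contra h
    push Not at h
    exact h3 ⟨⟨le_of_lt h1, h2.1⟩, h, h2.2⟩
  have hlim1 : Tendsto (fun n => ∫ p in S n, Φ p) atTop
      (𝓝 (∫ p in Ioi (0:ℝ) ×ˢ Icc (-Real.pi) Real.pi, Φ p)) := by
    have := tendsto_setIntegral_of_monotone (μ := volume) (f := Φ) (s := S)
      (fun n => measurableSet_Icc) hSmono (by rw [hSU]; exact hint)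
    rwa [hSU] at this
  have hcirc : ∀ᶠ n : ℕ in atTop, ∫ p in S n, Φ p =
      - ∫ t in (-Real.pi)..Real.pi, F (pol z ((1:ℝ)/(n+1), t)) := by
    obtain ⟨N, hN⟩ := exists_nat_gt (R + ‖z‖)
    filter_upwards [eventually_ge_atTop N] with n hn
    have hn' : R + ‖z‖ < (n:ℝ) + 1 := by
      have : (N:ℝ) ≤ n := by exact_mod_cast hn
      linarith
    have hle : ((1:ℝ)/(n+1)) ≤ (n:ℝ)+1 := by
      rw [div_le_iff₀ (by positivity)]; nlinarith [(Nat.cast_nonneg n : (0:ℝ) ≤ n)]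
    have hdivpos : (0:ℝ) < 1/((n:ℝ)+1) := by positivity
    have hinv : ∀ p : ℝ × ℝ, p.1 ≠ 0 → HasFDerivAt (fun p : ℝ × ℝ => ((p.1:ℂ))⁻¹ * Complex.I)
      ((Complex.ofRealCLM.comp ((-(p.1^2)⁻¹) • ContinuousLinearMap.fst ℝ ℝ ℝ)).smulRight Complex.I) p := by
      intro p hp
      have h1 : HasFDerivAt (fun p : ℝ × ℝ => p.1⁻¹) ((-(p.1^2)⁻¹) • ContinuousLinearMap.fst ℝ ℝ ℝ) p :=
        (hasDerivAt_inv hp).comp_hasFDerivAt p hasFDerivAt_fst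
      have h2 := (Complex.ofRealCLM.hasFDerivAt.comp p h1).mul_const Complex.I
      simp only [Function.comp_def, Complex.ofRealCLM_apply, Complex.ofReal_inv] at h2
      refine h2.congr_fderiv ?_
      ext <;> simp [mul_comm]
    have hFp : ∀ p, HasFDerivAt (fun p => F (pol z p)) ((fderiv ℝ F (pol z p)).comp (polD p)) p :=
      fun p => (hF _).hasFDerivAt.comp p (hasFDerivAt_pol z p)
    have hcF : Continuous (fun p => F (pol z p)) := hF.continuous.comp (continuous_pol z)
    have hg : ∀ p : ℝ × ℝ, p.1 ≠ 0 → HasFDerivAt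
       (fun p : ℝ × ℝ => (((p.1:ℂ))⁻¹ * Complex.I) • F (pol z p)) _ p :=
      fun p hp => (hinv p hp).smul (hFp p)
    have hpos : ∀ p ∈ Icc ((1:ℝ)/(n+1), -Real.pi) ((n:ℝ)+1, Real.pi), p.1 ≠ 0 :=
      fun p hp => ne_of_gt (lt_of_lt_of_le hdivpos hp.1.1)
    have hpos' : ∀ p ∈ Ioo ((1:ℝ)/(n+1)) ((n:ℝ)+1) ×ˢ Ioo (-Real.pi) Real.pi, p.1 ≠ 0 :=
      fun p hp => ne_of_gt (lt_trans hdivpos hp.1.1)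
    have hΦeq : ∀ p : ℝ × ℝ, p.1 ≠ 0 → ((fderiv ℝ F (pol z p)).comp (polD p)) (1,0) +
       ((((p.1:ℂ))⁻¹ * Complex.I) • ((fderiv ℝ F (pol z p)).comp (polD p)) +
         ((Complex.ofRealCLM.comp ((-(p.1^2)⁻¹) • ContinuousLinearMap.fst ℝ ℝ ℝ)).smulRight
          Complex.I).smulRight (F (pol z p))) (0,1) = Φ p := by
      intro p hp
      have := polar_dbar (fderiv ℝ F (pol z p)) p.1 p.2 hp
      simpa [hΦ, dbar] using this
    have key := integral_divergence_prod_Icc_of_hasFDerivAt_of_le (fun p => F (pol z p))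
      (fun p : ℝ × ℝ => (((p.1:ℂ))⁻¹ * Complex.I) • F (pol z p))
      (fun p => (fderiv ℝ F (pol z p)).comp (polD p)) (fun p => 
         (((p.1:ℂ))⁻¹ * Complex.I) • ((fderiv ℝ F (pol z p)).comp (polD p)) +
         ((Complex.ofRealCLM.comp ((-(p.1^2)⁻¹) • ContinuousLinearMap.fst ℝ ℝ ℝ)).smulRight
          Complex.I).smulRight (F (pol z p)))
      ((1:ℝ)/(n+1), -Real.pi) ((n:ℝ)+1, Real.pi) ⟨hle, by simp; linarith [Real.pi_pos]⟩
      hcF.continuousOn (fun p hp => (hg p (hpos p hp)).continuousAt.continuousWithinAt)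
      (fun p hp => hFp p) (fun p hp => hg p (hpos' p hp)) 
      (IntegrableOn.congr_fun (f := Φ) (hint.mono_set (by rw [← hSU]; exact subset_iUnion S n))
        (fun p hp => (hΦeq p (hpos p hp)).symm) measurableSet_Icc)
    rw [setIntegral_congr_fun measurableSet_Icc (fun p hp => hΦeq p (hpos p hp))] at key
    have hper : ∀ x : ℝ, pol z (x, Real.pi) = pol z (x, -Real.pi) := by
      intro x; simp [pol, Complex.exp_neg]
    have hz : ∀ y : ℝ, F (pol z ((n:ℝ)+1, y)) = 0 := by
      intro y
      apply hR
      have := hnp ((n:ℝ)+1, y) (by positivity)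
      dsimp only at this
      linarith
    simp only [hper, hz, sub_self, intervalIntegral.integral_zero, zero_add, zero_sub] at key
    exact key
  have hlim2 : Tendsto (fun n : ℕ => - ∫ t in (-Real.pi)..Real.pi, F (pol z ((1:ℝ)/(n+1), t))) atTop
      (𝓝 (- ∫ t in (-Real.pi)..Real.pi, F (pol z (0, t)))) := by
    apply Tendsto.neg
    have hc : Continuous (fun r : ℝ => ∫ t in (-Real.pi)..Real.pi, F (pol z (r, t))) := by
      apply intervalIntegral.continuous_parametric_intervalIntegral_of_continuous'
      exact hF.continuous.comp (continuous_pol z)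
    exact (hc.tendsto 0).comp tendsto_one_div_add_atTop_nhds_zero_nat
  have hfin := tendsto_nhds_unique (hlim1.congr' hcirc) hlim2
  have h0 : ∀ t, pol z (0,t) = z := by intro t; simp [pol]
  simp only [h0, intervalIntegral.integral_const] at hfin
  have hae : (Ioi (0:ℝ) ×ˢ Icc (-Real.pi) Real.pi : Set (ℝ × ℝ)) =ᵐ[volume] Complex.polarCoord.target := by
    rw [Complex.polarCoord_target]
    exact Measure.set_prod_ae_eq ae_eq_rfl Ioo_ae_eq_Icc.symm
  rw [setIntegral_congr_set hae] at hfin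
  have hpc : ∫ p in Complex.polarCoord.target, Φ p = ∫ w : ℂ, w⁻¹ • dbar F (z + w) := by
    rw [← Complex.integral_comp_polarCoord_symm]
    apply setIntegral_congr_fun Complex.polarCoord.open_target.measurableSet
    rintro ⟨r, t⟩ ⟨hr, -⟩
    have hr' : (r:ℂ) ≠ 0 := by exact_mod_cast (ne_of_gt hr)
    have e : ((r, t).1 : ℂ) * (Real.cos (r,t).2 + Real.sin (r,t).2 * Complex.I) =
       r * Complex.exp (t * Complex.I) := by rw [Complex.exp_mul_I]; simp
    simp only [Complex.polarCoord_symm_apply, hΦ] 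
    rw [e, ← Complex.coe_smul, smul_smul, Complex.exp_neg]
    congr 1
    field_simp
  rw [hpc] at hfin
  rw [cT]
  have hsub : ∫ w, (z - w)⁻¹ • dbar F w = - ∫ w : ℂ, w⁻¹ • dbar F (z + w) := by
    rw [← integral_add_left_eq_self _ z, ← integral_neg]
    congr 1; ext w
    rw [show z - (z + w) = -w by ring, inv_neg, neg_smul]
  rw [hsub, hfin, neg_neg, smul_smul]
  rw [show (2 * Real.pi)⁻¹ * (Real.pi - -Real.pi) = 1 by
    have := Real.pi_ne_zero
    field_simp; ring, one_smul]

end KR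

namespace KR
open MeasureTheory

/-- radial comparison kernel -/
def kap (x : ℝ) : ℝ := if x ≤ 1 then 1 / (x * √x) else 1 / (x * x * √x)

lemma kap_nonneg {x : ℝ} (hx : 0 ≤ x) : 0 ≤ kap x := by
  unfold kap; split_ifs <;> positivity

lemma measurable_kap : Measurable kap := by
  unfold kap
  refine Measurable.ite measurableSet_Iic ?_ ?_
  · exact measurable_const.div (measurable_id.mul Real.continuous_sqrt.measurable)
  · exact measurable_const.div ((measurable_id.mul measurable_id).mul Real.continuous_sqrt.measurable)

lemma integrable_kap : Integrable (fun w : ℂ => kap ‖w‖) := by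
  rw [MeasureTheory.integrable_fun_norm_addHaar (volume : Measure ℂ) (f := kap)]
  rw [← Ioc_union_Ioi_eq_Ioi (zero_le_one' ℝ)]
  simp only [Complex.finrank_real_complex]
  refine IntegrableOn.union ?_ ?_
  · have h := (intervalIntegral.intervalIntegrable_rpow' (a := 0) (b := 1) (r := (-1/2:ℝ)) (by norm_num))
    rw [intervalIntegrable_iff_integrableOn_Ioc_of_le zero_le_one] at h
    refine h.congr_fun ?_ measurableSet_Ioc
    intro x hx
    have hx0 : 0 < x := hx.1
    have : x ^ (-1/2:ℝ) = 1 / √x := by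
      rw [Real.sqrt_eq_rpow, show (-1/2:ℝ) = -(1/2) by norm_num, Real.rpow_neg hx0.le]; simp
    simp only [kap, if_pos hx.2, this]
    simp
    field_simp
  · have h := integrableOn_Ioi_rpow_of_lt (a := (-3/2:ℝ)) (c := 1) (by norm_num) one_pos
    refine h.congr_fun ?_ measurableSet_Ioi
    intro x hx
    have hx1 : 1 < x := hx
    have hx0 : 0 < x := by linarith
    have : x ^ (-3/2:ℝ) = 1 / (x * √x) := by
      rw [Real.sqrt_eq_rpow, show (-3/2:ℝ) = -(1 + 1/2) by norm_num, Real.rpow_neg hx0.le,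
        Real.rpow_add hx0, Real.rpow_one]; simp
    simp only [kap, if_neg (not_le.2 hx1), this]
    simp
    field_simp

def Ck : ℝ := ∫ w : ℂ, kap ‖w‖

lemma Ck_nonneg : 0 ≤ Ck := integral_nonneg fun w => kap_nonneg (norm_nonneg _)

lemma kap_bound {x : ℝ} (hx : 0 ≤ x) : 1 / x ≤ kap x + 1 ∧ 1 / (x * √x) ≤ kap x + 1 := by
  rcases hx.eq_or_lt with rfl | hx0
  · simp [kap]
  unfold kap
  split_ifs with h
  · have hs : √x ≤ 1 := by rw [Real.sqrt_le_one]; exact h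
    have hs0 : 0 < √x := Real.sqrt_pos.2 hx0
    constructor
    · have : 1 / x ≤ 1 / (x * √x) := by
        apply one_div_le_one_div_of_le (by positivity)
        nlinarith
      linarith
    · linarith
  · push Not at h
    have hs : 1 ≤ √x := by rw [Real.one_le_sqrt]; exact h.le
    have h3 : 0 ≤ 1 / (x * x * √x) := by positivity
    constructor
    · have : 1 / x ≤ 1 := by rw [div_le_one hx0]; exact h.le
      linarith
    · have : 1 / (x * √x) ≤ 1 := by rw [div_le_one (by positivity)]; nlinarith
      linarith

lemma kap_two {a b : ℝ} (ha : 0 ≤ a) (hb : 0 ≤ b) (h : 1 ≤ a + b) :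
    1 / (a * √a * b) ≤ 6 * (kap a + kap b) := by
  rcases ha.eq_or_lt with rfl | ha0
  · have := kap_nonneg le_rfl; have := kap_nonneg hb; simp; positivity
  rcases hb.eq_or_lt with rfl | hb0
  · have := kap_nonneg le_rfl; have := kap_nonneg ha; simp; positivity
  have hsa0 : 0 < √a := Real.sqrt_pos.2 ha0
  have hsb0 : 0 < √b := Real.sqrt_pos.2 hb0
  have ka := kap_nonneg ha
  have kb := kap_nonneg hb
  rcases le_total a b with hab | hab
  · have hb2 : 1 / 2 ≤ b := by linarith
    suffices 1 / (a * √a * b) ≤ 2 * kap a by linarith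
    unfold kap
    split_ifs with h1
    · rw [← div_eq_mul_one_div, div_le_div_iff₀ (by positivity) (by positivity)]
      nlinarith [mul_pos ha0 hsa0]
    · push Not at h1
      rw [← div_eq_mul_one_div, div_le_div_iff₀ (by positivity) (by positivity)]
      nlinarith [mul_pos ha0 hsa0, mul_le_mul_of_nonneg_left hab (mul_pos ha0 hsa0).le, mul_pos (mul_pos ha0 hsa0) hb0]
  · have ha2 : 1 / 2 ≤ a := by linarith
    suffices 1 / (a * √a * b) ≤ 6 * kap b by linarith
    have hsab : √b ≤ √a := Real.sqrt_le_sqrt hab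
    unfold kap
    split_ifs with h1
    · have hsq : √b ≤ 1 := by rw [Real.sqrt_le_one]; exact h1
      have hsa : 1 / 2 ≤ √a := by rw [Real.le_sqrt' (by norm_num)]; linarith
      rw [← div_eq_mul_one_div, div_le_div_iff₀ (by positivity) (by positivity)]
      have : 1 / 4 ≤ a * √a := by nlinarith
      have h2 : b * √b ≤ b := by nlinarith
      nlinarith [mul_pos ha0 hsa0, mul_le_mul_of_nonneg_right this hb0.le]
    · push Not at h1
      rw [← div_eq_mul_one_div, div_le_div_iff₀ (by positivity) (by positivity)]
      have : b * √b ≤ a * √a := by apply mul_le_mul hab hsab hsb0.le ha0.le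
      nlinarith [mul_le_mul_of_nonneg_right this hb0.le, mul_pos (mul_pos ha0 hsa0) hb0]

lemma integrable_kap_scaled (t : ℝ) (ht : 0 < t) (z : ℂ) :
    Integrable (fun w : ℂ => kap (‖z - w‖ / t)) ∧ ∫ w : ℂ, kap (‖z - w‖ / t) = t ^ 2 * Ck := by
  have h1 : (fun w : ℂ => kap (‖z - w‖ / t)) = fun w => (fun u : ℂ => kap ‖t⁻¹ • u‖) (z - w) := by
    funext w
    simp only [norm_smul, Real.norm_eq_abs, abs_inv, abs_of_pos ht]
    rw [div_eq_inv_mul]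
  have h2 : Integrable (fun u : ℂ => kap ‖t⁻¹ • u‖) := by
    have := (integrable_kap.comp_smul (inv_ne_zero ht.ne'))
    exact this
  constructor
  · rw [h1]; exact h2.comp_sub_left z
  · rw [h1, integral_sub_left_eq_self (fun u : ℂ => kap ‖t⁻¹ • u‖) volume z]
    rw [Measure.integral_comp_smul volume (fun u : ℂ => kap ‖u‖) t⁻¹]
    simp only [Complex.finrank_real_complex, Ck, smul_eq_mul]
    congr 1
    simp

/-- dominating function -/
def dom (R : ℝ) (z w : ℂ) : ℝ := kap ‖z - w‖ + (ball (0:ℂ) R).indicator (fun _ => (1:ℝ)) w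

def Cd (R : ℝ) : ℝ := Ck + volume.real (ball (0:ℂ) R)

lemma Cd_nonneg (R : ℝ) : 0 ≤ Cd R := add_nonneg Ck_nonneg measureReal_nonneg

lemma integrable_dom (R : ℝ) (z : ℂ) : Integrable (dom R z) ∧ ∫ w, dom R z w = Cd R := by
  obtain ⟨h1, h2⟩ := integrable_kap_scaled 1 one_pos z
  simp only [div_one] at h1 h2
  have h3 : Integrable ((ball (0:ℂ) R).indicator (fun _ => (1:ℝ))) := by
    rw [integrable_indicator_iff measurableSet_ball]
    exact integrableOn_const (measure_ball_lt_top.ne)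
  constructor
  · exact h1.add h3
  · unfold dom Cd
    rw [integral_add h1 h3, h2, integral_indicator measurableSet_ball]
    simp

lemma dom_nonneg (R : ℝ) (z w : ℂ) : 0 ≤ dom R z w := by
  unfold dom
  have := kap_nonneg (norm_nonneg (z - w))
  have : 0 ≤ (ball (0:ℂ) R).indicator (fun _ => (1:ℝ)) w := indicator_nonneg (by simp) _
  positivity

lemma dom_bound (R : ℝ) (z w : ℂ) (hw : ‖w‖ < R) :
    1 / ‖z - w‖ ≤ dom R z w ∧ 1 / (‖z - w‖ * √‖z - w‖) ≤ dom R z w := by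
  have := kap_bound (norm_nonneg (z - w))
  unfold dom
  rw [indicator_of_mem (by simpa using hw)]
  exact this

end KR

namespace KR
open MeasureTheory

variable {W : Type*} [NormedAddCommGroup W] [NormedSpace ℂ W] [CompleteSpace W]
  [SecondCountableTopology W]

lemma two_pi_smul_le (x : W) : ‖(2 * Real.pi)⁻¹ • x‖ ≤ ‖x‖ := by
  rw [norm_smul, Real.norm_eq_abs, abs_of_pos (by positivity)]
  have : (2 * Real.pi)⁻¹ ≤ 1 := by
    apply inv_le_one_of_one_le₀
    nlinarith [Real.pi_gt_three]
  nlinarith [norm_nonneg x]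

lemma cT_integrable {m : ℂ → W} (hm : AEStronglyMeasurable m volume) {K R : ℝ}
    (hK : ∀ w, ‖m w‖ ≤ K) (hR : ∀ w, R ≤ ‖w‖ → m w = 0) (z : ℂ) :
    Integrable (fun w => (z - w)⁻¹ • m w) ∧ ‖cT m z‖ ≤ K * Cd R := by
  have hK0 : 0 ≤ K := (norm_nonneg _).trans (hK 0)
  have hb : ∀ w, ‖(z - w)⁻¹ • m w‖ ≤ K * dom R z w := by
    intro w
    rcases lt_or_ge ‖w‖ R with h | h
    · rw [norm_smul, norm_inv, mul_comm]
      have := (dom_bound R z w h).1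
      rw [one_div] at this
      exact mul_le_mul (hK w) this (by positivity) hK0
    · rw [hR w h, smul_zero, norm_zero]
      exact mul_nonneg hK0 (dom_nonneg R z w)
  have hi := ((integrable_dom R z).1.const_mul K)
  constructor
  · refine hi.mono' ?_ (Eventually.of_forall hb)
    refine AEStronglyMeasurable.smul ?_ hm
    exact ((measurable_const.sub measurable_id).inv).aestronglyMeasurable
  · unfold cT
    refine (two_pi_smul_le _).trans ?_
    refine (norm_integral_le_of_norm_le hi (Eventually.of_forall hb)).trans ?_
    rw [integral_const_mul, (integrable_dom R z).2]

lemma real_kernel_holder {α β t : ℝ} (hα : 0 < α) (hβ : 0 < β) (ht : 0 ≤ t) (h : t ≤ α + β) :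
    t / (α * β) ≤ 2 * √t * (1 / (α * √α) + 1 / (β * √β)) := by
  obtain ⟨p, hp, rfl⟩ : ∃ p : ℝ, 0 < p ∧ α = p ^ 2 := ⟨√α, Real.sqrt_pos.2 hα, (Real.sq_sqrt hα.le).symm⟩
  obtain ⟨q, hq, rfl⟩ : ∃ q : ℝ, 0 < q ∧ β = q ^ 2 := ⟨√β, Real.sqrt_pos.2 hβ, (Real.sq_sqrt hβ.le).symm⟩
  obtain ⟨s, hs, rfl⟩ : ∃ s : ℝ, 0 ≤ s ∧ t = s ^ 2 := ⟨√t, Real.sqrt_nonneg t, (Real.sq_sqrt ht).symm⟩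
  rw [Real.sqrt_sq hp.le, Real.sqrt_sq hq.le, Real.sqrt_sq hs]
  have hspq : s ≤ p + q := by nlinarith
  have h1 : s ^ 2 / (p ^ 2 * q ^ 2) ≤ s * ((p + q) / (p ^ 2 * q ^ 2)) := by
    rw [← mul_div_assoc]; gcongr; nlinarith
  refine h1.trans ?_
  rw [mul_comm 2 s, mul_assoc]
  gcongr
  rw [div_add_div _ _ (by positivity) (by positivity), ← mul_div_assoc,
    div_le_div_iff₀ (by positivity) (by positivity)]
  have : (p + q) * (p * q) ≤ 2 * (q ^ 3 + p ^ 3) := by nlinarith [sq_nonneg (p - q), mul_pos hp hq, mul_nonneg (add_pos hp hq).le (sq_nonneg (p-q)), pow_pos hp 3, pow_pos hq 3]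
  have h2 := mul_le_mul_of_nonneg_right this (show 0 ≤ p ^ 2 * q ^ 2 by positivity)
  nlinarith

lemma cT_holder {m : ℂ → W} (hm : AEStronglyMeasurable m volume) {K R : ℝ}
    (hK : ∀ w, ‖m w‖ ≤ K) (hR : ∀ w, R ≤ ‖w‖ → m w = 0) (z z' : ℂ) :
    ‖cT m z - cT m z'‖ ≤ 4 * Cd R * K * √‖z - z'‖ := by
  have hK0 : 0 ≤ K := (norm_nonneg _).trans (hK 0)
  have i1 := (cT_integrable hm hK hR z).1
  have i2 := (cT_integrable hm hK hR z').1
  unfold cT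
  rw [← smul_sub, ← integral_sub i1 i2]
  refine (two_pi_smul_le _).trans ?_
  have hi : Integrable (fun w => 2 * √‖z - z'‖ * K * (dom R z w + dom R z' w)) :=
    ((integrable_dom R z).1.add (integrable_dom R z').1).const_mul _
  have hb : ∀ᵐ w : ℂ, ‖(z - w)⁻¹ • m w - (z' - w)⁻¹ • m w‖ ≤
      2 * √‖z - z'‖ * K * (dom R z w + dom R z' w) := by
    have n1 : ∀ᵐ w : ℂ, w ≠ z := by simp [ae_iff, measure_singleton]
    have n2 : ∀ᵐ w : ℂ, w ≠ z' := by simp [ae_iff, measure_singleton]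
    filter_upwards [n1, n2] with w h1 h2
    have d1 := dom_nonneg R z w
    have d2 := dom_nonneg R z' w
    rcases lt_or_ge ‖w‖ R with h | h
    · have e1 : z - w ≠ 0 := sub_ne_zero.2 h1.symm
      have e2 : z' - w ≠ 0 := sub_ne_zero.2 h2.symm
      rw [← sub_smul, norm_smul, inv_sub_inv e1 e2, norm_div, norm_mul]
      have e3 : z' - w - (z - w) = - (z - z') := by ring
      rw [e3, norm_neg]
      have := real_kernel_holder (norm_pos_iff.2 e1) (norm_pos_iff.2 e2) (norm_nonneg (z - z'))
        (by have := norm_sub_le (z - w) (z' - w); simpa using this)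
      have b1 := (dom_bound R z w h).2
      have b2 := (dom_bound R z' w h).2
      calc _ ≤ (2 * √‖z - z'‖ * (dom R z w + dom R z' w)) * K := by
            refine mul_le_mul (this.trans ?_) (hK w) (norm_nonneg _) (by positivity)
            gcongr
        _ = _ := by ring
    · rw [hR w h]; simp; positivity
  refine (norm_integral_le_of_norm_le hi hb).trans ?_
  rw [integral_const_mul, integral_add (integrable_dom R z).1 (integrable_dom R z').1,
    (integrable_dom R z).2, (integrable_dom R z').2]
  apply le_of_eq; ring

lemma real_kernel_key {a b t : ℝ} (ha : 0 ≤ a) (hb : 0 ≤ b) (ht : 0 < t) (h : t ≤ a + b) :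
    1 / (a * √a * b) ≤ 6 * (1 / (t * t * √t)) * (kap (a / t) + kap (b / t)) := by
  have := kap_two (a := a / t) (b := b / t) (by positivity) (by positivity)
    (by rw [← add_div, le_div_iff₀ ht]; linarith)
  have e : 1 / (a * √a * b) = (1 / (t * t * √t)) * (1 / (a / t * √(a / t) * (b / t))) := by
    rw [Real.sqrt_div ha]
    have : √t ≠ 0 := (Real.sqrt_pos.2 ht).ne'
    have := ht.ne'
    rcases ha.eq_or_lt with rfl | ha0
    · simp
    rcases hb.eq_or_lt with rfl | hb0
    · simp
    have : √a ≠ 0 := (Real.sqrt_pos.2 ha0).ne'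
    field_simp
  rw [e]
  calc _ ≤ (1 / (t * t * √t)) * (6 * (kap (a / t) + kap (b / t))) := by gcongr
    _ = _ := by ring

/-- The key expansion. -/
lemma cT_key {m : ℂ → W} (hm : AEStronglyMeasurable m volume) {K R : ℝ} (z₀ : ℂ)
    (hK : ∀ w, ‖m w‖ ≤ K * √‖w - z₀‖) (hR : ∀ w, R ≤ ‖w‖ → m w = 0) :
    ∃ b : W, ‖b‖ ≤ 12 * Cd R * K ∧ ∀ z,
      ‖cT m z - cT m z₀ - (z - z₀) • b‖ ≤ 12 * Cd R * K * (‖z - z₀‖ * √‖z - z₀‖) := by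
  have hK0 : 0 ≤ K := by
    have h1 := (norm_nonneg _).trans (hK (z₀ + 1))
    simpa using h1
  obtain ⟨K', hK'⟩ : ∃ K', ∀ w, ‖m w‖ ≤ K' := by
    refine ⟨K * √(|R| + ‖z₀‖), fun w => ?_⟩
    rcases lt_or_ge ‖w‖ R with h | h
    · refine (hK w).trans ?_
      gcongr
      exact (norm_sub_le _ _).trans (by gcongr; exact h.le.trans (le_abs_self R))
    · rw [hR w h, norm_zero]; positivity
  have hCd := Cd_nonneg R
  have hbb : ∀ w, ‖((z₀ - w) ^ 2)⁻¹ • m w‖ ≤ K * dom R z₀ w := by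
    intro w
    rcases lt_or_ge ‖w‖ R with h | h
    · have b1 := (dom_bound R z₀ w h).2
      rw [norm_smul, norm_inv, norm_pow]
      by_cases h0 : w = z₀
      · subst h0; simp; exact mul_nonneg hK0 (dom_nonneg _ _ _)
      have p0 : 0 < ‖z₀ - w‖ := norm_pos_iff.2 (sub_ne_zero.2 (Ne.symm h0))
      have hKw := hK w
      rw [norm_sub_rev] at hKw
      calc _ ≤ (‖z₀ - w‖ ^ 2)⁻¹ * (K * √‖z₀ - w‖) := by gcongr
        _ = K * (1 / (‖z₀ - w‖ * √‖z₀ - w‖)) := by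
            have := Real.sqrt_pos.2 p0
            have e : ‖z₀ - w‖ = √‖z₀ - w‖ ^ 2 := (Real.sq_sqrt p0.le).symm
            field_simp
            rw [← e, mul_comm]
        _ ≤ _ := by gcongr
    · rw [hR w h, smul_zero, norm_zero]
      exact mul_nonneg hK0 (dom_nonneg _ _ _)
  have hbi : Integrable (fun w => ((z₀ - w) ^ 2)⁻¹ • m w) := by
    refine ((integrable_dom R z₀).1.const_mul K).mono' ?_ (Eventually.of_forall hbb)
    refine AEStronglyMeasurable.smul ?_ hm
    exact (((measurable_const.sub measurable_id).pow_const 2).inv).aestronglyMeasurable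
  refine ⟨- ((2 * Real.pi)⁻¹ • ∫ w, ((z₀ - w) ^ 2)⁻¹ • m w), ?_, ?_⟩
  · rw [norm_neg]
    refine (two_pi_smul_le _).trans ((norm_integral_le_of_norm_le
      ((integrable_dom R z₀).1.const_mul K) (Eventually.of_forall hbb)).trans ?_)
    rw [integral_const_mul, (integrable_dom R z₀).2]
    nlinarith [mul_nonneg hCd hK0]
  · intro z
    by_cases hz : z = z₀
    · subst hz; simp
    have ht : 0 < ‖z - z₀‖ := norm_pos_iff.2 (sub_ne_zero.2 hz)
    set t := ‖z - z₀‖ with htd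
    have i1 := (cT_integrable hm hK' hR z).1
    have i2 := (cT_integrable hm hK' hR z₀).1
    have e1 : cT m z - cT m z₀ - (z - z₀) • (-((2 * Real.pi)⁻¹ • ∫ w, ((z₀ - w) ^ 2)⁻¹ • m w))
        = (2 * Real.pi)⁻¹ • ∫ w, ((z - w)⁻¹ • m w - (z₀ - w)⁻¹ • m w
            + (z - z₀) • (((z₀ - w) ^ 2)⁻¹ • m w)) := by
      have i3 := hbi.smul (z - z₀)
      have q1 := integral_add (i1.sub i2) i3
      have q2 := integral_sub i1 i2
      simp only [Pi.sub_apply, Pi.smul_apply] at q1 q2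
      rw [q1, q2, integral_smul]
      unfold cT
      rw [smul_add, smul_sub, smul_neg, sub_neg_eq_add, smul_comm]
    rw [e1]
    refine (two_pi_smul_le _).trans ?_
    have s1 := integrable_kap_scaled t ht z
    have s2 := integrable_kap_scaled t ht z₀
    have hi : Integrable (fun w => K * (t ^ 2 * (6 * (1 / (t * t * √t)))) *
        (kap (‖z₀ - w‖ / t) + kap (‖z - w‖ / t))) := (s2.1.add s1.1).const_mul _
    have hb : ∀ᵐ w : ℂ, ‖(z - w)⁻¹ • m w - (z₀ - w)⁻¹ • m w
            + (z - z₀) • (((z₀ - w) ^ 2)⁻¹ • m w)‖ ≤ K * (t ^ 2 * (6 * (1 / (t * t * √t)))) *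
        (kap (‖z₀ - w‖ / t) + kap (‖z - w‖ / t)) := by
      have n1 : ∀ᵐ w : ℂ, w ≠ z := by simp [ae_iff, measure_singleton]
      have n2 : ∀ᵐ w : ℂ, w ≠ z₀ := by simp [ae_iff, measure_singleton]
      filter_upwards [n1, n2] with w h1 h2
      have f1 : z - w ≠ 0 := sub_ne_zero.2 h1.symm
      have f2 : z₀ - w ≠ 0 := sub_ne_zero.2 h2.symm
      have e2 : (z - w)⁻¹ - (z₀ - w)⁻¹ + (z - z₀) * ((z₀ - w) ^ 2)⁻¹
          = (z - z₀) ^ 2 / ((z₀ - w) ^ 2 * (z - w)) := by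
        field_simp
        ring
      rw [smul_smul, ← sub_smul, ← add_smul, e2, norm_smul, norm_div, norm_mul, norm_pow, norm_pow]
      have hk := real_kernel_key (norm_nonneg (z₀ - w)) (norm_nonneg (z - w)) ht
        (by have := norm_sub_le (z - w) (z₀ - w); rw [htd]; simpa [add_comm] using this)
      have hKw := hK w
      rw [norm_sub_rev] at hKw
      have p0 : 0 < ‖z₀ - w‖ := norm_pos_iff.2 f2
      have p1 : 0 < ‖z - w‖ := norm_pos_iff.2 f1
      calc _ ≤ t ^ 2 / (‖z₀ - w‖ ^ 2 * ‖z - w‖) * (K * √‖z₀ - w‖) := by gcongr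
        _ = K * t ^ 2 * (1 / (‖z₀ - w‖ * √‖z₀ - w‖ * ‖z - w‖)) := by
            have := Real.sqrt_pos.2 p0
            have e : ‖z₀ - w‖ = √‖z₀ - w‖ ^ 2 := (Real.sq_sqrt p0.le).symm
            field_simp
            rw [← e, mul_comm]
        _ ≤ K * t ^ 2 * (6 * (1 / (t * t * √t)) * (kap (‖z₀ - w‖ / t) + kap (‖z - w‖ / t))) := by gcongr
        _ = _ := by ring
    refine (norm_integral_le_of_norm_le hi hb).trans ?_
    rw [integral_const_mul, integral_add s2.1 s1.1, s1.2, s2.2]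
    have hs := Real.sqrt_pos.2 ht
    have e : √t ^ 2 = t := Real.sq_sqrt ht.le
    have e3 : K * (t ^ 2 * (6 * (1 / (t * t * √t)))) * (t ^ 2 * Ck + t ^ 2 * Ck)
        = 12 * Ck * K * (t * √t) := by
      field_simp
      rw [e]; ring
    rw [e3]
    have : Ck ≤ Cd R := by unfold Cd; linarith [measureReal_nonneg (μ := (volume : Measure ℂ)) (s := ball 0 R)]
    gcongr

end KR

namespace KR
open MeasureTheory

variable {W : Type*} [NormedAddCommGroup W] [NormedSpace ℂ W] [CompleteSpace W]
  [SecondCountableTopology W]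

def bmp : ContDiffBump (0:ℂ) := ⟨3, 4, by norm_num, by norm_num⟩

def The (z : ℂ) : ℂ := (bmp z : ℂ) * ((starRingEnd ℂ) z / 2)

lemma contDiff_The : ContDiff ℝ 1 The := by
  unfold The
  refine ContDiff.mul ?_ ?_
  · exact Complex.ofRealCLM.contDiff.comp bmp.contDiff
  · exact (Complex.conjCLE.contDiff).div_const 2

lemma The_eq {z : ℂ} (hz : ‖z‖ ≤ 3) : The z = (starRingEnd ℂ) z / 2 := by
  unfold The
  rw [bmp.one_of_mem_closedBall (by simpa [bmp] using hz)]
  simp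

lemma The_zero {z : ℂ} (hz : 4 ≤ ‖z‖) : The z = 0 := by
  unfold The
  rw [bmp.zero_of_le_dist (by simpa [bmp] using hz)]
  simp

lemma dbar_eq_zero_of {F : ℂ → W} {R : ℝ} (h : ∀ w, R < ‖w‖ → F w = 0) {z : ℂ} (hz : R < ‖z‖) :
    dbar F z = 0 := by
  have : F =ᶠ[𝓝 z] fun _ => 0 := by
    filter_upwards [(isOpen_lt continuous_const continuous_norm).mem_nhds hz] with w hw
    exact h w hw
  unfold dbar
  rw [this.fderiv_eq]
  simp

lemma dbar_The_zero {z : ℂ} (hz : 4 < ‖z‖) : dbar The z = 0 :=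
  dbar_eq_zero_of (fun w hw => The_zero (le_of_lt hw)) hz

lemma continuous_dbar_The : Continuous (dbar The) := by
  unfold dbar
  have := contDiff_The.continuous_fderiv (by norm_num)
  fun_prop

lemma dbar_The_one {z : ℂ} (hz : ‖z‖ < 3) : dbar The z = 1 := by
  have : The =ᶠ[𝓝 z] fun w => (starRingEnd ℂ) w / 2 := by
    filter_upwards [(isOpen_lt continuous_norm continuous_const).mem_nhds hz] with w hw
    exact The_eq (le_of_lt hw)
  have h2 : HasFDerivAt (fun w : ℂ => (starRingEnd ℂ) w / 2)
      ((2:ℂ)⁻¹ • (Complex.conjCLE : ℂ →L[ℝ] ℂ)) z := by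
    have := ((Complex.conjCLE : ℂ →L[ℝ] ℂ).hasFDerivAt (x := z)).const_mul ((2:ℂ)⁻¹)
    refine this.congr_of_eventuallyEq (Eventually.of_forall fun w => ?_)
    simp [div_eq_inv_mul]
  unfold dbar
  rw [this.fderiv_eq, h2.fderiv]
  simp
  ring_nf
  simp
  norm_num

lemma dbar_The_bdd : ∃ T : ℝ, 0 ≤ T ∧ ∀ z, ‖dbar The z‖ ≤ T := by
  have hc : HasCompactSupport (dbar The) := by
    refine HasCompactSupport.of_support_subset_isCompact (isCompact_closedBall (0:ℂ) 4) ?_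
    intro z hz
    by_contra h
    apply hz
    apply dbar_The_zero
    simpa using h
  obtain ⟨T, hT⟩ := continuous_dbar_The.bounded_above_of_compact_support hc
  exact ⟨T, (norm_nonneg _).trans (hT 0), hT⟩

lemma cT_dbar_The (z : ℂ) : cT (dbar The) z = The z := by
  obtain ⟨T, _, hT⟩ := dbar_The_bdd
  exact (pompeiu The (contDiff_The.differentiable (by norm_num)) 4 T
    (fun w hw => The_zero hw) hT z).symm

lemma cT_smul_const (z : ℂ) (c : W) : cT (fun w => dbar The w • c) z = The z • c := by
  rw [← cT_dbar_The z]
  unfold cT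
  simp only [← smul_assoc]
  rw [integral_smul_const, smul_assoc]

/-- Regularity of the Cauchy transform of a Hoelder function. -/
lemma cT_taylor : ∃ C : ℝ, 0 ≤ C ∧ ∀ (h : ℂ → W) (K : ℝ), AEStronglyMeasurable h volume →
    (∀ z, ‖h z‖ ≤ K) → (∀ z w, ‖h z - h w‖ ≤ K * √‖z - w‖) → (∀ z, 2 ≤ ‖z‖ → h z = 0) →
    ∀ z₀, ‖z₀‖ ≤ 2 → ∃ D : ℂ →L[ℝ] W, ‖D‖ ≤ C * K ∧ D 1 + Complex.I • D Complex.I = h z₀ ∧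
      ∀ z, ‖z‖ ≤ 2 → ‖cT h z - cT h z₀ - D (z - z₀)‖ ≤ C * K * (‖z - z₀‖ * √‖z - z₀‖) := by
  obtain ⟨T, hT0, hT⟩ := dbar_The_bdd
  have hCd := Cd_nonneg 5
  refine ⟨12 * Cd 5 * (2 + T) + 1, by positivity, ?_⟩
  intro h K hm hK hH hsupp z₀ hz₀
  have hK0 : 0 ≤ K := (norm_nonneg _).trans (hK 0)
  set m : ℂ → W := fun w => h w - dbar The w • h z₀ with hmd
  have hτm : AEStronglyMeasurable (fun w => dbar The w • h z₀) volume :=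
    (continuous_dbar_The.smul continuous_const).aestronglyMeasurable
  have hmm : AEStronglyMeasurable m volume := hm.sub hτm
  have hmR : ∀ w, 5 ≤ ‖w‖ → m w = 0 := by
    intro w hw
    simp only [hmd]
    rw [hsupp w (by linarith), dbar_The_zero (by linarith)]; simp
  have hmK : ∀ w, ‖m w‖ ≤ ((2 + T) * K) * √‖w - z₀‖ := by
    intro w
    have e : m w = (h w - h z₀) + (1 - dbar The w) • h z₀ := by
      simp only [hmd, sub_smul, one_smul]; abel
    have h1 : ‖(1 - dbar The w) • h z₀‖ ≤ (1 + T) * K * √‖w - z₀‖ := by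
      rcases lt_or_ge ‖w - z₀‖ 1 with h1 | h1
      · have : ‖w‖ < 3 := by
          have := norm_add_le (w - z₀) z₀
          rw [sub_add_cancel] at this; linarith
        rw [dbar_The_one this]; simp; positivity
      · have h2 : 1 ≤ √‖w - z₀‖ := by rw [Real.one_le_sqrt]; exact h1
        rw [norm_smul]
        have h3 : ‖1 - dbar The w‖ ≤ 1 + T := (norm_sub_le _ _).trans (by simpa using hT w)
        have h4 := mul_le_mul h3 (hK z₀) (norm_nonneg _) (by positivity)
        refine h4.trans ?_
        exact le_mul_of_one_le_right (by positivity) h2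
    rw [e]
    refine (norm_add_le _ _).trans ?_
    have := hH w z₀
    linarith
  obtain ⟨b, hb, hb2⟩ := cT_key hmm z₀ hmK hmR
  refine ⟨((ContinuousLinearMap.id ℝ ℂ).smulRight b) + ((2:ℂ)⁻¹ • (Complex.conjCLE : ℂ →L[ℝ] ℂ)).smulRight (h z₀), ?_, ?_, ?_⟩
  · refine ContinuousLinearMap.opNorm_le_bound _ (by positivity) ?_
    intro ξ
    simp only [ContinuousLinearMap.add_apply, ContinuousLinearMap.smulRight_apply, ContinuousLinearMap.smul_apply]
    refine (norm_add_le _ _).trans ?_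
    rw [norm_smul, norm_smul]
    have h1 : ‖(2:ℂ)⁻¹ • (Complex.conjCLE : ℂ →L[ℝ] ℂ) ξ‖ ≤ ‖ξ‖ := by
      rw [norm_smul]; simp; linarith [norm_nonneg ξ]
    have h2 := mul_le_mul h1 (hK z₀) (norm_nonneg _) (norm_nonneg ξ)
    have h3 := mul_le_mul_of_nonneg_left hb (norm_nonneg ξ)
    simp only [ContinuousLinearMap.id_apply]
    refine (add_le_add h3 h2).trans (le_of_eq ?_)
    ring
  · simp
    rw [smul_smul, smul_smul, Complex.I_mul_I]
    have : Complex.I * (2⁻¹ * Complex.I) = - 2⁻¹ := by ring_nf; simp; norm_num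
    rw [this, neg_smul, neg_smul, one_smul]
    have : b + (2:ℂ)⁻¹ • h z₀ + (-b + -(-((2:ℂ)⁻¹ • h z₀))) = ((2:ℂ)⁻¹ + 2⁻¹) • h z₀ := by
      rw [add_smul]; abel
    rw [this]; norm_num
  · intro z hz
    have i1 := fun z => (cT_integrable (R := 5) hm hK (fun w hw => hsupp w (by linarith)) z).1
    have i2 := fun z => (cT_integrable (m := fun w => dbar The w • h z₀) (K := T * K) (R := 5) hτm (fun w => by
      rw [norm_smul]; exact mul_le_mul (hT w) (hK z₀) (norm_nonneg _) hT0) (fun w hw => by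
        rw [dbar_The_zero (by linarith)]; simp) z).1
    have hs : ∀ z, cT h z = cT m z + The z • h z₀ := by
      intro z
      rw [← cT_smul_const]
      unfold cT
      rw [← smul_add, ← integral_add _ (i2 z)]
      · congr 1
        apply integral_congr_ae
        refine Eventually.of_forall fun w => ?_
        simp only [hmd, smul_sub]; abel
      · have := (i1 z).sub (i2 z)
        refine this.congr (Eventually.of_forall fun w => ?_)
        simp only [hmd, smul_sub, Pi.sub_apply]
    rw [hs z, hs z₀, The_eq (by linarith), The_eq (by linarith)]
    have := hb2 z
    have e : cT m z + ((starRingEnd ℂ) z / 2) • h z₀ - (cT m z₀ + ((starRingEnd ℂ) z₀ / 2) • h z₀) -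
      (((ContinuousLinearMap.id ℝ ℂ).smulRight b) + ((2:ℂ)⁻¹ • (Complex.conjCLE : ℂ →L[ℝ] ℂ)).smulRight (h z₀)) (z - z₀)
      = cT m z - cT m z₀ - (z - z₀) • b := by
      simp only [ContinuousLinearMap.add_apply, ContinuousLinearMap.smulRight_apply, ContinuousLinearMap.smul_apply,
        ContinuousLinearMap.id_apply]
      have : (2:ℂ)⁻¹ • (Complex.conjCLE : ℂ →L[ℝ] ℂ) (z - z₀) = (starRingEnd ℂ) z / 2 - (starRingEnd ℂ) z₀ / 2 := by
        simp; ring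
      rw [this, sub_smul ((starRingEnd ℂ) z / 2)]
      abel
    rw [e]
    refine this.trans ?_
    refine mul_le_mul_of_nonneg_right ?_ (by positivity)
    nlinarith [mul_nonneg hCd hK0]

lemma hasFDerivAt_of_taylor {V : Type*} [NormedAddCommGroup V] [NormedSpace ℝ V]
    {f : ℂ → V} {D : ℂ →L[ℝ] V} {z₀ : ℂ} {C : ℝ}
    (h : ∀ᶠ z in 𝓝 z₀, ‖f z - f z₀ - D (z - z₀)‖ ≤ C * (‖z - z₀‖ * √‖z - z₀‖)) :
    HasFDerivAt f D z₀ := by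
  rw [hasFDerivAt_iff_isLittleO]
  have h1 : (fun z => f z - f z₀ - D (z - z₀)) =O[𝓝 z₀] fun z => (‖z - z₀‖ * √‖z - z₀‖) := by
    refine Asymptotics.IsBigO.of_bound C ?_
    filter_upwards [h] with z hz
    refine hz.trans (le_of_eq ?_)
    congr 1
    rw [Real.norm_eq_abs, abs_of_nonneg (by positivity)]
  refine h1.trans_isLittleO ?_
  have h2 : (fun z : ℂ => √‖z - z₀‖) =o[𝓝 z₀] fun _ => (1:ℝ) := by
    rw [Asymptotics.isLittleO_one_iff]
    have : Continuous fun z : ℂ => √‖z - z₀‖ := by fun_prop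
    have := this.tendsto z₀
    simpa using this
  have h3 : (fun z : ℂ => ‖z - z₀‖) =O[𝓝 z₀] fun z => ‖z - z₀‖ := Asymptotics.isBigO_refl _ _
  have := (h3.mul_isLittleO h2)
  simp only [mul_one] at this
  exact this.of_norm_right

lemma holder_of_taylor {V : Type*} [NormedAddCommGroup V] [NormedSpace ℝ V]
    {f : ℂ → V} {D : ℂ → ℂ →L[ℝ] V} {ρ ρ' C B : ℝ} (hρ : ρ' < ρ) (hC : 0 ≤ C) (hB : 0 ≤ B)
    (h : ∀ z₀, ‖z₀‖ < ρ' → ∀ z, ‖z‖ < ρ → ‖f z - f z₀ - D z₀ (z - z₀)‖ ≤ C * (‖z - z₀‖ * √‖z - z₀‖))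
    (hD : ∀ z₀, ‖z₀‖ < ρ' → ‖D z₀‖ ≤ B) :
    ∀ z₀ z₁, ‖z₀‖ < ρ' → ‖z₁‖ < ρ' →
      ‖D z₀ - D z₁‖ ≤ (6 * C + 2 * B / √(ρ - ρ')) * √‖z₀ - z₁‖ := by
  intro z₀ z₁ h0 h1
  by_cases he : z₀ = z₁
  · subst he; simp
  have hδ : 0 < ‖z₀ - z₁‖ := norm_pos_iff.2 (sub_ne_zero.2 he)
  set δ := ‖z₀ - z₁‖ with hδd
  have hs : 0 < √(ρ - ρ') := Real.sqrt_pos.2 (by linarith)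
  have hsδ : 0 < √δ := Real.sqrt_pos.2 hδ
  rcases lt_or_ge δ (ρ - ρ') with hlt | hge
  · suffices ‖D z₀ - D z₁‖ ≤ 6 * C * √δ by
      refine this.trans ?_
      gcongr
      have : 0 ≤ 2 * B / √(ρ - ρ') := by positivity
      linarith
    refine ContinuousLinearMap.opNorm_le_bound _ (by positivity) ?_
    intro ξ
    by_cases hξ : ξ = 0
    · subst hξ; simp
    have hξ0 : 0 < ‖ξ‖ := norm_pos_iff.2 hξ
    set e : ℂ := (δ / ‖ξ‖) • ξ with he
    have hen : ‖e‖ = δ := by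
      rw [he, norm_smul, Real.norm_eq_abs, abs_of_pos (by positivity)]; field_simp
    have t1 := h z₀ h0 (z₀ + e) (by
      refine (norm_add_le _ _).trans_lt ?_; rw [hen]; linarith)
    have t2 := h z₁ h1 (z₀ + e) (by
      refine (norm_add_le _ _).trans_lt ?_; rw [hen]; linarith)
    have t3 := h z₁ h1 z₀ (by linarith)
    rw [add_sub_cancel_left, hen] at t1
    have hn2 : ‖z₀ + e - z₁‖ ≤ 4 * δ := by
      have : z₀ + e - z₁ = (z₀ - z₁) + e := by abel
      rw [this]
      refine (norm_add_le _ _).trans ?_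
      rw [hen, ← hδd]; linarith
    have hn3 : ‖z₀ + e - z₁‖ ≤ 2 * δ := by
      have : z₀ + e - z₁ = (z₀ - z₁) + e := by abel
      rw [this]
      refine (norm_add_le _ _).trans ?_
      rw [hen, ← hδd]; linarith
    have hs2 : √‖z₀ + e - z₁‖ ≤ 2 * √δ := by
      refine (Real.sqrt_le_sqrt hn2).trans ?_
      rw [Real.sqrt_mul (by norm_num), show (4:ℝ) = 2 ^ 2 by norm_num, Real.sqrt_sq (by norm_num)]
    have t2' : ‖f (z₀ + e) - f z₁ - D z₁ (z₀ + e - z₁)‖ ≤ C * (2 * δ * (2 * √δ)) := by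
      refine t2.trans ?_
      gcongr
    have key : (D z₀ - D z₁) e = - (f (z₀ + e) - f z₀ - D z₀ e)
        + (f (z₀ + e) - f z₁ - D z₁ (z₀ + e - z₁)) - (f z₀ - f z₁ - D z₁ (z₀ - z₁)) := by
      have : z₀ + e - z₁ = (z₀ - z₁) + e := by abel
      rw [this, map_add]
      simp only [ContinuousLinearMap.sub_apply]
      abel
    have kb : ‖(D z₀ - D z₁) e‖ ≤ 6 * C * (δ * √δ) := by
      rw [key]
      refine (norm_sub_le _ _).trans ?_
      have := norm_add_le (- (f (z₀ + e) - f z₀ - D z₀ e)) (f (z₀ + e) - f z₁ - D z₁ (z₀ + e - z₁))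
      rw [norm_neg] at this
      rw [← hδd] at t3
      nlinarith
    rw [he, map_smul, norm_smul, Real.norm_eq_abs, abs_of_pos (by positivity)] at kb
    rw [div_mul_eq_mul_div, div_le_iff₀ hξ0] at kb
    have : δ * ‖(D z₀ - D z₁) ξ‖ ≤ δ * (6 * C * √δ * ‖ξ‖) := by
      refine kb.trans (le_of_eq ?_); ring
    exact le_of_mul_le_mul_left this hδ
  · have h2 : ‖D z₀ - D z₁‖ ≤ 2 * B := (norm_sub_le _ _).trans (by linarith [hD z₀ h0, hD z₁ h1])
    refine h2.trans ?_
    have h3 : √(ρ - ρ') ≤ √δ := Real.sqrt_le_sqrt hge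
    have h4 : 2 * B ≤ 2 * B / √(ρ - ρ') * √δ := by
      rw [div_mul_eq_mul_div, le_div_iff₀ hs]; gcongr
    have : 0 ≤ 6 * C * √δ := by positivity
    nlinarith

end KR

namespace KR
open MeasureTheory

variable {W : Type*} [NormedAddCommGroup W] [NormedSpace ℂ W] [CompleteSpace W]
  [SecondCountableTopology W]
variable {V : Type*} [NormedAddCommGroup V] [NormedSpace ℝ V]

def bm2 : ContDiffBump (0:ℂ) := ⟨1/2, 3/4, by norm_num, by norm_num⟩

/-- complex linear embedding of `(V, A)` in `W` -/
def eA (ι : V →L[ℝ] W) (A : V →L[ℝ] V) : V →L[ℝ] W :=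
  ι - Complex.I • (ι.comp A)

lemma eA_apply (ι : V →L[ℝ] W) (A : V →L[ℝ] V) (x : V) : eA ι A x = ι x - Complex.I • ι (A x) := rfl

lemma eA_I (ι : V →L[ℝ] W) (A : V →L[ℝ] V) (hA : ∀ x, A (A x) = -x) (x : V) :
    eA ι A (A x) = Complex.I • eA ι A x := by
  rw [eA_apply, eA_apply, hA, smul_sub, smul_smul, Complex.I_mul_I]
  simp [add_comm]

lemma eA_norm (ι : V →L[ℝ] W) (A : V →L[ℝ] V) {c : ℝ} (hA : ‖A‖ ≤ c) (x : V) :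
    ‖eA ι A x‖ ≤ ‖ι‖ * (1 + c) * ‖x‖ := by
  rw [eA_apply]
  refine (norm_sub_le _ _).trans ?_
  rw [norm_smul, Complex.norm_I, one_mul]
  have h1 := ι.le_opNorm x
  have h2 : ‖ι (A x)‖ ≤ ‖ι‖ * (c * ‖x‖) := by
    refine (ι.le_opNorm _).trans ?_
    gcongr
    exact (A.le_opNorm x).trans (by gcongr)
  nlinarith

lemma bm2_bdd : ∃ T : ℝ, 0 ≤ T ∧ ∀ z, ‖fderiv ℝ bm2 z‖ ≤ T := by
  have hc : HasCompactSupport (fderiv ℝ bm2) := bm2.hasCompactSupport.fderiv ℝ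
  have : Continuous (fderiv ℝ bm2) := (bm2.contDiff (n := 1)).continuous_fderiv (by norm_num)
  obtain ⟨T, hT⟩ := this.bounded_above_of_compact_support hc
  exact ⟨T, (norm_nonneg _).trans (hT 0), hT⟩

lemma regIa (ι : V →L[ℝ] W) (ψ : W →L[ℝ] V) (hψι : ∀ x, ψ (ι x) = x)
    (hψI : ∀ x, ψ (Complex.I • ι x) = 0) (CA : ℝ) (hCA : 0 ≤ CA) : ∃ C : ℝ, 0 ≤ C ∧
    ∀ (f : ℂ → V) (A : ℂ → V →L[ℝ] V) (Λ H M : ℝ), 0 ≤ H →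
    (∀ z ∈ ball (0:ℂ) 1, DifferentiableAt ℝ f z ∧ ‖fderiv ℝ f z‖ ≤ Λ ∧
      fderiv ℝ f z Complex.I = A z (fderiv ℝ f z 1) ∧ (∀ x, A z (A z x) = -x) ∧
      ‖A z - A 0‖ ≤ H * √‖z‖ ∧ ‖f z - f 0‖ ≤ M) → ‖A 0‖ ≤ CA →
    ‖fderiv ℝ f 0‖ ≤ C * (H * Λ + M) ∧ ∀ z ∈ ball (0:ℂ) (1/2),
      ‖f z - f 0 - fderiv ℝ f 0 z‖ ≤ C * (H * Λ + M) * (‖z‖ * √‖z‖) := by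
  obtain ⟨T, hT0, hT⟩ := bm2_bdd
  have hCd := Cd_nonneg 1
  set E : ℝ := ‖ι‖ * (1 + CA) with hE
  have hE0 : 0 ≤ E := by positivity
  refine ⟨‖ψ‖ * (12 * Cd 1 * (E * (1 + 4 * T))), by positivity, ?_⟩
  intro f A Λ H M hH hf hA0
  have h01 : (0:ℂ) ∈ ball (0:ℂ) 1 := by simp
  have hΛ : 0 ≤ Λ := (norm_nonneg _).trans (hf 0 h01).2.1
  have hM : 0 ≤ M := (norm_nonneg _).trans (hf 0 h01).2.2.2.2.2
  set e := eA ι (A 0) with he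
  have hen : ∀ x, ‖e x‖ ≤ E * ‖x‖ := eA_norm ι (A 0) hA0
  have heI : ∀ x, e (A 0 x) = Complex.I • e x := eA_I ι (A 0) (hf 0 h01).2.2.2.1
  have hψe : ∀ x, ψ (e x) = x := by
    intro x
    rw [he, eA_apply, map_sub, hψI, hψι, sub_zero]
  set F : ℂ → W := fun z => bm2 z • e (f z - f 0) with hF
  have hF0 : ∀ w, 3/4 ≤ ‖w‖ → F w = 0 := by
    intro w hw
    simp only [hF]
    rw [bm2.zero_of_le_dist (by simpa [bm2] using hw), zero_smul]
  -- derivative of F in the ball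
  have hFd : ∀ z ∈ ball (0:ℂ) 1, HasFDerivAt F (bm2 z • e.comp (fderiv ℝ f z) +
      (fderiv ℝ bm2 z).smulRight (e (f z - f 0))) z := by
    intro z hz
    have h1 : HasFDerivAt (fun z => e (f z - f 0)) (e.comp (fderiv ℝ f z)) z :=
      e.hasFDerivAt.comp z ((hf z hz).1.hasFDerivAt.sub_const (f 0))
    have h2 : HasFDerivAt bm2 (fderiv ℝ bm2 z) z :=
      ((bm2.contDiff (n := 1)).differentiable (by norm_num) z).hasFDerivAt
    exact h2.smul h1
  have hFdiff : Differentiable ℝ F := by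
    intro z
    by_cases hz : z ∈ ball (0:ℂ) 1
    · exact (hFd z hz).differentiableAt
    · have hz' : 3/4 < ‖z‖ := by
        simp at hz; linarith
      have : F =ᶠ[𝓝 z] fun _ => 0 := by
        filter_upwards [(isOpen_lt continuous_const continuous_norm).mem_nhds hz'] with w hw
        exact hF0 w (le_of_lt hw)
      exact (differentiableAt_const (0:W)).congr_of_eventuallyEq this
  set K : ℝ := E * (1 + 4 * T) * (H * Λ + M) with hKd
  have hbd : ∀ z, ‖dbar F z‖ ≤ K * √‖z‖ := by
    intro z
    by_cases hz : z ∈ ball (0:ℂ) 1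
    · obtain ⟨_, h2, h3, h4, h5, h6⟩ := hf z hz
      have hd : dbar F z = bm2 z • e ((A 0 - A z) (fderiv ℝ f z Complex.I)) +
          ((fderiv ℝ bm2 z 1) • e (f z - f 0) + Complex.I • ((fderiv ℝ bm2 z Complex.I) • e (f z - f 0))) := by
        unfold dbar
        rw [(hFd z hz).fderiv]
        simp only [ContinuousLinearMap.add_apply, ContinuousLinearMap.smul_apply,
          ContinuousLinearMap.comp_apply, ContinuousLinearMap.smulRight_apply, smul_add]
        have : e ((A 0 - A z) (fderiv ℝ f z Complex.I)) =
            e (fderiv ℝ f z 1) + Complex.I • e (fderiv ℝ f z Complex.I) := by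
          rw [ContinuousLinearMap.sub_apply, map_sub, heI]
          rw [show A z (fderiv ℝ f z Complex.I) = - fderiv ℝ f z 1 by rw [h3, h4]]
          rw [map_neg]; abel
        rw [this, smul_add, smul_comm Complex.I (bm2 z)]
        abel
      have b1 : ‖bm2 z • e ((A 0 - A z) (fderiv ℝ f z Complex.I))‖ ≤ E * (H * √‖z‖ * Λ) := by
        rw [norm_smul, Real.norm_eq_abs, abs_of_nonneg bm2.nonneg]
        have q1 : ‖fderiv ℝ f z Complex.I‖ ≤ Λ := by
          refine ((fderiv ℝ f z).le_opNorm _).trans ?_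
          simpa using h2
        have q2 : ‖(A 0 - A z) (fderiv ℝ f z Complex.I)‖ ≤ H * √‖z‖ * Λ := by
          refine ((A 0 - A z).le_opNorm _).trans ?_
          rw [norm_sub_rev]
          gcongr
        calc _ ≤ 1 * ‖e ((A 0 - A z) (fderiv ℝ f z Complex.I))‖ := by
              gcongr; exact bm2.le_one
          _ ≤ _ := by rw [one_mul]; exact (hen _).trans (by gcongr)
      have b2 : ‖((fderiv ℝ bm2 z 1) • e (f z - f 0) + Complex.I • ((fderiv ℝ bm2 z Complex.I) • e (f z - f 0)))‖
          ≤ 4 * T * (E * M) * √‖z‖ := by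
        rcases lt_or_ge ‖z‖ (1/2) with hlt | hge
        · have : (bm2 : ℂ → ℝ) =ᶠ[𝓝 z] fun _ => 1 := by
            filter_upwards [(isOpen_lt continuous_norm continuous_const).mem_nhds hlt] with w hw
            exact bm2.one_of_mem_closedBall (by simpa [bm2] using le_of_lt hw)
          rw [this.fderiv_eq]
          simp
          positivity
        · have hsq : 1/2 ≤ √‖z‖ := by
            rw [Real.le_sqrt' (by norm_num)]; linarith
          have q1 : ‖fderiv ℝ bm2 z 1‖ ≤ T := by
            refine ((fderiv ℝ bm2 z).le_opNorm _).trans ?_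
            simpa using hT z
          have q2 : ‖fderiv ℝ bm2 z Complex.I‖ ≤ T := by
            refine ((fderiv ℝ bm2 z).le_opNorm _).trans ?_
            simpa using hT z
          have q3 : ‖e (f z - f 0)‖ ≤ E * M := (hen _).trans (by gcongr)
          refine (norm_add_le _ _).trans ?_
          rw [norm_smul, norm_smul, norm_smul, Complex.norm_I, one_mul]
          have := mul_le_mul q1 q3 (norm_nonneg _) hT0
          have := mul_le_mul q2 q3 (norm_nonneg _) hT0
          have : 0 ≤ T * (E * M) := by positivity
          nlinarith
      rw [hd]
      refine (norm_add_le _ _).trans ((add_le_add b1 b2).trans ?_)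
      rw [hKd]
      have p1 : 0 ≤ E * M * √‖z‖ := by positivity
      have p2 : 0 ≤ T * (E * (H * Λ)) * √‖z‖ := by positivity
      nlinarith
    · rw [dbar_eq_zero_of (R := 3/4) (fun w hw => hF0 w (le_of_lt hw)) (by simp at hz; linarith)]
      simp
      positivity
  have hK0 : 0 ≤ K := by positivity
  have hsup : ∀ w, 1 ≤ ‖w‖ → dbar F w = 0 := fun w hw =>
    dbar_eq_zero_of (R := 3/4) (fun w hw => hF0 w (le_of_lt hw)) (by linarith)
  have hglob : ∀ w, ‖dbar F w‖ ≤ K := by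
    intro w
    rcases lt_or_ge ‖w‖ 1 with h | h
    · refine (hbd w).trans (mul_le_of_le_one_right hK0 ?_)
      rw [Real.sqrt_le_one]; exact h.le
    · rw [hsup w h, norm_zero]; exact hK0
  have hP := pompeiu F hFdiff (3/4) K hF0 hglob
  obtain ⟨b, hb1, hb2⟩ := cT_key (stronglyMeasurable_dbar F).aestronglyMeasurable (K := K) (R := 1) 0
    (by simpa using hbd) hsup
  have hF00 : F 0 = 0 := by simp [hF]
  have hFone : ∀ z ∈ ball (0:ℂ) (1/2), F z = e (f z - f 0) := by
    intro z hz
    simp only [hF]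
    rw [bm2.one_of_mem_closedBall (ball_subset_closedBall hz), one_smul]
  set D : ℂ →L[ℝ] V := ψ.comp ((ContinuousLinearMap.id ℝ ℂ).smulRight b) with hD
  set C1 := ‖ψ‖ * (12 * Cd 1 * (E * (1 + 4 * T))) with hC1
  have hDn : ‖D‖ ≤ C1 * (H * Λ + M) := by
    refine ContinuousLinearMap.opNorm_le_bound _ (by positivity) fun ξ => ?_
    simp only [hD, ContinuousLinearMap.comp_apply, ContinuousLinearMap.smulRight_apply, ContinuousLinearMap.id_apply]
    refine (ψ.le_opNorm _).trans ?_
    rw [norm_smul]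
    calc ‖ψ‖ * (‖ξ‖ * ‖b‖) ≤ ‖ψ‖ * (‖ξ‖ * (12 * Cd 1 * K)) := by gcongr
      _ = _ := by rw [hC1, hKd]; ring
  have hTay : ∀ z ∈ ball (0:ℂ) (1/2), ‖f z - f 0 - D (z - 0)‖ ≤ C1 * (H * Λ + M) * (‖z - 0‖ * √‖z - 0‖) := by
    intro z hz
    have h1 := hb2 z
    rw [← hP z, ← hP 0, hF00, hFone z hz, sub_zero] at h1
    have h2 : f z - f 0 - D (z - 0) = ψ (e (f z - f 0) - (z - 0) • b) := by
      rw [map_sub ψ, hψe]; rfl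
    rw [h2]
    refine (ψ.le_opNorm _).trans ?_
    calc _ ≤ ‖ψ‖ * (12 * Cd 1 * K * (‖z - 0‖ * √‖z - 0‖)) := by gcongr
      _ = _ := by rw [hC1, hKd]; ring
  have hder : HasFDerivAt f D 0 := by
    apply hasFDerivAt_of_taylor (C := C1 * (H * Λ + M))
    filter_upwards [ball_mem_nhds (0:ℂ) (by norm_num : (0:ℝ) < 1/2)] with z hz using hTay z hz
  rw [hder.fderiv]
  refine ⟨hDn, fun z hz => ?_⟩
  simpa using hTay z hz

lemma regIa' (ι : V →L[ℝ] W) (ψ : W →L[ℝ] V) (hψι : ∀ x, ψ (ι x) = x)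
    (hψI : ∀ x, ψ (Complex.I • ι x) = 0) (CA : ℝ) (hCA : 0 ≤ CA) : ∃ C : ℝ, 0 ≤ C ∧
    ∀ (f : ℂ → V) (A : ℂ → V →L[ℝ] V) (Λ H M : ℝ) (z₀ : ℂ) (ρ : ℝ), 0 < ρ → 0 ≤ H →
    (∀ z ∈ ball z₀ ρ, DifferentiableAt ℝ f z ∧ ‖fderiv ℝ f z‖ ≤ Λ ∧
      fderiv ℝ f z Complex.I = A z (fderiv ℝ f z 1) ∧ (∀ x, A z (A z x) = -x) ∧
      ‖A z - A z₀‖ ≤ H * √‖z - z₀‖ ∧ ‖f z - f z₀‖ ≤ M) → ‖A z₀‖ ≤ CA →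
    ρ * ‖fderiv ℝ f z₀‖ ≤ C * (H * √ρ * (ρ * Λ) + M) ∧ ∀ z ∈ ball z₀ (ρ/2),
      ‖f z - f z₀ - fderiv ℝ f z₀ (z - z₀)‖ ≤
        C * (H * √ρ * (ρ * Λ) + M) * ((‖z - z₀‖ / ρ) * √(‖z - z₀‖ / ρ)) := by
  obtain ⟨C, hC, hmain⟩ := regIa ι ψ hψι hψI CA hCA
  refine ⟨C, hC, ?_⟩
  intro f A Λ H M z₀ ρ hρ hH hf hA0
  set g : ℂ → V := fun z => f (z₀ + ρ • z) with hg
  have hmem : ∀ z ∈ ball (0:ℂ) 1, z₀ + ρ • z ∈ ball z₀ ρ := by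
    intro z hz
    simp only [mem_ball, dist_self_add_left, norm_smul, Real.norm_eq_abs, abs_of_pos hρ]
    simp at hz
    simpa using mul_lt_mul_of_pos_left hz hρ
  have hgd : ∀ z ∈ ball (0:ℂ) 1, HasFDerivAt g (ρ • fderiv ℝ f (z₀ + ρ • z)) z := by
    intro z hz
    have h1 : HasFDerivAt (fun z : ℂ => z₀ + ρ • z) (ρ • ContinuousLinearMap.id ℝ ℂ) z :=
      ((hasFDerivAt_id z).const_smul ρ).const_add z₀
    have h2 := ((hf _ (hmem z hz)).1.hasFDerivAt).comp z h1
    refine h2.congr_fderiv ?_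
    ext <;> simp
  have := hmain g (fun z => A (z₀ + ρ • z)) (ρ * Λ) (H * √ρ) M (by positivity) (by
    intro z hz
    obtain ⟨h1, h2, h3, h4, h5, h6⟩ := hf _ (hmem z hz)
    refine ⟨(hgd z hz).differentiableAt, ?_, ?_, h4, ?_, ?_⟩
    · rw [(hgd z hz).fderiv, norm_smul, Real.norm_eq_abs, abs_of_pos hρ]; gcongr
    · rw [(hgd z hz).fderiv, ContinuousLinearMap.smul_apply, ContinuousLinearMap.smul_apply, h3, map_smul]
    · simp only [smul_zero, add_zero]
      refine h5.trans (le_of_eq ?_)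
      rw [add_sub_cancel_left, norm_smul, Real.norm_eq_abs, abs_of_pos hρ, Real.sqrt_mul hρ.le]
      ring
    · simp only [hg, smul_zero, add_zero]; exact h6) (by simpa using hA0)
  have hg0 := (hgd 0 (by simp)).fderiv
  rw [hg0] at this
  simp only [smul_zero, add_zero] at this
  refine ⟨?_, ?_⟩
  · have h1 := this.1
    rwa [norm_smul, Real.norm_eq_abs, abs_of_pos hρ] at h1
  · intro z hz
    have hn : ‖(ρ⁻¹ • (z - z₀))‖ = ‖z - z₀‖ / ρ := by
      rw [norm_smul, norm_inv, Real.norm_eq_abs, abs_of_pos hρ, div_eq_inv_mul]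
    have h2 := this.2 (ρ⁻¹ • (z - z₀)) (by
      rw [mem_ball_zero_iff, hn, div_lt_iff₀ hρ]
      rw [mem_ball, dist_eq_norm] at hz
      linarith)
    rw [hn] at h2
    have e1 : z₀ + ρ • ρ⁻¹ • (z - z₀) = z := by
      rw [smul_smul, mul_inv_cancel₀ hρ.ne', one_smul]; abel
    have e2 : (ρ • fderiv ℝ f z₀) (ρ⁻¹ • (z - z₀)) = fderiv ℝ f z₀ (z - z₀) := by
      rw [ContinuousLinearMap.smul_apply, map_smul, smul_smul, mul_inv_cancel₀ hρ.ne', one_smul]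
    rw [e2] at h2
    simp only [hg, e1, smul_zero, add_zero] at h2
    exact h2

end KR

namespace KR
open MeasureTheory

variable {W : Type*} [NormedAddCommGroup W] [NormedSpace ℂ W] [CompleteSpace W]
  [SecondCountableTopology W]
variable {V : Type*} [NormedAddCommGroup V] [NormedSpace ℝ V]

def GoodOn (J : V → V →L[ℝ] V) (S : Set V) (CA L : ℝ) : Prop :=
  (∀ x ∈ S, ‖J x‖ ≤ CA ∧ ∀ y, J x (J x y) = -y) ∧ ∀ x ∈ S, ∀ y ∈ S, ‖J x - J y‖ ≤ L * ‖x - y‖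

lemma regIb (ι : V →L[ℝ] W) (ψ : W →L[ℝ] V) (hψι : ∀ x, ψ (ι x) = x)
    (hψI : ∀ x, ψ (Complex.I • ι x) = 0) (CA L : ℝ) (hCA : 0 ≤ CA) (hL : 0 ≤ L) :
    ∃ C ε : ℝ, 0 ≤ C ∧ 0 < ε ∧
    ∀ (J : V → V →L[ℝ] V) (S : Set V) (f : ℂ → V) (z₀ : ℂ) (d ω B : ℝ), 0 < d → GoodOn J S CA L →
    (∀ z ∈ ball z₀ d, DifferentiableAt ℝ f z ∧ ‖fderiv ℝ f z‖ ≤ B ∧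
      fderiv ℝ f z Complex.I = J (f z) (fderiv ℝ f z 1) ∧ f z ∈ S) →
    (∀ z ∈ ball z₀ d, ∀ w ∈ ball z₀ d, ‖f z - f w‖ ≤ ω) → ω ≤ ε →
    d * ‖fderiv ℝ f z₀‖ ≤ C * ω := by
  obtain ⟨C, hC, hmain⟩ := regIa' ι ψ hψι hψI CA hCA
  have hpos : 0 < C * L + 1 := by positivity
  refine ⟨4 * C, min ((1 / (4 * (C * L + 1))) ^ 2) (1 / (8 * (C + 1))), by positivity,
    by positivity, ?_⟩
  intro J S f z₀ d ω B hd hJ hf hosc hω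
  have hz0 : z₀ ∈ ball z₀ d := mem_ball_self hd
  have hω0 : 0 ≤ ω := (norm_nonneg _).trans (hosc z₀ hz0 z₀ hz0)
  have hB : 0 ≤ B := (norm_nonneg _).trans (hf z₀ hz0).2.1
  have hω1 : C * L * √ω ≤ 1 / 4 := by
    have h1 : √ω ≤ 1 / (4 * (C * L + 1)) := by
      rw [Real.sqrt_le_left (by positivity)]
      exact hω.trans (min_le_left _ _)
    calc C * L * √ω ≤ C * L * (1 / (4 * (C * L + 1))) := by gcongr
      _ ≤ 1 / 4 := by
        rw [mul_one_div, div_le_div_iff₀ (by positivity) (by positivity)]; nlinarith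
  have hω2 : C * ω ≤ 1 / 8 := by
    have h1 : ω ≤ 1 / (8 * (C + 1)) := hω.trans (min_le_right _ _)
    calc C * ω ≤ C * (1 / (8 * (C + 1))) := by gcongr
      _ ≤ 1 / 8 := by
        rw [mul_one_div, div_le_div_iff₀ (by positivity) (by positivity)]; nlinarith
  set T : Set ℝ := (fun z => (d - ‖z - z₀‖) * ‖fderiv ℝ f z‖) '' ball z₀ d with hT
  have hTb : BddAbove T := by
    refine ⟨d * B, ?_⟩
    rintro _ ⟨z, hz, rfl⟩
    have h1 : d - ‖z - z₀‖ ≤ d := by linarith [norm_nonneg (z - z₀)]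
    exact mul_le_mul h1 (hf z hz).2.1 (norm_nonneg _) hd.le
  have hTn : T.Nonempty := ⟨_, z₀, hz0, rfl⟩
  set M := sSup T with hM
  have hle : ∀ z ∈ ball z₀ d, (d - ‖z - z₀‖) * ‖fderiv ℝ f z‖ ≤ M := fun z hz =>
    le_csSup hTb ⟨z, hz, rfl⟩
  have hgoal : d * ‖fderiv ℝ f z₀‖ ≤ M := by simpa using hle z₀ hz0
  have hM0 : 0 ≤ M := le_trans (by positivity) hgoal
  -- main inequality
  have hineq : ∀ s : ℝ, 0 < s → s ≤ 1 / 2 → s * M ≤ C * (L * √ω * (2 * s * M * √(2 * s * M)) + ω) := by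
    intro s hs hs2
    have : M ≤ (C * (L * √ω * (2 * s * M * √(2 * s * M)) + ω)) / s := by
      refine csSup_le hTn ?_
      rintro _ ⟨z, hz, rfl⟩
      rw [le_div_iff₀ hs]
      have hδ : 0 < d - ‖z - z₀‖ := by
        rw [mem_ball, dist_eq_norm] at hz; linarith
      set δ := d - ‖z - z₀‖ with hδd
      have hsub : ∀ w ∈ ball z (s * δ), w ∈ ball z₀ d ∧ δ / 2 ≤ d - ‖w - z₀‖ := by
        intro w hw
        rw [mem_ball, dist_eq_norm] at hw
        have h1 : ‖w - z₀‖ ≤ ‖w - z‖ + ‖z - z₀‖ := by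
          have := norm_add_le (w - z) (z - z₀); simpa using this
        have h2 : s * δ ≤ δ / 2 := by nlinarith
        constructor
        · rw [mem_ball, dist_eq_norm]; linarith
        · linarith
      have hΛ : ∀ w ∈ ball z (s * δ), ‖fderiv ℝ f w‖ ≤ 2 * M / δ := by
        intro w hw
        obtain ⟨h1, h2⟩ := hsub w hw
        have h3 := hle w h1
        rw [le_div_iff₀ hδ]
        nlinarith [norm_nonneg (fderiv ℝ f w)]
      have hlip : ∀ w ∈ ball z (s * δ), ‖f w - f z‖ ≤ 2 * M / δ * ‖w - z‖ := by
        intro w hw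
        exact (convex_ball z (s * δ)).norm_image_sub_le_of_norm_fderiv_le (𝕜 := ℝ)
          (fun x hx => (hf x (hsub x hx).1).1) hΛ (mem_ball_self (by positivity)) hw
      have hres := hmain f (fun w => J (f w)) (2 * M / δ) (L * √(ω * (2 * M / δ))) ω z (s * δ)
        (by positivity) (by positivity) (by
          intro w hw
          obtain ⟨h1, h2⟩ := hsub w hw
          obtain ⟨g1, g2, g3, g4⟩ := hf w h1
          refine ⟨g1, hΛ w hw, g3, (hJ.1 _ g4).2, ?_, hosc w h1 z hz⟩
          refine (hJ.2 _ g4 _ (hf z hz).2.2.2).trans ?_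
          rw [mul_assoc]
          gcongr
          rw [← Real.sqrt_mul (by positivity)]
          apply Real.le_sqrt_of_sq_le
          rw [sq, mul_assoc]
          exact mul_le_mul (hosc w h1 z hz) (hlip w hw) (norm_nonneg _) hω0)
        (hJ.1 _ (hf z hz).2.2.2).1
      have h1 := hres.1
      have e1 : s * δ * (2 * M / δ) = 2 * s * M := by field_simp
      have e2 : L * √(ω * (2 * M / δ)) * √(s * δ) = L * √ω * √(2 * s * M) := by
        rw [mul_assoc, ← Real.sqrt_mul (by positivity), mul_assoc L, ← Real.sqrt_mul hω0, ← e1]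
        congr 2; ring
      rw [e1, e2] at h1
      calc _ = s * δ * ‖fderiv ℝ f z‖ := by ring
        _ ≤ _ := h1
        _ = _ := by ring
    rw [le_div_iff₀ hs] at this
    linarith
  refine hgoal.trans ?_
  rcases le_or_gt 1 M with h1 | h1
  · exfalso
    have := hineq (1 / (2 * M)) (by positivity) (by
      rw [div_le_div_iff₀ (by positivity) (by positivity)]; linarith)
    have e : 2 * (1 / (2 * M)) * M = 1 := by field_simp
    rw [e, Real.sqrt_one] at this
    have e2 : 1 / (2 * M) * M = 1 / 2 := by field_simp
    rw [e2] at this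
    nlinarith
  · have := hineq (1 / 2) (by norm_num) le_rfl
    have e : 2 * (1 / 2 : ℝ) * M = M := by ring
    rw [e] at this
    have hs : √M ≤ 1 := by rw [Real.sqrt_le_one]; exact h1.le
    have h3 : C * (L * √ω * (M * √M)) ≤ 1 / 4 * M := by
      calc C * (L * √ω * (M * √M)) = (C * L * √ω) * (M * √M) := by ring
        _ ≤ 1 / 4 * (M * 1) := by gcongr
        _ = _ := by ring
    linarith

def LocGood (J : V → V →L[ℝ] V) (a : V) : Prop :=
  ∃ CA L η : ℝ, 0 ≤ CA ∧ 0 ≤ L ∧ 0 < η ∧ GoodOn J (ball a η) CA L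

lemma regIc (ι : V →L[ℝ] W) (ψ : W →L[ℝ] V) (hψι : ∀ x, ψ (ι x) = x)
    (hψI : ∀ x, ψ (Complex.I • ι x) = 0) (J : V → V →L[ℝ] V) (U : Set ℂ) (hU : IsOpen U)
    (f : ℂ → V) (hf : ∀ z ∈ U, DifferentiableAt ℝ f z ∧
      fderiv ℝ f z Complex.I = J (f z) (fderiv ℝ f z 1) ∧ LocGood J (f z)) :
    ∀ z ∈ U, ∃ C : ℝ, ∀ᶠ w in 𝓝 z, ‖fderiv ℝ f w‖ ≤ C := by
  by_contra hcon
  push Not at hcon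
  set Reg : Set ℂ := {z | ∃ C : ℝ, ∀ᶠ w in 𝓝 z, ‖fderiv ℝ f w‖ ≤ C} with hReg
  have hRegO : IsOpen Reg := by
    rw [isOpen_iff_mem_nhds]
    rintro z ⟨C, hC⟩
    filter_upwards [hC.eventually_nhds] with w hw using ⟨C, hw⟩
  set E : Set ℂ := U \ Reg with hE
  have hEn : E.Nonempty := by
    obtain ⟨z, hz, h⟩ := hcon
    refine ⟨z, hz, ?_⟩
    rintro ⟨C, hC⟩
    exact h C (hC.mono fun x hx => not_lt.2 hx)
  have hElc : IsLocallyClosed E := by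
    rw [hE, diff_eq]
    exact hU.isLocallyClosed.inter hRegO.isClosed_compl.isLocallyClosed
  haveI : LocallyCompactSpace E := hElc.locallyCompactSpace
  haveI : Nonempty E := hEn.to_subtype
  set Ek : ℕ → Set E := fun k => {z : E | ∀ w ∈ U, ‖w - z‖ ≤ 1 / ((k:ℝ) + 1) →
    ‖f w - f z‖ ≤ ((k:ℝ) + 1) * ‖w - z‖} with hEk
  have hfc : ∀ z ∈ U, ContinuousAt f z := fun z hz => (hf z hz).1.continuousAt
  have hcl : ∀ k, IsClosed (Ek k) := by
    intro k
    rw [← isSeqClosed_iff_isClosed]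
    intro zs z hzs hz w hw hwz
    have hz' : Tendsto (fun j => ((zs j : E) : ℂ)) atTop (𝓝 (z:ℂ)) :=
      (continuous_subtype_val.tendsto z).comp hz
    have hwj : Tendsto (fun j => w + ((zs j : ℂ) - z)) atTop (𝓝 w) := by
      have : Tendsto (fun j => w + ((zs j : ℂ) - z)) atTop (𝓝 (w + ((z:ℂ) - z))) :=
        (hz'.sub_const (z:ℂ)).const_add w
      simpa using this
    have hev : ∀ᶠ j in atTop, w + ((zs j : ℂ) - z) ∈ U := hwj (hU.mem_nhds hw)
    have hlim : Tendsto (fun j => ‖f (w + ((zs j : ℂ) - z)) - f (zs j)‖) atTop (𝓝 ‖f w - f z‖) :=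
      (((hfc w hw).tendsto.comp hwj).sub ((hfc z z.2.1).tendsto.comp hz')).norm
    refine le_of_tendsto hlim ?_
    filter_upwards [hev] with j hj
    have e : w + ((zs j : ℂ) - z) - zs j = w - z := by abel
    have := hzs j _ hj (by rw [e]; exact hwz)
    rwa [e] at this
  have hun : ⋃ k, Ek k = univ := by
    rw [eq_univ_iff_forall]
    intro z
    have hO := (hf z z.2.1).1.hasFDerivAt.isBigO_sub
    obtain ⟨c, hc⟩ := hO.bound
    obtain ⟨δ, hδ, hcδ⟩ := Metric.eventually_nhds_iff.1 hc
    obtain ⟨k, hk⟩ := exists_nat_gt (max c (1 / δ))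
    rw [mem_iUnion]
    refine ⟨k, fun w hw hwz => ?_⟩
    have hk1 : c ≤ (k:ℝ) + 1 := by linarith [le_max_left c (1/δ)]
    have hk2 : 1 / δ < (k:ℝ) + 1 := by linarith [le_max_right c (1/δ)]
    have hlt : 1 / ((k:ℝ) + 1) < δ := by
      rw [div_lt_iff₀ hδ] at hk2
      rw [div_lt_iff₀ (by positivity)]; linarith
    have := hcδ (y := w) (by rw [dist_eq_norm]; linarith)
    exact this.trans (by gcongr)
  obtain ⟨k, ⟨e₀, he₀⟩⟩ := nonempty_interior_of_iUnion_of_closed hcl hun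
  rw [mem_interior_iff_mem_nhds, Metric.mem_nhds_iff] at he₀
  obtain ⟨r₀, hr₀, hsub₀⟩ := he₀
  have hEkr : ∀ e ∈ E, ‖e - e₀‖ < r₀ → ∀ w ∈ U, ‖w - e‖ ≤ 1 / ((k:ℝ) + 1) →
      ‖f w - f e‖ ≤ ((k:ℝ) + 1) * ‖w - e‖ := by
    intro e he hlt w hw hwe
    have : (⟨e, he⟩ : E) ∈ Ek k := hsub₀ (by rw [mem_ball, Subtype.dist_eq, dist_eq_norm]; exact hlt)
    exact this w hw hwe
  obtain ⟨CA, L, η, hCA, hL, hη, hgood⟩ := (hf e₀ e₀.2.1).2.2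
  obtain ⟨C, ε, hC, hε, hIb⟩ := regIb ι ψ hψι hψI CA L hCA hL
  -- choose r
  obtain ⟨r₁, hr₁, hball⟩ := Metric.mem_nhds_iff.1 (Filter.inter_mem (hU.mem_nhds e₀.2.1)
    ((hfc e₀ e₀.2.1).preimage_mem_nhds (ball_mem_nhds (f e₀) hη)))
  set k1 : ℝ := (k:ℝ) + 1 with hk1
  have hk1p : 0 < k1 := by positivity
  obtain ⟨r, hr, hr4⟩ : ∃ r > 0, r ≤ r₀ / 4 ∧ r ≤ r₁ / 4 ∧ r ≤ 1 / (4 * k1) ∧ r ≤ ε / (8 * k1) :=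
    ⟨min (min (r₀ / 4) (r₁ / 4)) (min (1 / (4 * k1)) (ε / (8 * k1))), by positivity,
      (min_le_left _ _).trans (min_le_left _ _), (min_le_left _ _).trans (min_le_right _ _),
      (min_le_right _ _).trans (min_le_left _ _), (min_le_right _ _).trans (min_le_right _ _)⟩
  obtain ⟨hra, hrb, hrc, hrd⟩ := hr4
  have hrc' : 4 * k1 * r ≤ 1 := by
    rw [le_div_iff₀ (by positivity)] at hrc; linarith
  have hrd' : 8 * k1 * r ≤ ε := by
    rw [le_div_iff₀ (by positivity)] at hrd; linarith
  refine e₀.2.2 ⟨max k1 (C * 20 * k1), ?_⟩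
  filter_upwards [ball_mem_nhds (e₀:ℂ) hr] with z hz
  rw [mem_ball, dist_eq_norm] at hz
  have hzU : z ∈ U := (hball (by rw [mem_ball, dist_eq_norm]; linarith)).1
  by_cases hzE : z ∈ E
  · refine le_trans ?_ (le_max_left _ _)
    refine HasFDerivAt.le_of_lip' (hf z hzU).1.hasFDerivAt hk1p.le ?_
    have hp : 0 < 1 / k1 := by positivity
    filter_upwards [hU.mem_nhds hzU, ball_mem_nhds z hp] with w hw hw2
    rw [mem_ball, dist_eq_norm] at hw2
    exact hEkr z hzE (by linarith) w hw hw2.le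
  · refine le_trans ?_ (le_max_right _ _)
    have hzR : z ∈ Reg := by
      by_contra h
      exact hzE ⟨hzU, h⟩
    have hd0 : 0 < infDist z E := by
      rw [← (Metric.infDist_pos_iff_notMem_closure hEn)]
      intro hcl
      obtain ⟨y, hy1, hy2⟩ := mem_closure_iff_nhds.1 hcl Reg (hRegO.mem_nhds hzR)
      exact hy2.2 hy1
    set d := infDist z E with hd
    have hdr : d < r := lt_of_le_of_lt (infDist_le_dist_of_mem e₀.2) (by rw [dist_eq_norm]; exact hz)
    obtain ⟨e, heE, hze⟩ := (infDist_lt_iff hEn).1 (show infDist z E < 2 * d by linarith)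
    rw [dist_eq_norm] at hze
    have hcb : ∀ w ∈ closedBall z (d / 2), w ∈ ball (e₀:ℂ) r₁ ∧ w ∈ Reg ∧ ‖w - e‖ ≤ 5 / 2 * d := by
      intro w hw
      rw [mem_closedBall, dist_eq_norm] at hw
      have h1 : ‖w - e₀‖ ≤ ‖w - z‖ + ‖z - e₀‖ := by
        have := norm_add_le (w - z) (z - e₀); simpa using this
      have h2 : w ∈ ball (e₀:ℂ) r₁ := by rw [mem_ball, dist_eq_norm]; linarith
      refine ⟨h2, ?_, ?_⟩
      · by_contra h
        have : w ∈ E := ⟨(hball h2).1, h⟩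
        have := infDist_le_dist_of_mem (x := z) this
        rw [dist_comm, dist_eq_norm, ← hd] at this
        linarith
      · have := norm_add_le (w - z) (z - e)
        rw [sub_add_sub_cancel] at this
        linarith
    -- bounded on the closed ball
    have hbdd : ∃ B : ℝ, ∀ w ∈ closedBall z (d / 2), ‖fderiv ℝ f w‖ ≤ B := by
      refine (isCompact_closedBall z (d / 2)).induction_on
        (p := fun s => ∃ B : ℝ, ∀ w ∈ s, ‖fderiv ℝ f w‖ ≤ B) ⟨0, by simp⟩ ?_ ?_ ?_
      · rintro s t hst ⟨B, hB⟩
        exact ⟨B, fun w hw => hB w (hst hw)⟩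
      · rintro s t ⟨B, hB⟩ ⟨B', hB'⟩
        refine ⟨max B B', fun w hw => ?_⟩
        rcases hw with h | h
        · exact (hB w h).trans (le_max_left _ _)
        · exact (hB' w h).trans (le_max_right _ _)
      · intro w hw
        obtain ⟨B, hB⟩ := (hcb w hw).2.1
        exact ⟨_, mem_nhdsWithin_of_mem_nhds hB, B, fun x hx => hx⟩
    obtain ⟨B, hB⟩ := hbdd
    have heE0 : ‖e - e₀‖ < r₀ := by
      have := norm_add_le (e - z) (z - e₀)
      rw [sub_add_sub_cancel, norm_sub_rev e z] at this
      linarith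
    have hfe : ∀ w ∈ ball z (d / 2), ‖f w - f e‖ ≤ 5 / 2 * k1 * d := by
      intro w hw
      obtain ⟨h1, h2, h3⟩ := hcb w (ball_subset_closedBall hw)
      have := hEkr e heE heE0 w (hball h1).1 (by
        rw [le_div_iff₀ hk1p]
        nlinarith)
      refine this.trans ?_
      nlinarith
    have := hIb J (ball (f e₀) η) f z (d / 2) (5 * k1 * d) B (by positivity) hgood (by
      intro w hw
      obtain ⟨h1, h2, h3⟩ := hcb w (ball_subset_closedBall hw)
      obtain ⟨g1, g2⟩ := hball h1
      exact ⟨(hf w g1).1, hB w (ball_subset_closedBall hw), (hf w g1).2.1, g2⟩) (by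
      intro w hw w' hw'
      have h1 := hfe w hw
      have h2 := hfe w' hw'
      rw [norm_sub_rev] at h2
      have := norm_add_le (f w - f e) (f e - f w')
      rw [sub_add_sub_cancel] at this
      linarith) (by nlinarith)
    have h2 : d * ‖fderiv ℝ f z‖ ≤ d * (C * 20 * k1) := by nlinarith [mul_nonneg hC (mul_nonneg hk1p.le hd0.le)]
    exact le_of_mul_le_mul_left h2 hd0

end KR

namespace KR
open MeasureTheory

variable {W : Type*} [NormedAddCommGroup W] [NormedSpace ℂ W] [CompleteSpace W]
  [SecondCountableTopology W]
variable {V : Type*} [NormedAddCommGroup V] [NormedSpace ℝ V]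

lemma regId (ι : V →L[ℝ] W) (ψ : W →L[ℝ] V) (hψι : ∀ x, ψ (ι x) = x)
    (hψI : ∀ x, ψ (Complex.I • ι x) = 0) (J : V → V →L[ℝ] V) (S : Set V) (CA L Λ ρ' ρ₁ : ℝ)
    (hCA : 0 ≤ CA) (hL : 0 ≤ L) (hΛ0 : 0 ≤ Λ) (hρ : ρ' < ρ₁) (hJ : GoodOn J S CA L) (f : ℂ → V)
    (hf : ∀ z ∈ ball (0:ℂ) ρ₁, DifferentiableAt ℝ f z ∧ ‖fderiv ℝ f z‖ ≤ Λ ∧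
      fderiv ℝ f z Complex.I = J (f z) (fderiv ℝ f z 1) ∧ f z ∈ S) :
    ∃ C : ℝ, 0 ≤ C ∧ ∀ z w, ‖z‖ < ρ' → ‖w‖ < ρ' →
      ‖fderiv ℝ f z - fderiv ℝ f w‖ ≤ C * √‖z - w‖ := by
  obtain ⟨C, hC, hmain⟩ := regIa' ι ψ hψι hψI CA hCA
  set ρ₂ := (ρ' + ρ₁) / 2 with hρ₂
  have h2a : ρ' < ρ₂ := by rw [hρ₂]; linarith
  have h2b : ρ₂ < ρ₁ := by rw [hρ₂]; linarith
  set ρ := ρ₁ - ρ₂ with hρd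
  have hρp : 0 < ρ := by rw [hρd]; linarith
  have hlip : ∀ z ∈ ball (0:ℂ) ρ₁, ∀ w ∈ ball (0:ℂ) ρ₁, ‖f w - f z‖ ≤ Λ * ‖w - z‖ := by
    intro z hz w hw
    exact (convex_ball (0:ℂ) ρ₁).norm_image_sub_le_of_norm_fderiv_le (𝕜 := ℝ)
          (fun x hx => (hf x hx).1) (fun x hx => (hf x hx).2.1) hz hw
  set C1 := C * (L * Λ * √ρ * √ρ * (ρ * Λ) + Λ * ρ) / (ρ * √ρ) with hC1
  set C2 := 2 * Λ / √(ρ / 2) with hC2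
  have hT : ∀ z₀, ‖z₀‖ < ρ₂ → ∀ z, ‖z‖ < ρ₂ →
      ‖f z - f z₀ - fderiv ℝ f z₀ (z - z₀)‖ ≤ (C1 + C2) * (‖z - z₀‖ * √‖z - z₀‖) := by
    intro z₀ hz₀ z hz
    have hz₀' : z₀ ∈ ball (0:ℂ) ρ₁ := by simp; linarith
    have hz' : z ∈ ball (0:ℂ) ρ₁ := by simp; linarith
    have hC1p : 0 ≤ C1 := by positivity
    have hC2p : 0 ≤ C2 := by positivity
    rcases lt_or_ge ‖z - z₀‖ (ρ / 2) with hlt | hge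
    · have hsub : ∀ w ∈ ball z₀ ρ, w ∈ ball (0:ℂ) ρ₁ := by
        intro w hw
        rw [mem_ball, dist_eq_norm] at hw
        have := norm_add_le (w - z₀) z₀
        rw [sub_add_cancel] at this
        simp; linarith
      have := (hmain f (fun w => J (f w)) Λ (L * Λ * √ρ) (Λ * ρ) z₀ ρ hρp (by positivity) (by
        intro w hw
        have hw' := hsub w hw
        obtain ⟨g1, g2, g3, g4⟩ := hf w hw'
        have hl := hlip z₀ hz₀' w hw'
        rw [mem_ball, dist_eq_norm] at hw
        refine ⟨g1, g2, g3, (hJ.1 _ g4).2, ?_, hl.trans (by gcongr)⟩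
        refine (hJ.2 _ g4 _ (hf z₀ hz₀').2.2.2).trans ?_
        have hs : ‖w - z₀‖ ≤ √ρ * √‖w - z₀‖ := by
          calc ‖w - z₀‖ = √‖w - z₀‖ * √‖w - z₀‖ := (Real.mul_self_sqrt (norm_nonneg _)).symm
            _ ≤ _ := by gcongr
        calc _ ≤ L * (Λ * (√ρ * √‖w - z₀‖)) := by gcongr; exact hl.trans (by gcongr)
          _ = _ := by ring) (hJ.1 _ (hf z₀ hz₀').2.2.2).1).2 z (by rw [mem_ball, dist_eq_norm]; exact hlt)
      refine this.trans ?_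
      have e : C * (L * Λ * √ρ * √ρ * (ρ * Λ) + Λ * ρ) * (‖z - z₀‖ / ρ * √(‖z - z₀‖ / ρ))
          = C1 * (‖z - z₀‖ * √‖z - z₀‖) := by
        rw [hC1, Real.sqrt_div (norm_nonneg _)]
        have := Real.sqrt_pos.2 hρp
        field_simp
      rw [e]
      gcongr
      linarith
    · have h1 : ‖f z - f z₀ - fderiv ℝ f z₀ (z - z₀)‖ ≤ 2 * Λ * ‖z - z₀‖ := by
        refine (norm_sub_le _ _).trans ?_
        have a := hlip z₀ hz₀' z hz'
        have b : ‖fderiv ℝ f z₀ (z - z₀)‖ ≤ Λ * ‖z - z₀‖ :=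
          ((fderiv ℝ f z₀).le_opNorm _).trans (by gcongr; exact (hf z₀ hz₀').2.1)
        linarith
      have hs : √(ρ / 2) ≤ √‖z - z₀‖ := Real.sqrt_le_sqrt hge
      have hsp : 0 < √(ρ / 2) := Real.sqrt_pos.2 (by positivity)
      have h2 : 2 * Λ * ‖z - z₀‖ ≤ C2 * (‖z - z₀‖ * √‖z - z₀‖) := by
        rw [hC2, div_mul_eq_mul_div, le_div_iff₀ hsp]
        calc _ ≤ 2 * Λ * ‖z - z₀‖ * √‖z - z₀‖ := by gcongr
          _ = _ := by ring
      refine h1.trans (h2.trans ?_)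
      gcongr
      linarith
  refine ⟨_, ?_, holder_of_taylor (f := f) (D := fderiv ℝ f) (ρ := ρ₂) (ρ' := ρ') (C := C1 + C2) (B := Λ) h2a
    (by positivity) hΛ0 (fun z₀ h0 z hz => hT z₀ (by linarith) z hz)
    (fun z₀ h0 => (hf z₀ (by simp; linarith)).2.1)⟩
  have : 0 < ρ₂ - ρ' := by linarith
  positivity

/-! Part II : weighted Cauchy transform -/

def ph (x : ℂ) : ℂ := dslope Complex.exp 0 x

lemma ph_mul (x : ℂ) : x * ph x = Complex.exp x - 1 := by
  have := sub_smul_dslope Complex.exp 0 x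
  simpa [ph] using this

lemma ph_diff : Differentiable ℂ ph := by
  have h : DifferentiableOn ℂ (dslope Complex.exp 0) univ := by
    rw [Complex.differentiableOn_dslope univ_mem]
    exact Complex.differentiable_exp.differentiableOn
  exact differentiableOn_univ.1 h

def kern (k : ℝ) (z w : ℂ) : ℂ := (k * (starRingEnd ℂ) w) * ph ((k * (starRingEnd ℂ) w) * (z - w))

def kern' (k : ℝ) (z w : ℂ) : ℂ := (k * (starRingEnd ℂ) w) *
  (deriv ph ((k * (starRingEnd ℂ) w) * (z - w)) * (k * (starRingEnd ℂ) w))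

lemma continuous_kern (k : ℝ) : Continuous (fun p : ℂ × ℂ => kern k p.1 p.2) := by
  unfold kern
  have h1 := ph_diff.continuous
  have h2 : Continuous (starRingEnd ℂ) := Complex.continuous_conj
  fun_prop

lemma continuous_kern' (k : ℝ) : Continuous (fun p : ℂ × ℂ => kern' k p.1 p.2) := by
  unfold kern'
  have h1 : Continuous (deriv ph) := (ph_diff.contDiff (n := 1)).continuous_deriv (by norm_num)
  have h2 : Continuous (starRingEnd ℂ) := Complex.continuous_conj
  fun_prop

lemma hasDerivAt_kern (k : ℝ) (z w : ℂ) : HasDerivAt (fun z => kern k z w) (kern' k z w) z := by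
  unfold kern kern'
  apply HasDerivAt.const_mul
  have h1 : HasDerivAt (fun z : ℂ => ((k:ℂ) * (starRingEnd ℂ) w) * (z - w)) ((k:ℂ) * (starRingEnd ℂ) w) z := by
    simpa using ((hasDerivAt_id z).sub_const w).const_mul ((k:ℂ) * (starRingEnd ℂ) w)
  exact (ph_diff _).hasDerivAt.comp z h1

def EE (k : ℝ) (m : ℂ → W) (z : ℂ) : W := (2 * Real.pi)⁻¹ • ∫ w, kern k z w • m w

lemma integrable_of_bdd {m : ℂ → W} (hm : AEStronglyMeasurable m volume) {K R : ℝ}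
    (hK : ∀ w, ‖m w‖ ≤ K) (hR : ∀ w, R ≤ ‖w‖ → m w = 0) : Integrable m := by
  have h1 : IntegrableOn m (ball 0 R) := by
    refine Measure.integrableOn_of_bounded (M := K) measure_ball_lt_top.ne hm (Eventually.of_forall hK)
  rw [← integrable_indicator_iff measurableSet_ball] at h1
  refine h1.congr (Eventually.of_forall fun w => ?_)
  by_cases hw : w ∈ ball (0:ℂ) R
  · simp [hw]
  · rw [indicator_of_notMem hw, hR w (by simpa using hw)]

lemma kern_integrable (k : ℝ) {m : ℂ → W} (hm : AEStronglyMeasurable m volume) {K R : ℝ}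
    (hK : ∀ w, ‖m w‖ ≤ K) (hR : ∀ w, R ≤ ‖w‖ → m w = 0) (z : ℂ) :
    Integrable (fun w => kern k z w • m w) := by
  have hc : Continuous (fun w => kern k z w) := (continuous_kern k).comp (by fun_prop : Continuous fun w : ℂ => (z, w))
  obtain ⟨B, hB⟩ := (isCompact_closedBall (0:ℂ) R).exists_bound_of_continuousOn hc.continuousOn
  refine ((integrable_of_bdd hm hK hR).norm.const_mul B).mono' (hc.aestronglyMeasurable.smul hm)
    (Eventually.of_forall fun w => ?_)
  rcases lt_or_ge ‖w‖ R with h | h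
  · rw [norm_smul]
    gcongr
    exact hB w (by simpa using h.le)
  · rw [hR w h]; simp

lemma EE_diff (k : ℝ) {m : ℂ → W} (hm : AEStronglyMeasurable m volume) {K R : ℝ}
    (hK : ∀ w, ‖m w‖ ≤ K) (hR : ∀ w, R ≤ ‖w‖ → m w = 0) : Differentiable ℂ (EE k m) := by
  intro z₀
  obtain ⟨B, hB⟩ := ((isCompact_closedBall (z₀:ℂ) 1).prod (isCompact_closedBall (0:ℂ) R)).exists_bound_of_continuousOn
    (continuous_kern' k).continuousOn
  have hint := (integrable_of_bdd hm hK hR)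
  have hc : ∀ z, Continuous (fun w => kern k z w) := fun z =>
    (continuous_kern k).comp (by fun_prop : Continuous fun w : ℂ => (z, w))
  have hc' : ∀ z, Continuous (fun w => kern' k z w) := fun z =>
    (continuous_kern' k).comp (by fun_prop : Continuous fun w : ℂ => (z, w))
  have := hasDerivAt_integral_of_dominated_loc_of_deriv_le (μ := volume) (𝕜 := ℂ)
    (F := fun z w => kern k z w • m w) (F' := fun z w => kern' k z w • m w) (x₀ := z₀)
    (s := ball z₀ 1) (bound := fun w => B * ‖m w‖) (ball_mem_nhds z₀ one_pos)
    (Eventually.of_forall fun z => (hc z).aestronglyMeasurable.smul hm)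
    (kern_integrable k hm hK hR z₀) ((hc' z₀).aestronglyMeasurable.smul hm)
    (Eventually.of_forall fun w z hz => by
      rcases lt_or_ge ‖w‖ R with h | h
      · rw [norm_smul]
        gcongr
        exact hB (z, w) ⟨ball_subset_closedBall hz, by simpa using h.le⟩
      · rw [hR w h]; simp)
    (hint.norm.const_mul B)
    (Eventually.of_forall fun w z hz => (hasDerivAt_kern k z w).smul_const (m w))
  unfold EE
  exact (this.2.differentiableAt).const_smul ((2 * Real.pi)⁻¹ : ℝ)

def TT (k : ℝ) (m : ℂ → W) (z : ℂ) : W := cT m z + EE k m z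

def wt (k : ℝ) (z : ℂ) : ℝ := Real.exp (k * ‖z‖ ^ 2 / 2)

lemma kernel_norm (k : ℝ) (z w : ℂ) :
    ‖Complex.exp ((k * (starRingEnd ℂ) w) * (z - w))‖ * wt k w = wt k z * Real.exp (-(k * ‖z - w‖ ^ 2 / 2)) := by
  unfold wt
  rw [Complex.norm_exp, ← Real.exp_add, ← Real.exp_add]
  congr 1
  simp only [← Complex.normSq_eq_norm_sq, Complex.normSq_apply]
  simp
  ring

lemma exp_kap {t x : ℝ} (ht : 0 < t) (hx : 0 < x) :
    Real.exp (-((1 / t ^ 2) * x ^ 2 / 2)) / x ≤ (2 / t) * kap (x / t) := by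
  obtain ⟨y, hy, rfl⟩ : ∃ y, 0 < y ∧ x = y * t := ⟨x / t, by positivity, by field_simp⟩
  have e1 : (1 / t ^ 2) * (y * t) ^ 2 / 2 = y ^ 2 / 2 := by field_simp
  have e2 : y * t / t = y := by field_simp
  rw [e1, e2]
  have hsy := Real.sqrt_pos.2 hy
  have key : Real.exp (-(y ^ 2 / 2)) / y ≤ 2 * kap y := by
    unfold kap
    split_ifs with h
    · have h1 : Real.exp (-(y ^ 2 / 2)) ≤ 1 := by rw [Real.exp_le_one_iff]; nlinarith [sq_nonneg y]
      have hs : √y ≤ 1 := by rw [Real.sqrt_le_one]; exact h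
      rw [← div_eq_mul_one_div, div_le_div_iff₀ (by positivity) (by positivity)]
      have : y * √y ≤ y := by nlinarith
      have : 0 < y * √y := by positivity
      nlinarith
    · push Not at h
      have h1 : Real.exp (-(y ^ 2 / 2)) ≤ 2 / y ^ 2 := by
        rw [Real.exp_neg, inv_eq_one_div, div_le_div_iff₀ (Real.exp_pos _) (by positivity)]
        have := Real.add_one_le_exp (y ^ 2 / 2)
        linarith
      have hs : √y ≤ y := by
        rw [Real.sqrt_le_left (by positivity)]; nlinarith
      calc Real.exp (-(y ^ 2 / 2)) / y ≤ 2 / y ^ 2 / y := by gcongr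
        _ = 2 * (1 / (y * y * y)) := by field_simp
        _ ≤ 2 * (1 / (y * y * √y)) := by gcongr
  calc _ = (1 / t) * (Real.exp (-(y ^ 2 / 2)) / y) := by field_simp
    _ ≤ (1 / t) * (2 * kap y) := by gcongr
    _ = _ := by ring

lemma TT_bound {t : ℝ} (ht : 0 < t) {m : ℂ → W} (hm : AEStronglyMeasurable m volume) {K R N : ℝ}
    (hK : ∀ w, ‖m w‖ ≤ K) (hR : ∀ w, R ≤ ‖w‖ → m w = 0) (hN : ∀ w, ‖m w‖ ≤ N * wt (1 / t ^ 2) w) (z : ℂ) :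
    ‖TT (1 / t ^ 2) m z‖ ≤ wt (1 / t ^ 2) z * (2 * t * Ck * N) := by
  set k := 1 / t ^ 2 with hk
  have hwt : ∀ w, 0 < wt k w := fun w => Real.exp_pos _
  have hN0 : 0 ≤ N := by
    have := (norm_nonneg _).trans (hN 0)
    exact nonneg_of_mul_nonneg_left this (hwt 0)
  have i1 := (cT_integrable hm hK hR z).1
  have i2 := kern_integrable k hm hK hR z
  have e : TT k m z = (2 * Real.pi)⁻¹ • ∫ w, ((z - w)⁻¹ • m w + kern k z w • m w) := by
    rw [integral_add i1 i2, smul_add]; rfl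
  rw [e]
  refine (two_pi_smul_le _).trans ?_
  obtain ⟨s1, s2⟩ := integrable_kap_scaled t ht z
  have hi : Integrable (fun w => wt k z * N * (2 / t) * kap (‖z - w‖ / t)) := s1.const_mul _
  refine (norm_integral_le_of_norm_le hi ?_).trans ?_
  · have n1 : ∀ᵐ w : ℂ, w ≠ z := by simp [ae_iff, measure_singleton]
    filter_upwards [n1] with w hw
    have hzw : z - w ≠ 0 := sub_ne_zero.2 hw.symm
    have hp : 0 < ‖z - w‖ := norm_pos_iff.2 hzw
    have e2 : (z - w)⁻¹ + kern k z w = Complex.exp ((k * (starRingEnd ℂ) w) * (z - w)) / (z - w) := by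
      have := ph_mul ((k * (starRingEnd ℂ) w) * (z - w))
      unfold kern
      rw [eq_div_iff hzw, add_mul, inv_mul_cancel₀ hzw]
      linear_combination this
    rw [← add_smul, e2, norm_smul, norm_div]
    have h1 := kernel_norm k z w
    have h2 := exp_kap ht hp
    calc _ ≤ ‖Complex.exp ((k * (starRingEnd ℂ) w) * (z - w))‖ / ‖z - w‖ * (N * wt k w) := by
          gcongr; exact hN w
      _ = N * (‖Complex.exp ((k * (starRingEnd ℂ) w) * (z - w))‖ * wt k w) / ‖z - w‖ := by ring
      _ = wt k z * N * (Real.exp (-(k * ‖z - w‖ ^ 2 / 2)) / ‖z - w‖) := by rw [h1]; ring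
      _ ≤ wt k z * N * ((2 / t) * kap (‖z - w‖ / t)) := by
          have := (hwt z).le
          gcongr
      _ = _ := by ring
  · rw [integral_const_mul, s2]
    apply le_of_eq
    field_simp

end KR

namespace KR
open MeasureTheory

variable {W : Type*} [NormedAddCommGroup W] [NormedSpace ℂ W] [CompleteSpace W]
  [SecondCountableTopology W]

lemma one_le_wt {k : ℝ} (hk : 0 ≤ k) (z : ℂ) : 1 ≤ wt k z := by
  unfold wt; apply Real.one_le_exp; positivity

lemma wt_pos (k : ℝ) (z : ℂ) : 0 < wt k z := Real.exp_pos _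

lemma continuous_wt (k : ℝ) : Continuous (wt k) := by unfold wt; fun_prop

lemma TT_sub (k : ℝ) {m m' : ℂ → W} (hm : AEStronglyMeasurable m volume)
    (hm' : AEStronglyMeasurable m' volume) {K K' R : ℝ}
    (hK : ∀ w, ‖m w‖ ≤ K) (hK' : ∀ w, ‖m' w‖ ≤ K') (hR : ∀ w, R ≤ ‖w‖ → m w = 0)
    (hR' : ∀ w, R ≤ ‖w‖ → m' w = 0) (z : ℂ) : 
    TT k (fun w => m w - m' w) z = TT k m z - TT k m' z := by
  unfold TT cT EE
  simp only [smul_sub]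
  rw [integral_sub (cT_integrable hm hK hR z).1 (cT_integrable hm' hK' hR' z).1,
    integral_sub (kern_integrable k hm hK hR z) (kern_integrable k hm' hK' hR' z)]
  simp only [smul_sub]
  abel

lemma TT_cont (k : ℝ) {m : ℂ → W} (hm : AEStronglyMeasurable m volume) {K R : ℝ}
    (hK : ∀ w, ‖m w‖ ≤ K) (hR : ∀ w, R ≤ ‖w‖ → m w = 0) : Continuous (TT k m) := by
  unfold TT
  refine Continuous.add ?_ (EE_diff k hm hK hR).continuous
  rw [continuous_iff_continuousAt]
  intro z
  rw [ContinuousAt, tendsto_iff_norm_sub_tendsto_zero]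
  have h1 : Tendsto (fun x => 4 * Cd R * K * √‖x - z‖) (𝓝 z) (𝓝 0) := by
    have : Continuous (fun x => 4 * Cd R * K * √‖x - z‖) := by fun_prop
    simpa using this.tendsto z
  exact squeeze_zero (fun _ => norm_nonneg _) (fun x => cT_holder hm hK hR x z) h1

lemma fixpt (L : ℂ → W →L[ℝ] W) (hLc : Continuous L) (K : ℝ) (hK : 0 ≤ K) (hLK : ∀ z, ‖L z‖ ≤ K)
    (hL2 : ∀ z, 2 ≤ ‖z‖ → L z = 0) (m0 : ℂ → W) (hm0 : AEStronglyMeasurable m0 volume) (M0 : ℝ)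
    (hM0 : ∀ w, ‖m0 w‖ ≤ M0) (hm2 : ∀ w, 2 ≤ ‖w‖ → m0 w = 0) :
    ∃ (k : ℝ) (η : ℂ → W) (m : ℂ → W) (M : ℝ), Continuous η ∧ AEStronglyMeasurable m volume ∧
      (∀ w, ‖m w‖ ≤ M) ∧ (∀ w, 2 ≤ ‖w‖ → m w = 0) ∧ 
      (∀ w, m w = m0 w + w⁻¹ • L w (w • η w)) ∧ ∀ z, η z = - (TT k m z - TT k m 0) := by
  obtain ⟨t, ht, htK⟩ : ∃ t : ℝ, 0 < t ∧ 4 * t * Ck * K ≤ 1/2 := by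
    have h0 : 0 ≤ Ck * K := mul_nonneg Ck_nonneg hK
    refine ⟨1 / (8 * (Ck * K + 1)), by positivity, ?_⟩
    have : 4 * (1 / (8 * (Ck * K + 1))) * Ck * K = (1/2) * ((Ck * K) / (Ck * K + 1)) := by
      field_simp; ring
    rw [this]
    have : (Ck * K) / (Ck * K + 1) ≤ 1 := by rw [div_le_one (by positivity)]; linarith
    linarith
  set k : ℝ := 1 / t ^ 2 with hk
  have hk0 : 0 ≤ k := by positivity
  let mm : BoundedContinuousFunction ℂ W → ℂ → W := fun e w =>
    m0 w + w⁻¹ • L w (w • (wt k w • e w))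
  have hLs : ∀ (w : ℂ) (x : W), ‖w⁻¹ • L w (w • x)‖ ≤ K * ‖x‖ := by
    intro w x
    rcases eq_or_ne w 0 with rfl | hw
    · simp; positivity
    · rw [norm_smul, norm_inv]
      have h1 : ‖L w (w • x)‖ ≤ K * (‖w‖ * ‖x‖) := by
        refine ((L w).le_opNorm _).trans ?_
        rw [norm_smul]
        gcongr
        exact hLK w
      calc ‖w‖⁻¹ * ‖L w (w • x)‖ ≤ ‖w‖⁻¹ * (K * (‖w‖ * ‖x‖)) := by gcongr
        _ = K * ‖x‖ := by
          have := norm_ne_zero_iff.2 hw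
          field_simp
  have hLm : ∀ e : ℂ → W, Continuous e → AEStronglyMeasurable (fun w => w⁻¹ • L w (w • e w)) volume := by
    intro e he
    refine (measurable_inv.aestronglyMeasurable).smul (Continuous.aestronglyMeasurable ?_)
    exact hLc.clm_apply (continuous_id.smul he)
  have hwe : ∀ e : BoundedContinuousFunction ℂ W, Continuous fun w => wt k w • e w := fun e =>
    (continuous_wt k).smul e.continuous
  have hmm : ∀ e, AEStronglyMeasurable (mm e) volume := fun e => hm0.add (hLm _ (hwe e))
  have hmm2 : ∀ e w, 2 ≤ ‖w‖ → mm e w = 0 := by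
    intro e w hw; simp [mm, hm2 w hw, hL2 w hw]
  have hW2 : ∀ w : ℂ, ‖w‖ < 2 → wt k w ≤ wt k 2 := by
    intro w hw
    unfold wt
    apply Real.exp_le_exp.2
    have : ‖(2:ℂ)‖ = 2 := by simp
    rw [this]
    gcongr
  have hM00 : 0 ≤ M0 := (norm_nonneg _).trans (hM0 0)
  have hmmK : ∀ e w, ‖mm e w‖ ≤ M0 + K * (wt k 2 * ‖e‖) := by
    intro e w
    rcases lt_or_ge ‖w‖ 2 with h | h
    · refine (norm_add_le _ _).trans (add_le_add (hM0 w) ((hLs w _).trans ?_))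
      rw [norm_smul, Real.norm_of_nonneg (wt_pos k w).le]
      have := wt_pos k w
      gcongr
      · exact (wt_pos k 2).le
      · exact hW2 w h
      · exact e.norm_coe_le_norm w
    · rw [hmm2 e w h]
      have := wt_pos k 2
      simp; positivity
  let Ψ0 : BoundedContinuousFunction ℂ W → ℂ → W := fun e z => 
    (wt k z)⁻¹ • (-(TT k (mm e) z - TT k (mm e) 0))
  have hgen : ∀ (m : ℂ → W) (hm : AEStronglyMeasurable m volume) (M N : ℝ) (hM : ∀ w, ‖m w‖ ≤ M) 
      (h2 : ∀ w, 2 ≤ ‖w‖ → m w = 0) (hN : ∀ w, ‖m w‖ ≤ N * wt k w) (z : ℂ), 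
      ‖(wt k z)⁻¹ • (-(TT k m z - TT k m 0))‖ ≤ 4 * t * Ck * N := by
    intro m hm M N hM h2 hN z
    have a := TT_bound ht hm hM h2 hN z
    have b := TT_bound ht hm hM h2 hN 0
    have hw0 : wt k 0 = 1 := by simp [wt]
    rw [← hk] at a b
    rw [hw0, one_mul] at b
    have hz := one_le_wt hk0 z
    have hN0 : 0 ≤ 2 * t * Ck * N := (norm_nonneg _).trans b
    rw [norm_smul, norm_neg, norm_inv, Real.norm_of_nonneg (wt_pos k z).le, inv_mul_le_iff₀ (wt_pos k z)]
    refine (norm_sub_le _ _).trans ?_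
    nlinarith
  have hcont : ∀ e, Continuous (Ψ0 e) := by
    intro e
    have := TT_cont k (hmm e) (hmmK e) (hmm2 e)
    exact ((continuous_wt k).inv₀ (fun z => (wt_pos k z).ne')).smul (this.sub continuous_const).neg
  have hbd : ∀ e, ∀ z, ‖Ψ0 e z‖ ≤ 4 * t * Ck * (M0 + K * (wt k 2 * ‖e‖)) := by
    intro e z
    refine hgen _ (hmm e) _ _ (hmmK e) (hmm2 e) (fun w => (hmmK e w).trans ?_) z
    refine le_mul_of_one_le_right ?_ (one_le_wt hk0 w)
    exact (norm_nonneg _).trans (hmmK e 0)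
  let Ψ : BoundedContinuousFunction ℂ W → BoundedContinuousFunction ℂ W := fun e =>
    BoundedContinuousFunction.ofNormedAddCommGroup (Ψ0 e) (hcont e) _ (hbd e)
  have hcontr : ContractingWith (1/2) Ψ := by
    constructor
    · rw [← NNReal.coe_lt_coe]; norm_num
    · refine LipschitzWith.of_dist_le_mul fun e e' => ?_
      rw [BoundedContinuousFunction.dist_le (by positivity)]
      intro z
      have hd : Ψ e z - Ψ e' z = 
          (wt k z)⁻¹ • (-(TT k (fun w => mm e w - mm e' w) z - TT k (fun w => mm e w - mm e' w) 0)) := by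
        have h := TT_sub k (hmm e) (hmm e') (hmmK e) (hmmK e') (hmm2 e) (hmm2 e')
        rw [h, h]
        change Ψ0 e z - Ψ0 e' z = _
        simp only [Ψ0]
        rw [← smul_sub]; congr 1; abel
      rw [dist_eq_norm, hd]
      refine (hgen _ ((hmm e).sub (hmm e')) (M0 + K * (wt k 2 * ‖e‖) + (M0 + K * (wt k 2 * ‖e'‖))) 
        (K * dist e e') (fun w => (norm_sub_le _ _).trans (add_le_add (hmmK e w) (hmmK e' w)))
        (fun w hw => by simp [hmm2 e w hw, hmm2 e' w hw]) (fun w => ?_) z).trans ?_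
      · have : mm e w - mm e' w = w⁻¹ • L w (w • (wt k w • (e w - e' w))) := by
          simp only [mm, smul_sub, map_sub]; abel
        change ‖mm e w - mm e' w‖ ≤ _
        rw [this]
        refine (hLs w _).trans ?_
        rw [norm_smul, Real.norm_of_nonneg (wt_pos k w).le, mul_comm (wt k w), mul_assoc]
        have := wt_pos k w
        gcongr
        rw [← dist_eq_norm]
        exact BoundedContinuousFunction.dist_coe_le_dist w
      · have : 0 ≤ dist e e' := dist_nonneg
        push_cast
        nlinarith
  let e := hcontr.fixedPoint Ψ
  have he : Ψ e = e := hcontr.fixedPoint_isFixedPt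
  refine ⟨k, fun z => wt k z • e z, mm e, _, hwe e, hmm e, hmmK e, hmm2 e, fun w => rfl, fun z => ?_⟩
  have : e z = Ψ0 e z := by
    conv_lhs => rw [← he]
    rfl
  change wt k z • e z = _
  rw [this]
  simp only [Ψ0]
  rw [smul_smul, mul_inv_cancel₀ (wt_pos k z).ne', one_smul]

end KR

namespace KR
open MeasureTheory

variable {W : Type*} [NormedAddCommGroup W] [NormedSpace ℂ W] [CompleteSpace W]
  [SecondCountableTopology W]

lemma smooth_holder {E : Type*} [NormedAddCommGroup E] [NormedSpace ℝ E] {F : ℂ → E}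
    (hF : ContDiff ℝ 1 F) : ∃ C : ℝ, 0 ≤ C ∧ ∀ z w, ‖z‖ ≤ 2 → ‖w‖ ≤ 2 →
      ‖F z‖ ≤ C ∧ ‖F z - F w‖ ≤ C * √‖z - w‖ := by
  have hc : Continuous (fun z => fderiv ℝ F z) := hF.continuous_fderiv (by norm_num)
  obtain ⟨B, hB⟩ := (isCompact_closedBall (0:ℂ) 2).exists_bound_of_continuousOn hc.continuousOn
  obtain ⟨B', hB'⟩ := (isCompact_closedBall (0:ℂ) 2).exists_bound_of_continuousOn hF.continuous.continuousOn
  have hB0 : 0 ≤ B := (norm_nonneg _).trans (hB 0 (by simp))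
  have hB0' : 0 ≤ B' := (norm_nonneg _).trans (hB' 0 (by simp))
  refine ⟨2 * B + B', by positivity, fun z w hz hw => ⟨?_, ?_⟩⟩
  · have := hB' z (by simpa using hz)
    linarith
  have h1 := Convex.norm_image_sub_le_of_norm_fderiv_le (𝕜 := ℝ) (f := F) (s := closedBall (0:ℂ) 2) (C := B)
    (fun x _ => (hF.differentiable (by norm_num)) x) hB (convex_closedBall _ _)
    (x := w) (y := z) (by simpa using hw) (by simpa using hz)
  have h4 : ‖z - w‖ ≤ 4 := (norm_sub_le _ _).trans (by linarith)
  have h2 : √‖z - w‖ ≤ 2 := by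
    rw [Real.sqrt_le_left (by norm_num)]; linarith
  have h3 : ‖z - w‖ = √‖z - w‖ * √‖z - w‖ := (Real.mul_self_sqrt (norm_nonneg _)).symm
  have h5 := Real.sqrt_nonneg ‖z - w‖
  calc _ ≤ B * ‖z - w‖ := h1
    _ = B * (√‖z - w‖ * √‖z - w‖) := by rw [← h3]
    _ ≤ B * (2 * √‖z - w‖) := by gcongr
    _ ≤ _ := by nlinarith [mul_nonneg hB0' h5]

lemma cT_sub {m m' : ℂ → W} (hm : AEStronglyMeasurable m volume)
    (hm' : AEStronglyMeasurable m' volume) {K K' R : ℝ}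
    (hK : ∀ w, ‖m w‖ ≤ K) (hK' : ∀ w, ‖m' w‖ ≤ K') (hR : ∀ w, R ≤ ‖w‖ → m w = 0)
    (hR' : ∀ w, R ≤ ‖w‖ → m' w = 0) (z : ℂ) : 
    cT (fun w => m w - m' w) z = cT m z - cT m' z := by
  unfold cT 
  simp only [smul_sub]
  rw [integral_sub (cT_integrable hm hK hR z).1 (cT_integrable hm' hK' hR' z).1]
  simp only [smul_sub]

lemma cT_mul {m : ℂ → W} (hm : AEStronglyMeasurable m volume) {K R : ℝ}
    (hK : ∀ w, ‖m w‖ ≤ K) (hR : ∀ w, R ≤ ‖w‖ → m w = 0) (z : ℂ) : 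
    z • cT m z = cT (fun w => w • m w) z + (2 * Real.pi)⁻¹ • ∫ w, m w := by
  unfold cT
  have h1 : ∀ᵐ w : ℂ, (z - w)⁻¹ • (w • m w) = z • ((z - w)⁻¹ • m w) - m w := by
    have : ∀ᵐ w : ℂ, w ≠ z := by
      simp [ae_iff]
    filter_upwards [this] with w hw
    have h : z - w ≠ 0 := sub_ne_zero.2 hw.symm
    rw [smul_smul, smul_smul]
    have : (z - w)⁻¹ * w = z * (z - w)⁻¹ - 1 := by field_simp; ring
    rw [this, sub_smul, one_smul]
  have h2 : Integrable (fun w => z • ((z - w)⁻¹ • m w)) := (cT_integrable hm hK hR z).1.smul z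
  rw [integral_congr_ae h1, integral_sub h2 (integrable_of_bdd hm hK hR),
    integral_smul, smul_sub, sub_add_cancel, smul_comm]

set_option maxHeartbeats 1000000 in
lemma linsolve (L : ℂ → W →L[ℝ] W) (γ : ℂ → W) (K : ℝ) (hK : 0 ≤ K) (hLK : ∀ z, ‖L z‖ ≤ K)
    (hLH : ∀ z w, ‖L z - L w‖ ≤ K * √‖z - w‖) (hL2 : ∀ z, 2 ≤ ‖z‖ → L z = 0)
    (hγK : ∀ z, ‖γ z‖ ≤ K) (hγH : ∀ z w, ‖γ z - γ w‖ ≤ K * √‖z - w‖)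
    (hγ2 : ∀ z, 2 ≤ ‖z‖ → γ z = 0) (c0 c1 : W) :
    ∃ (u : ℂ → W) (C : ℝ), 0 ≤ C ∧ u 0 = c0 ∧ fderiv ℝ u 0 1 = c1 ∧
      (∀ z, ‖z‖ < 1 → DifferentiableAt ℝ u z ∧ dbar u z = γ z - L z (u z) ∧ ‖fderiv ℝ u z‖ ≤ C) ∧
      (∀ z w, ‖z‖ < 1 → ‖w‖ < 1 → ‖fderiv ℝ u z - fderiv ℝ u w‖ ≤ C * √‖z - w‖) := by
  have hcont : ∀ {E : Type _} [NormedAddCommGroup E] (F : ℂ → E) (hF : ∀ z w, ‖F z - F w‖ ≤ K * √‖z - w‖),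
      Continuous F := by
    intro E _ F hF
    rw [continuous_iff_continuousAt]
    intro z
    rw [ContinuousAt, tendsto_iff_norm_sub_tendsto_zero]
    have h1 : Tendsto (fun x => K * √‖x - z‖) (𝓝 z) (𝓝 0) := by
      have : Continuous (fun x => K * √‖x - z‖) := by fun_prop
      simpa using this.tendsto z
    exact squeeze_zero (fun _ => norm_nonneg _) (fun x => hF x z) h1
  have hLc : Continuous L := hcont L hLH
  have hγc : Continuous γ := hcont γ hγH
  obtain ⟨CT, hCT, htay⟩ := cT_taylor (W := W)
  -- h0
  set h0 : ℂ → W := fun z => γ z - L z c0 with hh0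
  have hLc0 : ∀ z, ‖L z c0‖ ≤ K * ‖c0‖ := fun z => ((L z).le_opNorm _).trans (by gcongr; exact hLK z)
  have h0c : Continuous h0 := hγc.sub (hLc.clm_apply continuous_const)
  have h0K : ∀ z, ‖h0 z‖ ≤ K * (1 + ‖c0‖) := fun z => (norm_sub_le _ _).trans (by
    have := hLc0 z; have := hγK z; linarith)
  have h0H : ∀ z w, ‖h0 z - h0 w‖ ≤ K * (1 + ‖c0‖) * √‖z - w‖ := by
    intro z w
    have e : h0 z - h0 w = (γ z - γ w) - (L z - L w) c0 := by
      simp [hh0]; abel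
    rw [e]
    refine (norm_sub_le _ _).trans ?_
    have a := hγH z w
    have b : ‖(L z - L w) c0‖ ≤ K * √‖z - w‖ * ‖c0‖ :=
      ((L z - L w).le_opNorm _).trans (by gcongr; exact hLH z w)
    linarith
  have h02 : ∀ z, 2 ≤ ‖z‖ → h0 z = 0 := fun z hz => by simp [hh0, hγ2 z hz, hL2 z hz]
  obtain ⟨D0, hD0, -, hD0t⟩ := htay h0 _ h0c.aestronglyMeasurable h0K h0H h02 0 (by simp)
  simp only [sub_zero] at hD0t
  set C0 := CT * (K * (1 + ‖c0‖)) with hC0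
  have hC00 : 0 ≤ C0 := by positivity
  set b : W := c1 - D0 1 with hb
  set φ : ℂ → W := fun z => cT h0 z - cT h0 0 + c0 + z • b with hφ
  have hT0c : Continuous (cT h0) := by
    rw [continuous_iff_continuousAt]
    intro z
    rw [ContinuousAt, tendsto_iff_norm_sub_tendsto_zero]
    have h1 : Tendsto (fun x => 4 * Cd 2 * (K * (1 + ‖c0‖)) * √‖x - z‖) (𝓝 z) (𝓝 0) := by
      have : Continuous (fun x => 4 * Cd 2 * (K * (1 + ‖c0‖)) * √‖x - z‖) := by fun_prop
      simpa using this.tendsto z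
    exact squeeze_zero (fun _ => norm_nonneg _) (fun x => cT_holder h0c.aestronglyMeasurable h0K h02 x z) h1
  have hφc : Continuous φ := by rw [hφ]; fun_prop
  have hφ0 : φ 0 = c0 := by simp [hφ]
  set Cφ := C0 * 2 + C0 + ‖b‖ with hCφ
  have hφL : ∀ w : ℂ, ‖w‖ ≤ 2 → ‖φ w - c0‖ ≤ Cφ * ‖w‖ := by
    intro w hw
    have e : φ w - c0 = (cT h0 w - cT h0 0 - D0 w) + D0 w + w • b := by
      simp only [hφ]; abel
    rw [e]
    have a1 := hD0t w hw
    have a2 : ‖D0 w‖ ≤ C0 * ‖w‖ := (D0.le_opNorm _).trans (by gcongr)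
    have a3 : ‖w • b‖ = ‖w‖ * ‖b‖ := norm_smul _ _
    have a4 : √‖w‖ ≤ 2 := by rw [Real.sqrt_le_left (by norm_num)]; linarith
    have a5 : C0 * (‖w‖ * √‖w‖) ≤ C0 * (‖w‖ * 2) := by gcongr
    refine (norm_add₃_le).trans ?_
    rw [hCφ]
    linarith
  set m0 : ℂ → W := fun w => w⁻¹ • L w (φ w - c0) with hm0
  have hm0m : AEStronglyMeasurable m0 volume :=
    (measurable_inv.aestronglyMeasurable).smul
      (hLc.clm_apply (hφc.sub continuous_const)).aestronglyMeasurable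
  have hCφ0 : 0 ≤ Cφ := by positivity
  have hm0K : ∀ w, ‖m0 w‖ ≤ K * Cφ := by
    intro w
    rcases le_or_gt 2 ‖w‖ with h | h
    · simp [hm0, hL2 w h]; positivity
    · rw [hm0]; simp only
      rw [norm_smul, norm_inv]
      rcases eq_or_ne w 0 with rfl | hw
      · simp; positivity
      rw [inv_mul_le_iff₀ (norm_pos_iff.2 hw)]
      calc _ ≤ ‖L w‖ * ‖φ w - c0‖ := (L w).le_opNorm _
        _ ≤ K * (Cφ * ‖w‖) := by
          gcongr
          · exact hLK w
          · exact hφL w h.le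
        _ = _ := by ring
  have hm02 : ∀ w, 2 ≤ ‖w‖ → m0 w = 0 := fun w hw => by simp [hm0, hL2 w hw]
  obtain ⟨k, η, m, M, hηc, hmm, hmM, hm2, hmeq, hηeq⟩ := fixpt L hLc K hK hLK hL2 m0 hm0m _ hm0K hm02
  set u : ℂ → W := fun z => φ z + z • η z with hu
  have hη0 : η 0 = 0 := by rw [hηeq]; simp
  have hu0 : u 0 = c0 := by simp [hu, hφ0]
  have huc : Continuous u := by rw [hu]; fun_prop
  have hwm : ∀ w, w • m w = L w (u w - c0) := by
    intro w
    rcases eq_or_ne w 0 with rfl | hw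
    · simp [hu0]
    · rw [hmeq w, hm0]
      simp only
      rw [smul_add, smul_smul, smul_smul, mul_inv_cancel₀ hw, one_smul, one_smul, ← map_add]
      congr 1
      simp only [hu]; abel
  set Q : ℂ → W := fun z => (c0 - cT h0 0) + z • b - (2 * Real.pi)⁻¹ • (∫ w, m w) - z • (EE k m z - TT k m 0) with hQ
  have hQd : Differentiable ℂ Q := by
    have := EE_diff k hmm hmM hm2
    rw [hQ]; fun_prop
  set h : ℂ → W := fun z => γ z - L z (u z) with hh
  have hwmK : ∀ w, ‖L w (u w - c0)‖ ≤ 2 * M := by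
    intro w
    have hM0 : 0 ≤ M := (norm_nonneg _).trans (hmM 0)
    rcases le_or_gt 2 ‖w‖ with h | h
    · simp [hL2 w h]; positivity
    · rw [← hwm, norm_smul]
      have := hmM w
      gcongr
  have hwm2 : ∀ w, 2 ≤ ‖w‖ → L w (u w - c0) = 0 := fun w hw => by simp [hL2 w hw]
  have hrep : ∀ z, u z = cT h z + Q z := by
    intro z
    have e1 : h = fun w => h0 w - L w (u w - c0) := by
      funext w; simp [hh, hh0]
    have e2 : cT h z = cT h0 z - cT (fun w => L w (u w - c0)) z := by
      rw [e1]
      exact cT_sub h0c.aestronglyMeasurable (hLc.clm_apply (huc.sub continuous_const)).aestronglyMeasurable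
        h0K hwmK h02 hwm2 z
    have e3 := cT_mul hmm hmM hm2 z
    simp only [hwm] at e3
    have e4 : cT (fun w => L w (u w - c0)) z = z • cT m z - (2 * Real.pi)⁻¹ • ∫ w, m w := by
      rw [e3]; abel
    rw [e2, e4]
    simp only [hu, hφ, hQ]
    rw [hηeq z]
    simp only [TT, smul_neg, smul_sub, smul_add]
    abel
  have hQ1 : ContDiff ℝ 1 Q := (hQd.contDiff (n := 1)).restrict_scalars ℝ
  have hQ2 : ContDiff ℝ 1 (fderiv ℝ Q) := 
    ((hQd.contDiff (n := 2)).restrict_scalars ℝ).fderiv_right (by norm_num)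
  obtain ⟨Q1, hQ10, hQ1b⟩ := smooth_holder hQ1
  obtain ⟨Q2, hQ20, hQ2b⟩ := smooth_holder hQ2
  -- bounds on u, h
  obtain ⟨Mu, hMu⟩ := (isCompact_closedBall (0:ℂ) 2).exists_bound_of_continuousOn huc.continuousOn
  have hMu0 : 0 ≤ Mu := (norm_nonneg _).trans (hMu 0 (by simp))
  have hhc : Continuous h := hγc.sub (hLc.clm_apply huc)
  have hh2 : ∀ z, 2 ≤ ‖z‖ → h z = 0 := fun z hz => by simp [hh, hγ2 z hz, hL2 z hz]
  have hhK : ∀ z, ‖h z‖ ≤ K * (1 + Mu) := by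
    intro z
    rcases le_or_gt 2 ‖z‖ with hz | hz
    · rw [hh2 z hz]; simp; positivity
    · refine (norm_sub_le _ _).trans ?_
      have a := hγK z
      have b : ‖L z (u z)‖ ≤ K * Mu := ((L z).le_opNorm _).trans
        (mul_le_mul (hLK z) (hMu z (by simpa using hz.le)) (norm_nonneg _) hK)
      linarith
  set Hu := 4 * Cd 2 * (K * (1 + Mu)) + Q1 with hHu
  have hCd := Cd_nonneg 2
  have hHu0 : 0 ≤ Hu := by positivity
  have huH : ∀ z w, ‖z‖ ≤ 2 → ‖w‖ ≤ 2 → ‖u z - u w‖ ≤ Hu * √‖z - w‖ := by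
    intro z w hz hw
    have e : u z - u w = (cT h z - cT h w) + (Q z - Q w) := by rw [hrep, hrep]; abel
    rw [e]
    refine (norm_add_le _ _).trans ?_
    have a := cT_holder hhc.aestronglyMeasurable hhK hh2 z w
    have b := (hQ1b z w hz hw).2
    rw [hHu]; linarith
  set KH := K * (1 + Mu) + K * Hu with hKH
  have hKH0 : 0 ≤ KH := by positivity
  have hLu : ∀ z w, ‖L z (u z) - L w (u w)‖ ≤ (K * Mu + K * Hu) * √‖z - w‖ := by
    have key : ∀ z w, ‖z‖ ≤ 2 → ‖L z (u z) - L w (u w)‖ ≤ (K * Mu + K * Hu) * √‖z - w‖ := by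
      intro z w hz
      have e : L z (u z) - L w (u w) = (L z - L w) (u z) + L w (u z - u w) := by
        simp
      rw [e]
      refine (norm_add_le _ _).trans ?_
      have a : ‖(L z - L w) (u z)‖ ≤ K * √‖z - w‖ * Mu := ((L z - L w).le_opNorm _).trans
        (mul_le_mul (hLH z w) (hMu z (by simpa using hz)) (norm_nonneg _) (by positivity))
      have b : ‖L w (u z - u w)‖ ≤ K * (Hu * √‖z - w‖) := by
        rcases le_or_gt 2 ‖w‖ with hw | hw
        · simp [hL2 w hw]; positivity
        · exact ((L w).le_opNorm _).trans (mul_le_mul (hLK w) (huH z w hz hw.le) (norm_nonneg _) hK)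
      linarith
    intro z w
    rcases le_or_gt ‖z‖ 2 with hz | hz
    · exact key z w hz
    rcases le_or_gt ‖w‖ 2 with hw | hw
    · rw [norm_sub_rev, norm_sub_rev z w]; exact key w z hw
    · simp [hL2 z hz.le, hL2 w hw.le]; positivity
  have hhH : ∀ z w, ‖h z - h w‖ ≤ KH * √‖z - w‖ := by
    intro z w
    have e : h z - h w = (γ z - γ w) - (L z (u z) - L w (u w)) := by simp only [hh]; abel
    rw [e]
    refine (norm_sub_le _ _).trans ?_
    have a := hγH z w
    have b := hLu z w
    rw [hKH]; linarith
  have hhK' : ∀ z, ‖h z‖ ≤ KH := fun z => (hhK z).trans (by rw [hKH]; nlinarith)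
  have hex := fun z₀ => htay h KH hhc.aestronglyMeasurable hhK' hhH hh2 z₀
  choose! D hDn hDd hDt using hex
  have hder : ∀ z, ‖z‖ < 1 → HasFDerivAt u (D z + fderiv ℝ Q z) z := by
    intro z hz
    have e : u = fun z => cT h z + Q z := funext hrep
    rw [e]
    refine HasFDerivAt.add ?_ (hQ1.differentiable (by norm_num) z).hasFDerivAt
    apply hasFDerivAt_of_taylor (C := CT * KH)
    have : ∀ᶠ w in 𝓝 z, ‖w‖ < 2 := 
      (continuous_norm.tendsto z).eventually (gt_mem_nhds (by linarith))
    filter_upwards [this] with w hw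
    exact hDt z (by linarith) w hw.le
  have hB : 0 ≤ CT * KH := by positivity
  have hDH := holder_of_taylor (f := cT h) (D := D) (C := CT * KH) (B := CT * KH) (ρ' := 1) (ρ := 2)
    (by norm_num) hB hB
    (fun z₀ h0 z hz => hDt z₀ (by linarith) z hz.le) (fun z₀ h0 => hDn z₀ (by linarith))
  set CC := (6 * (CT * KH) + 2 * (CT * KH) / √(2 - 1)) with hCC
  have hCC0 : 0 ≤ CC := by positivity
  refine ⟨u, CT * KH + CC + Q2, by positivity, hu0, ?_, ?_, ?_⟩
  · have h1 : HasFDerivAt (cT h0) D0 0 := by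
      apply hasFDerivAt_of_taylor (C := C0)
      have : ∀ᶠ w in 𝓝 (0:ℂ), ‖w‖ < 2 := 
        (continuous_norm.tendsto (0:ℂ)).eventually (gt_mem_nhds (by simp))
      filter_upwards [this] with w hw
      simpa using hD0t w hw.le
    have h2 : HasFDerivAt (fun z : ℂ => z • η z) (0 : ℂ →L[ℝ] W) 0 := by
      rw [hasFDerivAt_iff_isLittleO_nhds_zero]
      simp only [zero_add, zero_smul, sub_zero, ContinuousLinearMap.zero_apply]
      have : (fun z : ℂ => η z) =o[𝓝 0] (fun _ => (1:ℂ)) := by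
        rw [Asymptotics.isLittleO_one_iff]
        have := hηc.tendsto 0
        rwa [hη0] at this
      have := (Asymptotics.isBigO_refl (fun z : ℂ => z) (𝓝 0)).smul_isLittleO this
      simpa using this
    have h3 : HasFDerivAt (fun z : ℂ => z • b) ((ContinuousLinearMap.id ℝ ℂ).smulRight b) 0 := 
      ((ContinuousLinearMap.id ℝ ℂ).smulRight b).hasFDerivAt
    have h4 : HasFDerivAt u (D0 + (ContinuousLinearMap.id ℝ ℂ).smulRight b + 0) 0 :=
      (((h1.sub_const (cT h0 0)).add_const c0).add h3).add h2
    rw [h4.fderiv]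
    simp [hb]
  · intro z hz
    refine ⟨(hder z hz).differentiableAt, ?_, ?_⟩
    · unfold dbar
      rw [(hder z hz).fderiv]
      have e1 : fderiv ℝ Q z Complex.I = Complex.I • fderiv ℝ Q z 1 := by
        have := (hQd z).hasFDerivAt.restrictScalars ℝ
        rw [this.fderiv]
        simp only [ContinuousLinearMap.coe_restrictScalars']
        rw [← map_smul]; simp
      have e2 := hDd z (by linarith)
      simp only [ContinuousLinearMap.add_apply, smul_add]
      rw [e1, smul_smul, Complex.I_mul_I]
      change _ = h z
      rw [← e2, neg_one_smul]; abel
    · rw [(hder z hz).fderiv]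
      refine (norm_add_le _ _).trans ?_
      have a := hDn z (by linarith)
      have b := (hQ2b z z (by linarith) (by linarith)).1
      linarith
  · intro z w hz hw
    rw [(hder z hz).fderiv, (hder w hw).fderiv]
    have e : D z + fderiv ℝ Q z - (D w + fderiv ℝ Q w) = (D z - D w) + (fderiv ℝ Q z - fderiv ℝ Q w) := by abel
    rw [e]
    refine (norm_add_le _ _).trans ?_
    have a := hDH z w hz hw
    have b := (hQ2b z w (by linarith) (by linarith)).2
    have c : 0 ≤ CT * KH * √‖z - w‖ := by positivity
    linarith

end KR

namespace KR
open MeasureTheory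

section Holder
variable {E F G : Type*} [NormedAddCommGroup E] [NormedSpace ℝ E] [NormedAddCommGroup F] [NormedSpace ℝ F]
  [NormedAddCommGroup G] [NormedSpace ℝ G]

def Ysub (F : Type*) [NormedAddCommGroup F] [NormedSpace ℝ F] :
    Submodule ℝ (lp (fun _ : ℂ × ℂ => F) ∞) where
  carrier := {y | (∀ z w : ℂ, ‖z‖ < 1 → ‖w‖ < 1 → y (z, z) - y (w, w) = √‖z - w‖ • y (z, w)) ∧
    ∀ z w : ℂ, ¬ (‖z‖ < 1 ∧ ‖w‖ < 1) → y (z, w) = 0}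
  zero_mem' := by simp
  add_mem' := by
    rintro a b ⟨ha, ha'⟩ ⟨hb, hb'⟩
    refine ⟨fun z w hz hw => ?_, fun z w h => ?_⟩
    · simp only [lp.coeFn_add, Pi.add_apply, smul_add]
      rw [← ha z w hz hw, ← hb z w hz hw]; abel
    · simp [ha' z w h, hb' z w h]
  smul_mem' := by
    rintro c a ⟨ha, ha'⟩ 
    refine ⟨fun z w hz hw => ?_, fun z w h => ?_⟩
    · simp only [lp.coeFn_smul, Pi.smul_apply]
      rw [smul_comm, ← ha z w hz hw, smul_sub]
    · simp [ha' z w h]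

abbrev Y (F : Type*) [NormedAddCommGroup F] [NormedSpace ℝ F] := ↥(Ysub F)

lemma Ysub_closed : IsClosed ((Ysub F : Set (lp (fun _ : ℂ × ℂ => F) ∞))) := by
  have hc : ∀ i : ℂ × ℂ, Continuous (fun y : lp (fun _ : ℂ × ℂ => F) ∞ => y i) := fun i =>
    (lp.evalCLM ℝ (fun _ : ℂ × ℂ => F) ∞ i).continuous
  have e : (Ysub F : Set (lp (fun _ : ℂ × ℂ => F) ∞)) = 
    {y | (∀ z w : ℂ, ‖z‖ < 1 → ‖w‖ < 1 → y (z, z) - y (w, w) = √‖z - w‖ • y (z, w)) ∧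
    ∀ z w : ℂ, ¬ (‖z‖ < 1 ∧ ‖w‖ < 1) → y (z, w) = 0} := rfl
  rw [e]
  simp only [setOf_and, setOf_forall]
  refine IsClosed.inter ?_ ?_
  · refine isClosed_iInter fun z => isClosed_iInter fun w => isClosed_iInter fun _ => isClosed_iInter fun _ => ?_
    exact isClosed_eq ((hc _).sub (hc _)) ((hc _).const_smul _)
  · refine isClosed_iInter fun z => isClosed_iInter fun w => isClosed_iInter fun _ => ?_
    exact isClosed_eq (hc _) continuous_const

instance [CompleteSpace F] : CompleteSpace (Y F) := Ysub_closed.completeSpace_coe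

def ev (y : Y F) (z : ℂ) : F := y.1 (z, z)

@[simp] lemma ev_add (a b : Y F) (z : ℂ) : ev (a + b) z = ev a z + ev b z := rfl
@[simp] lemma ev_sub (a b : Y F) (z : ℂ) : ev (a - b) z = ev a z - ev b z := rfl
@[simp] lemma ev_neg (a : Y F) (z : ℂ) : ev (-a) z = -ev a z := rfl
@[simp] lemma ev_zero (z : ℂ) : ev (0 : Y F) z = 0 := rfl
@[simp] lemma ev_smul (c : ℝ) (a : Y F) (z : ℂ) : ev (c • a) z = c • ev a z := rfl

lemma norm_ev_le (y : Y F) (z : ℂ) : ‖ev y z‖ ≤ ‖y‖ := lp.norm_apply_le_norm (by simp) y.1 _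

lemma ev_out (y : Y F) {z : ℂ} (hz : ¬ ‖z‖ < 1) : ev y z = 0 := y.2.2 z z (by tauto)

lemma norm_ev_sub_le (y : Y F) {z w : ℂ} (hz : ‖z‖ < 1) (hw : ‖w‖ < 1) :
    ‖ev y z - ev y w‖ ≤ ‖y‖ * √‖z - w‖ := by
  have := y.2.1 z w hz hw
  unfold ev
  rw [this, norm_smul, Real.norm_of_nonneg (Real.sqrt_nonneg _), mul_comm]
  gcongr
  exact lp.norm_apply_le_norm (by simp) y.1 _

lemma norm_Y_le (y : Y F) {C : ℝ} (hC : 0 ≤ C) (h1 : ∀ z, ‖z‖ < 1 → ‖ev y z‖ ≤ C)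
    (h2 : ∀ z w, ‖z‖ < 1 → ‖w‖ < 1 → ‖ev y z - ev y w‖ ≤ C * √‖z - w‖) : ‖y‖ ≤ C := by
  change ‖y.1‖ ≤ C
  refine lp.norm_le_of_forall_le hC ?_
  rintro ⟨z, w⟩
  by_cases h : ‖z‖ < 1 ∧ ‖w‖ < 1
  · rcases eq_or_ne z w with rfl | hne
    · exact h1 z h.1
    · have a := y.2.1 z w h.1 h.2
      have b := h2 z w h.1 h.2
      unfold ev at b
      rw [a, norm_smul, Real.norm_of_nonneg (Real.sqrt_nonneg _), mul_comm] at b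
      have : 0 < √‖z - w‖ := Real.sqrt_pos.2 (norm_pos_iff.2 (sub_ne_zero.2 hne))
      exact le_of_mul_le_mul_right b this
  · rw [y.2.2 z w h]; simpa using hC

lemma Y_ext {a b : Y F} (h : ∀ z, ‖z‖ < 1 → ev a z = ev b z) : a = b := by
  rw [← sub_eq_zero, ← norm_le_zero_iff]
  refine norm_Y_le _ le_rfl (fun z hz => by simp [h z hz]) (fun z w hz hw => by simp [h z hz, h w hw])

def IsH (u : ℂ → F) (C : ℝ) : Prop := 0 ≤ C ∧ (∀ z, ‖z‖ < 1 → ‖u z‖ ≤ C) ∧ 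
  ∀ z w, ‖z‖ < 1 → ‖w‖ < 1 → ‖u z - u w‖ ≤ C * √‖z - w‖

lemma exists_Y {u : ℂ → F} {C : ℝ} (h : IsH u C) : ∃ y : Y F, ‖y‖ ≤ C ∧ ∀ z, ‖z‖ < 1 → ev y z = u z := by
  classical
  let y0 : ℂ × ℂ → F := fun i => if ‖i.1‖ < 1 ∧ ‖i.2‖ < 1 then 
    (if i.1 = i.2 then u i.1 else (√‖i.1 - i.2‖)⁻¹ • (u i.1 - u i.2)) else 0
  have hy0 : ∀ i, ‖y0 i‖ ≤ C := by
    rintro ⟨z, w⟩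
    simp only [y0]
    split_ifs with h1 h2
    · exact h.2.1 _ h1.1
    · have : 0 < √‖z - w‖ := Real.sqrt_pos.2 (norm_pos_iff.2 (sub_ne_zero.2 h2))
      rw [norm_smul, norm_inv, Real.norm_of_nonneg this.le, inv_mul_le_iff₀ this, mul_comm]
      exact h.2.2 _ _ h1.1 h1.2
    · simpa using h.1
  let y1 : lp (fun _ : ℂ × ℂ => F) ∞ := ⟨y0, memℓp_infty ⟨C, by rintro _ ⟨i, rfl⟩; exact hy0 i⟩⟩
  have hev : ∀ z, ‖z‖ < 1 → y1 (z, z) = u z := by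
    intro z hz
    change y0 (z, z) = _
    simp [y0, hz]
  have hmem : y1 ∈ Ysub F := by
    refine ⟨fun z w hz hw => ?_, fun z w hzw => ?_⟩
    · rw [hev z hz, hev w hw]
      rcases eq_or_ne z w with rfl | hne
      · simp
      · have : 0 < √‖z - w‖ := Real.sqrt_pos.2 (norm_pos_iff.2 (sub_ne_zero.2 hne))
        change _ = √‖z - w‖ • y0 (z, w)
        simp only [y0, hz, hw, hne, if_true, if_false, and_self]
        rw [smul_smul, mul_inv_cancel₀ this.ne', one_smul]
    · change y0 (z, w) = 0
      simp only [y0]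
      rw [if_neg hzw]
  exact ⟨⟨y1, hmem⟩, lp.norm_le_of_forall_le h.1 hy0, hev⟩

lemma isH_ev (y : Y F) : IsH (ev y) ‖y‖ := 
  ⟨norm_nonneg _, fun z _ => norm_ev_le y z, fun z w hz hw => norm_ev_sub_le y hz hw⟩

lemma isH_bil {a : ℂ → E →L[ℝ] F} {b : ℂ → E} {A B : ℝ} (ha : IsH a A) (hb : IsH b B) :
    IsH (fun z => a z (b z)) (2 * A * B) := by
  have hA := ha.1
  have hB := hb.1
  refine ⟨by positivity, fun z hz => ?_, fun z w hz hw => ?_⟩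
  · have := ((a z).le_opNorm (b z)).trans (mul_le_mul (ha.2.1 z hz) (hb.2.1 z hz) (norm_nonneg _) hA)
    nlinarith [mul_nonneg hA hB]
  · have e : a z (b z) - a w (b w) = (a z - a w) (b z) + a w (b z - b w) := by simp
    rw [e]
    refine (norm_add_le _ _).trans ?_
    have h1 := ((a z - a w).le_opNorm (b z)).trans (mul_le_mul (ha.2.2 z w hz hw) (hb.2.1 z hz) (norm_nonneg _) (by positivity))
    have h2 := ((a w).le_opNorm (b z - b w)).trans (mul_le_mul (ha.2.1 w hw) (hb.2.2 z w hz hw) (norm_nonneg _) hA)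
    linarith

def bil0 (a : Y (E →L[ℝ] F)) (b : Y E) : Y F := (exists_Y (isH_bil (isH_ev a) (isH_ev b))).choose

lemma bil0_norm (a : Y (E →L[ℝ] F)) (b : Y E) : ‖bil0 a b‖ ≤ 2 * ‖a‖ * ‖b‖ := 
  (exists_Y (isH_bil (isH_ev a) (isH_ev b))).choose_spec.1

lemma bil0_ev (a : Y (E →L[ℝ] F)) (b : Y E) {z : ℂ} (hz : ‖z‖ < 1) : ev (bil0 a b) z = ev a z (ev b z) :=
  (exists_Y (isH_bil (isH_ev a) (isH_ev b))).choose_spec.2 z hz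

def Bil : Y (E →L[ℝ] F) →L[ℝ] Y E →L[ℝ] Y F :=
  LinearMap.mkContinuous₂ (LinearMap.mk₂ ℝ bil0
    (fun a a' b => Y_ext fun z hz => by simp [bil0_ev _ _ hz])
    (fun c a b => Y_ext fun z hz => by simp [bil0_ev _ _ hz])
    (fun a b b' => Y_ext fun z hz => by simp [bil0_ev _ _ hz])
    (fun c a b => Y_ext fun z hz => by simp [bil0_ev _ _ hz])) 2 
    (fun a b => bil0_norm a b)

lemma Bil_ev (a : Y (E →L[ℝ] F)) (b : Y E) {z : ℂ} (hz : ‖z‖ < 1) : ev (Bil a b) z = ev a z (ev b z) :=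
  bil0_ev a b hz

def evL (z : ℂ) : Y F →L[ℝ] F := LinearMap.mkContinuous 
  { toFun := fun y => ev y z, map_add' := fun _ _ => rfl, map_smul' := fun _ _ => rfl } 1 
  (fun y => by rw [one_mul]; exact norm_ev_le y z)

@[simp] lemma evL_apply (z : ℂ) (y : Y F) : evL z y = ev y z := rfl

/-- post-composition with a fixed linear map -/
def post (T : E →L[ℝ] F) : Y E →L[ℝ] Y F :=
  Bil (exists_Y (u := fun _ => T) (C := ‖T‖) ⟨norm_nonneg _, fun _ _ => le_rfl, fun _ _ _ _ => by simp; positivity⟩).choose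

lemma post_ev (T : E →L[ℝ] F) (y : Y E) {z : ℂ} (hz : ‖z‖ < 1) : ev (post T y) z = T (ev y z) := by
  unfold post
  rw [Bil_ev _ _ hz, (exists_Y (u := fun _ => T) (C := ‖T‖) ⟨norm_nonneg _, fun _ _ => le_rfl, fun _ _ _ _ => by simp; positivity⟩).choose_spec.2 z hz]

def Xsub (V : Type*) [NormedAddCommGroup V] [NormedSpace ℝ V] : Submodule ℝ (Y V × Y (ℂ →L[ℝ] V)) where
  carrier := {x | ∀ z : ℂ, ‖z‖ < 1 → HasFDerivAt (ev x.1) (ev x.2 z) z}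
  zero_mem' := by
    intro z hz
    exact hasFDerivAt_const (0:V) z
  add_mem' := by
    intro a b ha hb z hz
    exact (ha z hz).add (hb z hz)
  smul_mem' := by
    intro c a ha z hz
    exact (ha z hz).const_smul c

lemma Xsub_closed : IsClosed ((Xsub F : Set (Y F × Y (ℂ →L[ℝ] F)))) := by
  refine IsSeqClosed.isClosed ?_
  intro x a hx hxa z hz
  have h1 : Tendsto (fun n => (x n).1) atTop (𝓝 a.1) := (continuous_fst.tendsto a).comp hxa
  have h2 : Tendsto (fun n => (x n).2) atTop (𝓝 a.2) := (continuous_snd.tendsto a).comp hxa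
  refine hasFDerivAt_of_tendstoUniformlyOn (s := ball (0:ℂ) 1) (l := atTop) (f := fun n => ev (x n).1)
    (f' := fun n => ev (x n).2) (g' := fun z => ev a.2 z) isOpen_ball ?_ ?_ ?_ (by simpa using hz)
  · rw [Metric.tendstoUniformlyOn_iff]
    intro ε hε
    filter_upwards [Metric.tendsto_nhds.1 h2 ε hε] with n hn w _
    rw [dist_comm] at hn
    refine lt_of_le_of_lt ?_ hn
    rw [dist_eq_norm, dist_eq_norm, ← ev_sub]
    exact norm_ev_le _ _
  · intro n w hw
    exact hx n w (by simpa using hw)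
  · intro w _
    exact ((evL (F := F) w).continuous.tendsto a.1).comp h1

abbrev X (V : Type*) [NormedAddCommGroup V] [NormedSpace ℝ V] := ↥(Xsub V)

instance [CompleteSpace F] : CompleteSpace (X F) := Xsub_closed.completeSpace_coe

end Holder

end KR

namespace KR
open MeasureTheory

section Nem
variable {V E : Type*} [NormedAddCommGroup V] [NormedSpace ℝ V] [NormedAddCommGroup E] [NormedSpace ℝ E]

lemma four_point {Φ : V → E} {Φ' : V → V →L[ℝ] E} {M : ℝ} (hM : 0 ≤ M) (hd : ∀ x, HasFDerivAt Φ (Φ' x) x)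
    (hb : ∀ x, ‖Φ' x‖ ≤ M) (hl : ∀ x y, ‖Φ' x - Φ' y‖ ≤ M * ‖x - y‖) (c₁ c₂ d₁ d₂ : V) :
    ‖(Φ (c₁ + d₁) - Φ c₁) - (Φ (c₂ + d₂) - Φ c₂)‖ ≤ M * ‖d₁ - d₂‖ + M * (‖c₁ - c₂‖ + ‖d₁ - d₂‖) * ‖d₂‖ := by
  have hp : ∀ c d : V, ∀ t : ℝ, HasDerivAt (fun t : ℝ => Φ (c + t • d)) (Φ' (c + t • d) d) t := by
    intro c d t
    have h1 : HasDerivAt (fun t : ℝ => c + t • d) d t := by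
      simpa using ((hasDerivAt_id t).smul_const d).const_add c
    exact (hd (c + t • d)).comp_hasDerivAt t h1
  have := norm_image_sub_le_of_norm_deriv_le_segment_01' (f := fun t : ℝ => Φ (c₁ + t • d₁) - Φ (c₂ + t • d₂))
    (f' := fun t => Φ' (c₁ + t • d₁) d₁ - Φ' (c₂ + t • d₂) d₂)
    (C := M * ‖d₁ - d₂‖ + M * (‖c₁ - c₂‖ + ‖d₁ - d₂‖) * ‖d₂‖)
    (fun t _ => ((hp c₁ d₁ t).sub (hp c₂ d₂ t)).hasDerivWithinAt) ?_
  · simp only [one_smul, zero_smul, add_zero] at this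
    refine le_trans (le_of_eq ?_) this
    congr 1; abel
  · intro t ht
    have e : Φ' (c₁ + t • d₁) d₁ - Φ' (c₂ + t • d₂) d₂ = 
      Φ' (c₁ + t • d₁) (d₁ - d₂) + (Φ' (c₁ + t • d₁) - Φ' (c₂ + t • d₂)) d₂ := by simp
    rw [e]
    refine (norm_add_le _ _).trans (add_le_add ?_ ?_)
    · exact (ContinuousLinearMap.le_opNorm _ _).trans (by gcongr; exact hb _)
    · refine (ContinuousLinearMap.le_opNorm _ _).trans ?_
      gcongr
      refine (hl _ _).trans ?_
      gcongr
      have e2 : c₁ + t • d₁ - (c₂ + t • d₂) = (c₁ - c₂) + t • (d₁ - d₂) := by rw [smul_sub]; abel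
      rw [e2]
      refine (norm_add_le _ _).trans ?_
      rw [norm_smul, Real.norm_of_nonneg ht.1]
      have := mul_le_of_le_one_left (norm_nonneg (d₁ - d₂)) ht.2.le
      linarith

/-- quantitative C^2,1 bounds -/
structure Nice (G : V → E) (G' : V → V →L[ℝ] E) (M : ℝ) : Prop where
  hM : 0 ≤ M
  h0 : ∀ x, ‖G x‖ ≤ M
  hd : ∀ x, HasFDerivAt G (G' x) x
  h1 : ∀ x, ‖G' x‖ ≤ M
  hd1 : ∃ G'' : V → V →L[ℝ] V →L[ℝ] E, (∀ x, HasFDerivAt G' (G'' x) x) ∧ (∀ x, ‖G'' x‖ ≤ M) ∧ 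
    ∀ x y, ‖G'' x - G'' y‖ ≤ M * ‖x - y‖

lemma lip_of {G : V → E} {G' : V → V →L[ℝ] E} {M : ℝ} (hd : ∀ x, HasFDerivAt G (G' x) x)
    (h1 : ∀ x, ‖G' x‖ ≤ M) (x y : V) : ‖G x - G y‖ ≤ M * ‖x - y‖ := 
  Convex.norm_image_sub_le_of_norm_hasFDerivWithin_le (s := univ) (fun x _ => (hd x).hasFDerivWithinAt)
    (fun x _ => h1 x) convex_univ (mem_univ _) (mem_univ _)

lemma isH_comp {G : V → E} {M : ℝ} (hM : 0 ≤ M) (h0 : ∀ x, ‖G x‖ ≤ M) 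
    (hl : ∀ x y, ‖G x - G y‖ ≤ M * ‖x - y‖) (g : Y V) : IsH (fun z => G (ev g z)) (M * (1 + ‖g‖)) := by
  refine ⟨by positivity, fun z hz => (h0 _).trans ?_, fun z w hz hw => (hl _ _).trans ?_⟩
  · nlinarith [mul_nonneg hM (norm_nonneg g)]
  · have := norm_ev_sub_le g hz hw
    have h2 : M * ‖ev g z - ev g w‖ ≤ M * (‖g‖ * √‖z - w‖) := by gcongr
    have : 0 ≤ M * √‖z - w‖ := by positivity
    linarith

lemma nem {G : V → E} {G' : V → V →L[ℝ] E} {M : ℝ} (hG : Nice G G' M) :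
    ∃ N : Y V → Y E, (∀ g z, ‖z‖ < 1 → ev (N g) z = G (ev g z)) ∧ ∀ c : Y V, ∃ N' : Y (V →L[ℝ] E), 
      (∀ z, ‖z‖ < 1 → ev N' z = G' (ev c z)) ∧ HasStrictFDerivAt N (Bil N') c := by
  have hM := hG.hM
  have hl := lip_of hG.hd hG.h1
  obtain ⟨G'', hd1, h2, h3⟩ := hG.hd1
  have hl' := lip_of hd1 h2
  choose N hNn hN using fun g : Y V => exists_Y (isH_comp hM hG.h0 hl g)
  refine ⟨N, hN, fun c => ?_⟩
  obtain ⟨N', -, hN'⟩ := exists_Y (isH_comp hM hG.h1 hl' c)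
  refine ⟨N', hN', ?_⟩
  have key : ∀ (δ : ℝ) (a b : Y V), ‖a - c‖ ≤ δ → ‖b - c‖ ≤ δ → 
      ‖N a - N b - Bil N' (a - b)‖ ≤ M * δ * (2 + ‖c‖ + δ) * ‖a - b‖ := by
    intro δ a b ha hb
    have hδ : 0 ≤ δ := (norm_nonneg _).trans ha
    have hev : ∀ z, ‖z‖ < 1 → ev (N a - N b - Bil N' (a - b)) z = 
        G (ev a z) - G (ev b z) - G' (ev c z) (ev a z - ev b z) := by
      intro z hz
      rw [ev_sub, ev_sub, Bil_ev _ _ hz, hN _ _ hz, hN _ _ hz, hN' _ hz, ev_sub]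
    have hp : ∀ (z : ℂ) (t : ℝ), HasDerivAt (fun t : ℝ => G (ev b z + t • (ev a z - ev b z)) - t • G' (ev c z) (ev a z - ev b z)) 
        ((G' (ev b z + t • (ev a z - ev b z)) - G' (ev c z)) (ev a z - ev b z)) t := by
      intro z t
      have h1 : HasDerivAt (fun t : ℝ => ev b z + t • (ev a z - ev b z)) (ev a z - ev b z) t := by
        simpa using ((hasDerivAt_id t).smul_const (ev a z - ev b z)).const_add (ev b z)
      have h2 := (hG.hd (ev b z + t • (ev a z - ev b z))).comp_hasDerivAt t h1
      have h3 : HasDerivAt (fun t : ℝ => t • G' (ev c z) (ev a z - ev b z)) (G' (ev c z) (ev a z - ev b z)) t := by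
        simpa using (hasDerivAt_id t).smul_const (G' (ev c z) (ev a z - ev b z))
      exact h2.sub h3
    -- the interpolating element
    have hd : ∀ t : ℝ, t ∈ Ico (0:ℝ) 1 → ∃ d : Y V, ‖d‖ ≤ δ ∧ ∀ z, ev b z + t • (ev a z - ev b z) = ev c z + ev d z := by
      intro t ht
      refine ⟨(1 - t) • (b - c) + t • (a - c), ?_, ?_⟩
      · refine (norm_add_le _ _).trans ?_
        rw [norm_smul, norm_smul, Real.norm_of_nonneg ht.1, Real.norm_of_nonneg (by linarith [ht.2])]
        have := mul_le_mul_of_nonneg_left ha ht.1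
        have := mul_le_mul_of_nonneg_left hb (by linarith [ht.2] : 0 ≤ 1 - t)
        linarith
      · intro z
        simp only [ev_add, ev_smul, ev_sub]
        module
    have hMd : 0 ≤ M * δ := by positivity
    refine norm_Y_le _ (by positivity) ?_ ?_
    · intro z hz
      rw [hev z hz]
      have := norm_image_sub_le_of_norm_deriv_le_segment_01' (C := M * δ * ‖a - b‖)
        (fun t _ => (hp z t).hasDerivWithinAt) ?_
      · simp only [one_smul, zero_smul, add_zero, sub_zero, add_sub_cancel] at this
        have e : G (ev a z) - G (ev b z) - G' (ev c z) (ev a z - ev b z) = 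
          G (ev a z) - G' (ev c z) (ev a z - ev b z) - G (ev b z) := by abel
        rw [e]
        refine this.trans ?_
        have : 0 ≤ M * δ * ‖a - b‖ := by positivity
        nlinarith [mul_nonneg this (norm_nonneg c), mul_nonneg this hδ]
      · intro t ht
        obtain ⟨d, hdn, hde⟩ := hd t ht
        refine (ContinuousLinearMap.le_opNorm _ _).trans ?_
        have h1 : ‖ev a z - ev b z‖ ≤ ‖a - b‖ := norm_ev_le (a - b) z
        have h2 : ‖G' (ev b z + t • (ev a z - ev b z)) - G' (ev c z)‖ ≤ M * δ := by
          rw [hde z]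
          refine (hl' _ _).trans ?_
          rw [add_sub_cancel_left]
          have := norm_ev_le d z
          gcongr
          linarith
        exact mul_le_mul h2 h1 (norm_nonneg _) hMd
    · intro z w hz hw
      rw [hev z hz, hev w hw]
      set s := √‖z - w‖ with hs
      have hs0 : 0 ≤ s := Real.sqrt_nonneg _
      have := norm_image_sub_le_of_norm_deriv_le_segment_01' (C := M * δ * (2 + ‖c‖ + δ) * ‖a - b‖ * s)
        (fun t _ => ((hp z t).sub (hp w t)).hasDerivWithinAt) ?_
      · simp only [Pi.sub_apply, one_smul, zero_smul, add_zero, sub_zero, add_sub_cancel] at this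
        refine le_trans (le_of_eq ?_) this
        congr 1; abel
      · intro t ht
        obtain ⟨d, hdn, hde⟩ := hd t ht
        rw [hde z, hde w]
        have h1 : ‖ev a z - ev b z‖ ≤ ‖a - b‖ := norm_ev_le (a - b) z
        have h1' : ‖(ev a z - ev b z) - (ev a w - ev b w)‖ ≤ ‖a - b‖ * s := norm_ev_sub_le (a - b) hz hw
        have h4 := four_point hM hd1 h2 h3 (ev c z) (ev c w) (ev d z) (ev d w)
        have h5 : ‖ev d z - ev d w‖ ≤ δ * s := (norm_ev_sub_le d hz hw).trans (by gcongr)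
        have h6 : ‖ev c z - ev c w‖ ≤ ‖c‖ * s := (norm_ev_sub_le c hz hw)
        have h7 : ‖ev d w‖ ≤ δ := (norm_ev_le d w).trans hdn
        have h8 : ‖G' (ev c w + ev d w) - G' (ev c w)‖ ≤ M * δ := by
          refine (hl' _ _).trans ?_
          rw [add_sub_cancel_left]; gcongr
        set S1 := G' (ev c z + ev d z) - G' (ev c z)
        set S2 := G' (ev c w + ev d w) - G' (ev c w)
        have h9 : ‖S1 - S2‖ ≤ M * (δ * s) + M * (‖c‖ * s + δ * s) * δ := h4.trans (by gcongr)
        have e : S1 (ev a z - ev b z) - S2 (ev a w - ev b w) = 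
          (S1 - S2) (ev a z - ev b z) + S2 ((ev a z - ev b z) - (ev a w - ev b w)) := by 
          simp only [ContinuousLinearMap.sub_apply, map_sub]; abel
        rw [e]
        refine (norm_add_le _ _).trans ?_
        have k1 := ((S1 - S2).le_opNorm (ev a z - ev b z)).trans 
          (mul_le_mul h9 h1 (norm_nonneg _) (by positivity))
        have k2 := (S2.le_opNorm ((ev a z - ev b z) - (ev a w - ev b w))).trans 
          (mul_le_mul h8 h1' (norm_nonneg _) hMd)
        linarith
  refine .of_isLittleO ?_
  rw [Asymptotics.isLittleO_iff]
  intro ε hε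
  set δ : ℝ := min 1 (ε / (M * (3 + ‖c‖) + 1)) with hδd
  have hden : 0 < M * (3 + ‖c‖) + 1 := by positivity
  have hδ : 0 < δ := lt_min one_pos (by positivity)
  have hδ1 : δ ≤ 1 := min_le_left _ _
  have hδ2 : M * δ * (2 + ‖c‖ + δ) ≤ ε := by
    have h1 : δ * (M * (3 + ‖c‖) + 1) ≤ ε := by
      rw [← le_div_iff₀ hden]; exact min_le_right _ _
    have h2 : M * δ * (2 + ‖c‖ + δ) ≤ M * δ * (2 + ‖c‖ + 1) := by gcongr
    nlinarith
  have hball : closedBall c δ ∈ 𝓝 c := closedBall_mem_nhds c hδ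
  filter_upwards [prod_mem_nhds hball hball] with p hp
  refine (key δ p.1 p.2 (by simpa [dist_eq_norm] using hp.1) (by simpa [dist_eq_norm] using hp.2)).trans ?_
  gcongr
end Nem

end KR

namespace KR
open MeasureTheory

section Ext
variable {E F G : Type*} [NormedAddCommGroup E] [NormedSpace ℝ E] [NormedAddCommGroup F] [NormedSpace ℝ F]
  [NormedAddCommGroup G] [NormedSpace ℝ G]

lemma IsH.mono {u : ℂ → F} {C C' : ℝ} (h : IsH u C) (hC : C ≤ C') : IsH u C' :=
  ⟨h.1.trans hC, fun z hz => (h.2.1 z hz).trans hC, fun z w hz hw => (h.2.2 z w hz hw).trans (by gcongr)⟩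

lemma IsH.add {u v : ℂ → F} {C D : ℝ} (h : IsH u C) (k : IsH v D) : IsH (fun z => u z + v z) (C + D) := by
  refine ⟨add_nonneg h.1 k.1, fun z hz => (norm_add_le _ _).trans (add_le_add (h.2.1 z hz) (k.2.1 z hz)),
    fun z w hz hw => ?_⟩
  have e : u z + v z - (u w + v w) = (u z - u w) + (v z - v w) := by abel
  rw [e, add_mul]
  exact (norm_add_le _ _).trans (add_le_add (h.2.2 z w hz hw) (k.2.2 z w hz hw))

lemma IsH.neg {u : ℂ → F} {C : ℝ} (h : IsH u C) : IsH (fun z => - u z) C := by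
  refine ⟨h.1, fun z hz => by rw [norm_neg]; exact h.2.1 z hz, fun z w hz hw => ?_⟩
  have e : - u z - - u w = -(u z - u w) := by abel
  rw [e, norm_neg]; exact h.2.2 z w hz hw

lemma IsH.sub {u v : ℂ → F} {C D : ℝ} (h : IsH u C) (k : IsH v D) : IsH (fun z => u z - v z) (C + D) := by
  simpa [sub_eq_add_neg] using h.add k.neg

lemma IsH.const (c : F) : IsH (fun _ => c) ‖c‖ := 
  ⟨norm_nonneg _, fun _ _ => le_rfl, fun _ _ _ _ => by simp; positivity⟩

lemma IsH.post (T : E →L[ℝ] F) {u : ℂ → E} {C : ℝ} (h : IsH u C) : IsH (fun z => T (u z)) (‖T‖ * C) := by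
  have := h.1
  refine ⟨by positivity, fun z hz => (T.le_opNorm _).trans (by gcongr; exact h.2.1 z hz), fun z w hz hw => ?_⟩
  rw [← map_sub, mul_assoc]
  exact (T.le_opNorm _).trans (by gcongr; exact h.2.2 z w hz hw)

lemma IsH.comp {a : ℂ → F →L[ℝ] G} {b : ℂ → E →L[ℝ] F} {A B : ℝ} (ha : IsH a A) (hb : IsH b B) :
    ∃ C, IsH (fun z => (a z).comp (b z)) C := 
  ⟨_, isH_bil (ha.post (ContinuousLinearMap.compL ℝ E F G)) hb⟩

lemma IsH.flip {a : ℂ → E →L[ℝ] F →L[ℝ] G} {A : ℝ} (ha : IsH a A) :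
    IsH (fun z => (a z).flip) A := by
  refine ⟨ha.1, fun z hz => by rw [ContinuousLinearMap.opNorm_flip]; exact ha.2.1 z hz, fun z w hz hw => ?_⟩
  have : (a z).flip - (a w).flip = (a z - a w).flip := by ext; simp
  rw [this, ContinuousLinearMap.opNorm_flip]; exact ha.2.2 z w hz hw

lemma le_sqrt_of {x : ℝ} (h0 : 0 ≤ x) (h : x ≤ 4) : x ≤ 2 * √x := by
  have h1 : √x ≤ 2 := by rw [Real.sqrt_le_left (by norm_num)]; linarith
  nlinarith [Real.mul_self_sqrt h0, Real.sqrt_nonneg x]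

lemma isH_of_deriv {u : ℂ → F} {C : ℝ} (hC : 0 ≤ C)
    (h : ∀ z, ‖z‖ < 1 → DifferentiableAt ℝ u z ∧ ‖fderiv ℝ u z‖ ≤ C) : 
    IsH u (‖u 0‖ + 2 * C) := by
  have hl : ∀ z w, ‖z‖ < 1 → ‖w‖ < 1 → ‖u z - u w‖ ≤ C * ‖z - w‖ := by
    intro z w hz hw
    exact Convex.norm_image_sub_le_of_norm_fderiv_le (𝕜 := ℝ) (f := u) (s := ball (0:ℂ) 1) (C := C)
      (fun x hx => (h x (by simpa using hx)).1) (fun x hx => (h x (by simpa using hx)).2) (convex_ball _ _)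
      (x := w) (y := z) (by simpa using hw) (by simpa using hz)
  refine ⟨by positivity, fun z hz => ?_, fun z w hz hw => ?_⟩
  · have := hl z 0 hz (by simp)
    rw [sub_zero] at this
    have h2 : ‖u z‖ ≤ ‖u 0‖ + ‖u z - u 0‖ := norm_le_norm_add_norm_sub' _ _
    nlinarith [norm_nonneg z]
  · have h4 : ‖z - w‖ ≤ 4 := (norm_sub_le _ _).trans (by linarith)
    have := le_sqrt_of (norm_nonneg (z - w)) h4
    have h5 : C * ‖z - w‖ ≤ C * (2 * √‖z - w‖) := by gcongr
    have h6 : 0 ≤ ‖u 0‖ * √‖z - w‖ := by positivity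
    linarith [hl z w hz hw]

def ret (z : ℂ) : ℂ := ((max 1 ‖z‖)⁻¹ : ℝ) • z

lemma norm_ret_le (z : ℂ) : ‖ret z‖ ≤ 1 := by
  unfold ret
  have : 0 < max 1 ‖z‖ := by positivity
  rw [norm_smul, norm_inv, Real.norm_of_nonneg this.le, inv_mul_le_iff₀ this, mul_one]
  exact le_max_right _ _

lemma ret_eq {z : ℂ} (hz : ‖z‖ ≤ 1) : ret z = z := by
  unfold ret; rw [max_eq_left hz]; simp

lemma ret_lip (z w : ℂ) : ‖ret z - ret w‖ ≤ 2 * ‖z - w‖ := by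
  have ha : 1 ≤ max 1 ‖z‖ := le_max_left _ _
  have hb : 0 < max 1 ‖w‖ := by positivity
  have hab : |max 1 ‖w‖ - max 1 ‖z‖| ≤ ‖z - w‖ := by
    rw [max_comm, max_comm 1 ‖z‖, norm_sub_rev]
    exact (abs_max_sub_max_le_abs _ _ _).trans (abs_norm_sub_norm_le w z)
  set a := max 1 ‖z‖
  have e : ret z - ret w = a⁻¹ • ((z - w) + (max 1 ‖w‖ - a) • ret w) := by
    unfold ret
    have ha' : a ≠ 0 := by linarith
    rw [sub_smul, smul_smul, mul_inv_cancel₀ hb.ne']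
    simp only [smul_add, smul_sub, one_smul, smul_smul, ← mul_assoc, inv_mul_cancel₀ ha', one_mul, a]
    abel
  rw [e, norm_smul, norm_inv, Real.norm_of_nonneg (by linarith), inv_mul_le_iff₀ (by linarith)]
  refine (norm_add_le _ _).trans ?_
  rw [norm_smul, Real.norm_eq_abs]
  have h1 := norm_ret_le w
  have h2 : |max 1 ‖w‖ - a| * ‖ret w‖ ≤ ‖z - w‖ * 1 := by gcongr
  nlinarith [norm_nonneg (z - w)]

def chi (z : ℂ) : ℝ := max 0 (min 1 (2 - ‖z‖))

lemma chi_props : (∀ z, 0 ≤ chi z ∧ chi z ≤ 1) ∧ (∀ z, ‖z‖ < 1 → chi z = 1) ∧ (∀ z, 2 ≤ ‖z‖ → chi z = 0) ∧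
    ∀ z w, |chi z - chi w| ≤ √‖z - w‖ := by
  have h1 : ∀ z, 0 ≤ chi z ∧ chi z ≤ 1 := fun z => ⟨le_max_left _ _, max_le (by norm_num) (min_le_left _ _)⟩
  refine ⟨h1, fun z hz => ?_, fun z hz => ?_, fun z w => ?_⟩
  · unfold chi; rw [min_eq_left (by linarith), max_eq_right (by norm_num)]
  · unfold chi; rw [min_eq_right (by linarith), max_eq_left (by linarith)]
  · have hl : |chi z - chi w| ≤ ‖z - w‖ := by
      unfold chi
      rw [max_comm, max_comm 0 (min 1 (2 - ‖w‖))]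
      refine (abs_max_sub_max_le_abs _ _ _).trans ?_
      refine (abs_min_sub_min_le_max _ _ _ _).trans ?_
      simp only [sub_self, abs_zero]
      refine max_le (norm_nonneg _) ?_
      have : 2 - ‖z‖ - (2 - ‖w‖) = ‖w‖ - ‖z‖ := by ring
      rw [this, norm_sub_rev]; exact abs_norm_sub_norm_le w z
    have hb : |chi z - chi w| ≤ 1 := by
      rw [abs_le]; constructor <;> linarith [(h1 z).1, (h1 z).2, (h1 w).1, (h1 w).2]
    rw [Real.le_sqrt (abs_nonneg _) (norm_nonneg _)]
    nlinarith [abs_nonneg (chi z - chi w)]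

lemma holder_ext [CompleteSpace F] {u : ℂ → F} {C : ℝ} (h : IsH u C) : ∃ U : ℂ → F, 
    (∀ z, ‖z‖ < 1 → U z = u z) ∧ (∀ z, ‖U z‖ ≤ 3 * C) ∧ (∀ z w, ‖U z - U w‖ ≤ 3 * C * √‖z - w‖) ∧
    ∀ z, 2 ≤ ‖z‖ → U z = 0 := by
  obtain ⟨hC, hb, hh⟩ := h
  let r : ℕ → ℝ := fun n => 1 - 1 / ((n:ℝ) + 2)
  have hr : ∀ n, 0 ≤ r n ∧ r n < 1 := by
    intro n
    have : (0:ℝ) < (n:ℝ) + 2 := by positivity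
    have h1 : 1 / ((n:ℝ) + 2) ≤ 1 := by rw [div_le_one this]; linarith [(Nat.cast_nonneg n : (0:ℝ) ≤ n)]
    have h2 : 0 < 1 / ((n:ℝ) + 2) := by positivity
    constructor <;> simp only [r] <;> linarith
  have hrt : Tendsto r atTop (𝓝 1) := by
    have h1 : Tendsto (fun n : ℕ => 1 / ((n:ℝ) + 2)) atTop (𝓝 0) := 
      Tendsto.div_atTop tendsto_const_nhds (tendsto_atTop_add_const_right _ _ tendsto_natCast_atTop_atTop)
    have h2 := (tendsto_const_nhds (x := (1:ℝ))).sub h1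
    rw [sub_zero] at h2
    exact h2
  have hin : ∀ n z, ‖r n • ret z‖ < 1 := by
    intro n z
    rw [norm_smul, Real.norm_of_nonneg (hr n).1]
    have := norm_ret_le z
    nlinarith [(hr n).1, (hr n).2, norm_nonneg (ret z)]
  have hrc : CauchySeq r := hrt.cauchySeq
  have hcau : ∀ z, CauchySeq (fun n => u (r n • ret z)) := by
    intro z
    rw [Metric.cauchySeq_iff] at hrc ⊢
    intro ε hε
    obtain ⟨N, hN⟩ := hrc ((ε / (C + 1)) ^ 2) (by positivity)
    refine ⟨N, fun m hm n hn => ?_⟩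
    rw [dist_eq_norm]
    have h1 := hh _ _ (hin m z) (hin n z)
    have h2 : ‖r m • ret z - r n • ret z‖ ≤ dist (r m) (r n) := by
      rw [← sub_smul, norm_smul, dist_eq_norm]
      exact mul_le_of_le_one_right (norm_nonneg _) (norm_ret_le z)
    have h3 : √‖r m • ret z - r n • ret z‖ < ε / (C + 1) := by
      rw [Real.sqrt_lt' (by positivity)]
      exact lt_of_le_of_lt h2 (hN m hm n hn)
    have h4 : C * (ε / (C + 1)) < ε := by
      rw [← mul_div_assoc, div_lt_iff₀ (by positivity)]; nlinarith
    calc _ ≤ _ := h1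
      _ ≤ C * (ε / (C + 1)) := by gcongr
      _ < ε := h4
  choose v hv using fun z => cauchySeq_tendsto_of_complete (hcau z)
  have hvb : ∀ z, ‖v z‖ ≤ C := fun z => 
    le_of_tendsto (hv z).norm (Eventually.of_forall fun n => hb _ (hin n z))
  have hvh : ∀ z w, ‖v z - v w‖ ≤ 2 * C * √‖z - w‖ := by
    intro z w
    refine le_of_tendsto ((hv z).sub (hv w)).norm (Eventually.of_forall fun n => ?_)
    refine (hh _ _ (hin n z) (hin n w)).trans ?_
    have h2 : ‖r n • ret z - r n • ret w‖ ≤ 2 ^ 2 * ‖z - w‖ := by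
      rw [← smul_sub, norm_smul, Real.norm_of_nonneg (hr n).1]
      have := ret_lip z w
      nlinarith [(hr n).1, (hr n).2, norm_nonneg (ret z - ret w), norm_nonneg (z - w)]
    have h3 : √‖r n • ret z - r n • ret w‖ ≤ 2 * √‖z - w‖ := by
      refine (Real.sqrt_le_sqrt h2).trans (le_of_eq ?_)
      rw [Real.sqrt_mul (by positivity), Real.sqrt_sq (by norm_num)]
    nlinarith
  have hvu : ∀ z, ‖z‖ < 1 → v z = u z := by
    intro z hz
    refine tendsto_nhds_unique (hv z) ?_
    rw [tendsto_iff_norm_sub_tendsto_zero, ret_eq hz.le]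
    have h1 : Tendsto (fun n => C * √‖r n • z - z‖) atTop (𝓝 0) := by
      have hc : Continuous (fun t : ℝ => C * √‖t • z - z‖) := by fun_prop
      have := (hc.tendsto 1).comp hrt
      rw [one_smul, sub_self, norm_zero, Real.sqrt_zero, mul_zero] at this
      exact this
    refine squeeze_zero (fun _ => norm_nonneg _) (fun n => ?_) h1
    refine hh _ _ ?_ hz
    have := hin n z
    rwa [ret_eq hz.le] at this
  obtain ⟨c1, c2, c3, c4⟩ := chi_props
  refine ⟨fun z => chi z • v z, fun z hz => by simp [c2 z hz, hvu z hz], fun z => ?_, fun z w => ?_, 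
    fun z hz => by simp [c3 z hz]⟩
  · rw [norm_smul, Real.norm_of_nonneg (c1 z).1]
    have := hvb z
    have := c1 z
    nlinarith [norm_nonneg (v z)]
  · have e : chi z • v z - chi w • v w = (chi z - chi w) • v z + chi w • (v z - v w) := by
      rw [sub_smul, smul_sub]; abel
    rw [e]
    refine (norm_add_le _ _).trans ?_
    rw [norm_smul, norm_smul, Real.norm_eq_abs, Real.norm_of_nonneg (c1 w).1]
    have k1 : |chi z - chi w| * ‖v z‖ ≤ √‖z - w‖ * C := by
      gcongr
      · exact c4 z w
      · exact hvb z
    have k2 : chi w * ‖v z - v w‖ ≤ 1 * (2 * C * √‖z - w‖) := by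
      gcongr
      · exact (c1 w).2
      · exact hvh z w
    linarith
end Ext

end KR

namespace KR
open MeasureTheory

variable {W : Type*} [NormedAddCommGroup W] [NormedSpace ℂ W] [CompleteSpace W]
  [SecondCountableTopology W]
variable {V : Type*} [NormedAddCommGroup V] [NormedSpace ℝ V] [CompleteSpace V]

set_option maxHeartbeats 1000000 in
lemma surj (ι : V →L[ℝ] W) (ψ : W →L[ℝ] V) (hψι : ∀ x, ψ (ι x) = x)
    (hψI : ∀ x, ψ (Complex.I • ι x) = 0) {G : V → V →L[ℝ] V} {G' : V → V →L[ℝ] V →L[ℝ] V} {M : ℝ}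
    (hG : Nice G G' M) (x : X V) 
    (hA : ∀ z, ‖z‖ < 1 → ∀ v, G (ev x.1.1 z) (G (ev x.1.1 z) v) = - v) (γ : Y V) (q w : V) :
    ∃ h : X V, (∀ z, ‖z‖ < 1 → ev h.1.2 z 1 + G (ev x.1.1 z) (ev h.1.2 z Complex.I) + 
      (G' (ev x.1.1 z) (ev h.1.1 z)) (ev x.1.2 z Complex.I) = ev γ z) ∧ ev h.1.1 0 = q ∧ ev h.1.2 0 1 = w := by
  have hM := hG.hM
  set A : ℂ → V →L[ℝ] V := fun z => G (ev x.1.1 z) with hAdef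
  set B : ℂ → V →L[ℝ] V →L[ℝ] V := fun z => G' (ev x.1.1 z) with hB
  set Df : ℂ → ℂ →L[ℝ] V := ev x.1.2 with hDf
  have hAH : IsH A _ := isH_comp hM hG.h0 (lip_of hG.hd hG.h1) x.1.1
  obtain ⟨G'', hd1, h2, h3⟩ := hG.hd1
  have hBH : IsH B _ := isH_comp hM hG.h1 (lip_of hd1 h2) x.1.1
  have hDfH : IsH Df _ := isH_ev x.1.2
  set ψ' : W →L[ℝ] V := ψ.comp ((Complex.I • ContinuousLinearMap.id ℂ W).restrictScalars ℝ) with hψ'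
  have hψ'a : ∀ u, ψ' u = ψ (Complex.I • u) := fun u => by simp [hψ']
  set P : ℂ → W →L[ℝ] V := fun z => ψ - (A z).comp ψ' with hP
  obtain ⟨C1, hC1⟩ := hAH.comp (IsH.const ψ')
  have hPH : IsH P _ := (IsH.const ψ).sub hC1
  -- derivative of A
  set DA : ℂ → ℂ →L[ℝ] V →L[ℝ] V := fun z => (B z).comp (Df z) with hDA
  obtain ⟨C2, hDAH⟩ : ∃ C, IsH DA C := hBH.comp hDfH
  have hAd : ∀ z, ‖z‖ < 1 → HasFDerivAt A (DA z) z := by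
    intro z hz
    exact (hG.hd (ev x.1.1 z)).comp z (x.2 z hz)
  have hevH : ∀ ξ : ℂ, ∃ C, IsH (fun z => Df z ξ) C := fun ξ => ⟨_, isH_bil hDfH (IsH.const ξ)⟩
  have hDAe : ∀ ξ : ℂ, ∃ C, IsH (fun z => DA z ξ) C := fun ξ => ⟨_, isH_bil hDAH (IsH.const ξ)⟩
  set Λ : ℂ → W →L[ℝ] V := fun z => ((B z).flip (Df z Complex.I)).comp (P z) - 
    (DA z 1).comp ψ' - ((A z).comp (DA z Complex.I)).comp ψ' with hΛ
  obtain ⟨C3, hΛH⟩ : ∃ C, IsH Λ C := by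
    obtain ⟨_, a0⟩ := hevH Complex.I
    obtain ⟨_, a1⟩ := (isH_bil hBH.flip a0).comp hPH
    obtain ⟨_, b1⟩ := hDAe 1
    obtain ⟨_, b2⟩ := hDAe Complex.I
    obtain ⟨_, b3⟩ := b1.comp (IsH.const ψ')
    obtain ⟨_, b4⟩ := hAH.comp b2
    obtain ⟨_, b5⟩ := b4.comp (IsH.const ψ')
    exact ⟨_, (a1.sub b3).sub b5⟩
  obtain ⟨C4, hιΛ⟩ := (IsH.const ι).comp hΛH
  have hιγ := (isH_ev γ).post ι
  set C5 := C4 + ‖ι‖ * ‖γ‖ with hC5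
  obtain ⟨L, hLe, hLb, hLh, hL2⟩ := holder_ext (hιΛ.mono (by have := hιγ.1; linarith : C4 ≤ C5))
  obtain ⟨γ', hγe, hγb, hγh, hγ2⟩ := holder_ext (hιγ.mono (by have := hιΛ.1; linarith : ‖ι‖ * ‖γ‖ ≤ C5))
  have hC50 : 0 ≤ C5 := add_nonneg hιΛ.1 hιγ.1
  obtain ⟨u, C, hC, hu0, hu1, hud, huh⟩ := linsolve L γ' (3 * C5) (by positivity) hLb hLh hL2 hγb hγh hγ2 (ι q) (ι w)
  have huH : IsH u _ := isH_of_deriv hC (fun z hz => ⟨(hud z hz).1, (hud z hz).2.2⟩)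
  have hDuH : IsH (fderiv ℝ u) C := ⟨hC, fun z hz => (hud z hz).2.2, huh⟩
  set g : ℂ → V := fun z => P z (u z) with hg
  have hgH : IsH g _ := isH_bil hPH huH
  set Dg : ℂ → ℂ →L[ℝ] V := fun z => (P z).comp (fderiv ℝ u z) - (DA z).flip (ψ' (u z)) with hDg
  obtain ⟨C6, hDgH⟩ : ∃ C, IsH Dg C := by
    obtain ⟨_, a1⟩ := hPH.comp hDuH
    exact ⟨_, a1.sub (isH_bil hDAH.flip (huH.post ψ'))⟩
  have hgd : ∀ z, ‖z‖ < 1 → HasFDerivAt g (Dg z) z := by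
    intro z hz
    have hu' := (hud z hz).1.hasFDerivAt
    have h1 : HasFDerivAt (fun z => ψ (u z)) (ψ.comp (fderiv ℝ u z)) z := ψ.hasFDerivAt.comp z hu'
    have h2 : HasFDerivAt (fun z => ψ' (u z)) (ψ'.comp (fderiv ℝ u z)) z := ψ'.hasFDerivAt.comp z hu'
    have h3 := (hAd z hz).clm_apply h2
    have h4 := h1.sub h3
    have e : g = fun z => ψ (u z) - A z (ψ' (u z)) := by
      funext z; simp [hg, hP]
    rw [e]
    refine h4.congr_fderiv ?_
    ext ξ
    simp [hDg, hP]
    abel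
  obtain ⟨g1, -, hg1⟩ := exists_Y hgH
  obtain ⟨g2, -, hg2⟩ := exists_Y hDgH
  have hmem : (g1, g2) ∈ Xsub V := by
    intro z hz
    change HasFDerivAt (ev g1) (ev g2 z) z
    rw [hg2 z hz]
    refine (hgd z hz).congr_of_eventuallyEq ?_
    have : ∀ᶠ w in 𝓝 z, ‖w‖ < 1 := (continuous_norm.tendsto z).eventually (gt_mem_nhds hz)
    filter_upwards [this] with w hw
    exact hg1 w hw
  have hPι : ∀ z v, P z (ι v) = v := by
    intro z v
    simp [hP, hψ'a, hψι, hψI]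
  refine ⟨⟨(g1, g2), hmem⟩, fun z hz => ?_, ?_, ?_⟩
  · change ev g2 z 1 + A z (ev g2 z Complex.I) + (B z (ev g1 z)) (Df z Complex.I) = ev γ z
    rw [hg2 z hz, hg1 z hz]
    have hdb := (hud z hz).2.1
    rw [hLe z hz, hγe z hz] at hdb
    have hPd : P z (dbar u z) = ev γ z - Λ z (u z) := by
      rw [hdb, ContinuousLinearMap.comp_apply, ← map_sub, hPι]
    have hPd2 : P z (dbar u z) = P z (fderiv ℝ u z 1) + A z (P z (fderiv ℝ u z Complex.I)) := by
      have hA2 := hA z hz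
      simp only [hP, dbar, ContinuousLinearMap.sub_apply, ContinuousLinearMap.comp_apply, map_add, map_sub, hψ'a,
        smul_smul, Complex.I_mul_I]
      have hA3 : A z (A z (ψ (Complex.I • fderiv ℝ u z Complex.I))) = - ψ (Complex.I • fderiv ℝ u z Complex.I) :=
        hA2 _
      rw [hA3]
      simp only [neg_smul, one_smul, map_neg]
      abel
    have hfin : ev γ z = P z (fderiv ℝ u z 1) + A z (P z (fderiv ℝ u z Complex.I)) + Λ z (u z) := by
      rw [← hPd2, hPd]; abel
    rw [hfin]
    simp only [hDg, hΛ, hg, ContinuousLinearMap.sub_apply, ContinuousLinearMap.comp_apply, map_sub, 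
      ContinuousLinearMap.flip_apply]
    abel
  · change ev g1 0 = q
    rw [hg1 0 (by simp)]
    simp only [hg]
    rw [hu0, hPι]
  · change ev g2 0 1 = w
    rw [hg2 0 (by simp)]
    simp only [hDg, ContinuousLinearMap.sub_apply, ContinuousLinearMap.comp_apply, ContinuousLinearMap.flip_apply]
    rw [hu1, hPι, hu0, hψ'a, hψI]; simp

end KR

namespace KR
open MeasureTheory

variable {W : Type*} [NormedAddCommGroup W] [NormedSpace ℂ W] [CompleteSpace W]
  [SecondCountableTopology W]
variable {V : Type*} [NormedAddCommGroup V] [NormedSpace ℝ V] [CompleteSpace V]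

def apL (V : Type*) [NormedAddCommGroup V] [NormedSpace ℝ V] (ξ : ℂ) : (ℂ →L[ℝ] V) →L[ℝ] V := 
  ContinuousLinearMap.apply ℝ V ξ

@[simp] lemma apL_apply (ξ : ℂ) (T : ℂ →L[ℝ] V) : apL V ξ T = T ξ := rfl

lemma surj_nhds {E F1 F2 F3 : Type*} [NormedAddCommGroup E] [NormedSpace ℝ E] [CompleteSpace E]
    [NormedAddCommGroup F1] [NormedSpace ℝ F1] [CompleteSpace F1] [NormedAddCommGroup F2] [NormedSpace ℝ F2]
    [CompleteSpace F2] [NormedAddCommGroup F3] [NormedSpace ℝ F3] [CompleteSpace F3]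
    {f : E → F1} {f' : E →L[ℝ] F1} {x : E} (hf : HasStrictFDerivAt f f' x) (k : E →L[ℝ] F1)
    (l : E →L[ℝ] F2) (m : E →L[ℝ] F3)
    (hs : ∀ a b c, ∃ h, k h + f' h = a ∧ l h = b ∧ m h = c) :
    map (fun g => (k g + f g, l g, m g)) (𝓝 x) = 𝓝 (k x + f x, l x, m x) := by
  have hF := ((k.hasStrictFDerivAt (x := x)).add hf).prodMk
    ((l.hasStrictFDerivAt (x := x)).prodMk (m.hasStrictFDerivAt (x := x)))
  refine HasStrictFDerivAt.map_nhds_eq_of_surj hF ?_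
  rw [eq_top_iff]
  rintro ⟨γ, q, w⟩ -
  obtain ⟨h, h1, h2, h3⟩ := hs γ q w
  exact ⟨h, Prod.ext h1 (Prod.ext h2 h3)⟩

instance instXg : NormedAddCommGroup (X V) := Submodule.normedAddCommGroup _
instance instXs : @NormedSpace ℝ (X V) _ (@NormedAddCommGroup.toSeminormedAddCommGroup _ instXg) := Submodule.normedSpace _

set_option maxHeartbeats 1000000 in
lemma deform (ι : V →L[ℝ] W) (ψ : W →L[ℝ] V) (hψι : ∀ x, ψ (ι x) = x)
    (hψI : ∀ x, ψ (Complex.I • ι x) = 0) {G : V → V →L[ℝ] V} {G' : V → V →L[ℝ] V →L[ℝ] V} {M : ℝ}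
    (hG : Nice G G' M) (x : X V) 
    (hA : ∀ z, ‖z‖ < 1 → ∀ v, G (ev x.1.1 z) (G (ev x.1.1 z) v) = - v) 
    (hx : ∀ z, ‖z‖ < 1 → ev x.1.2 z 1 + G (ev x.1.1 z) (ev x.1.2 z Complex.I) = 0) (ε : ℝ) (hε : 0 < ε) :
    ∀ᶠ p : V × V in 𝓝 (ev x.1.1 0, ev x.1.2 0 1), ∃ g : X V, ‖g.1.1 - x.1.1‖ < ε ∧ 
      (∀ z, ‖z‖ < 1 → ev g.1.2 z 1 + G (ev g.1.1 z) (ev g.1.2 z Complex.I) = 0) ∧ ev g.1.1 0 = p.1 ∧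
      ev g.1.2 0 1 = p.2 := by
  obtain ⟨N, hN, hN'⟩ := nem hG
  obtain ⟨N', hN'e, hNd⟩ := hN' x.1.1
  let p1 : X V →L[ℝ] Y V := (ContinuousLinearMap.fst ℝ (Y V) (Y (ℂ →L[ℝ] V))).comp (Xsub V).subtypeL
  let p2 : X V →L[ℝ] Y (ℂ →L[ℝ] V) := (ContinuousLinearMap.snd ℝ (Y V) (Y (ℂ →L[ℝ] V))).comp (Xsub V).subtypeL
  let dx : X V →L[ℝ] Y V := (post (apL V 1)).comp p2
  let dy : X V →L[ℝ] Y V := (post (apL V Complex.I)).comp p2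
  let e0 : X V →L[ℝ] V := (evL 0).comp p1
  let e1 : X V →L[ℝ] V := (evL 0).comp dx
  let 𝓕 : X V → Y V × V × V := fun g => (dx g + Bil (N (p1 g)) (dy g), e0 g, e1 g)
  have hNp : HasStrictFDerivAt (fun g : X V => N (p1 g)) ((Bil N').comp p1) x := 
    HasStrictFDerivAt.comp x (f := p1) (g := N) hNd p1.hasStrictFDerivAt
  have hB := (Bil (E := V) (F := V)).hasStrictFDerivAt_of_bilinear hNp (dy.hasStrictFDerivAt (x := x))
  have hmap := surj_nhds (E := X V) (F1 := Y V) (F2 := V) (F3 := V) hB dx e0 e1 ?_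
  · change map 𝓕 (𝓝 x) = 𝓝 (𝓕 x) at hmap
    have hFx : 𝓕 x = (0, ev x.1.1 0, ev x.1.2 0 1) := by
      refine Prod.ext ?_ (Prod.ext rfl ?_)
      · refine Y_ext fun z hz => ?_
        change ev (post (apL V 1) x.1.2 + Bil (N x.1.1) (post (apL V Complex.I) x.1.2)) z = _
        rw [ev_add, Bil_ev _ _ hz, post_ev _ _ hz, post_ev _ _ hz, hN _ _ hz]
        exact hx z hz
      · change ev (post (apL V 1) x.1.2) 0 = _
        rw [post_ev _ _ (by simp)]; rfl
    have hnb : {g : X V | ‖g.1.1 - x.1.1‖ < ε} ∈ 𝓝 x := by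
      have hc : Continuous (fun g : X V => ‖p1 g - p1 x‖) := by fun_prop
      have := (hc.tendsto x).eventually (gt_mem_nhds (by simpa using hε : ‖p1 x - p1 x‖ < ε))
      exact this
    have him := image_mem_map (m := 𝓕) hnb
    rw [hmap, hFx] at him
    have hcont : Continuous (fun p : V × V => ((0 : Y V), p.1, p.2)) := by fun_prop
    have := (hcont.tendsto (ev x.1.1 0, ev x.1.2 0 1)) him
    filter_upwards [this] with p hp
    obtain ⟨g, hg1, hg2⟩ := hp
    have a1 : dx g + Bil (N (p1 g)) (dy g) = 0 := congrArg Prod.fst hg2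
    have a2 : e0 g = p.1 := congrArg (fun t => t.2.1) hg2
    have a3 : e1 g = p.2 := congrArg (fun t => t.2.2) hg2
    refine ⟨g, hg1, fun z hz => ?_, a2, ?_⟩
    · have b := congrArg (fun y => ev y z) a1
      change ev (post (apL V 1) g.1.2 + Bil (N g.1.1) (post (apL V Complex.I) g.1.2)) z = _ at b
      rw [ev_add, Bil_ev _ _ hz, post_ev _ _ hz, post_ev _ _ hz, hN _ _ hz] at b
      exact b
    · change ev (post (apL V 1) g.1.2) 0 = _ at a3
      rw [post_ev _ _ (by simp)] at a3
      exact a3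
  · intro γ q w
    obtain ⟨h, h1, h2, h3⟩ := surj ι ψ hψι hψI hG x hA γ q w
    refine ⟨h, ?_⟩
    refine ⟨?_, h2, ?_⟩
    · refine Y_ext fun z hz => ?_
      rw [← h1 z hz]
      change ev (post (apL V 1) h.1.2 + (Bil (N x.1.1) (post (apL V Complex.I) h.1.2) + 
        Bil (Bil N' h.1.1) (post (apL V Complex.I) x.1.2))) z = _
      rw [ev_add, ev_add, Bil_ev _ _ hz, Bil_ev _ _ hz, Bil_ev _ _ hz, post_ev _ _ hz, post_ev _ _ hz, post_ev _ _ hz, 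
        hN _ _ hz, hN'e _ hz, ← add_assoc]
      rfl
    · change ev (post (apL V 1) h.1.2) 0 = _
      rw [post_ev _ _ (by simp)]
      exact h3

end KR

namespace KR
open MeasureTheory
section
variable {V : Type*} [NormedAddCommGroup V] [NormedSpace ℝ V] 
variable {E : Type*} [NormedAddCommGroup E] [NormedSpace ℝ E] 

lemma cs_fderiv {G : V → E} (h : ContDiff ℝ ((⊤ : ℕ∞) : WithTop ℕ∞) G) (hs : HasCompactSupport G) :
    ∃ M, 0 ≤ M ∧ (∀ x, ‖G x‖ ≤ M) ∧ (∀ x, HasFDerivAt G (fderiv ℝ G x) x) ∧ 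
      ContDiff ℝ ((⊤ : ℕ∞) : WithTop ℕ∞) (fderiv ℝ G) ∧ 
      HasCompactSupport (fderiv ℝ G) ∧ ∀ x y, ‖G x - G y‖ ≤ M * ‖x - y‖ := by
  have h1 : ContDiff ℝ ((⊤ : ℕ∞) : WithTop ℕ∞) (fderiv ℝ G) := h.fderiv_right le_rfl
  have s1 := hs.fderiv (𝕜 := ℝ)
  obtain ⟨M0, b0⟩ := h.continuous.bounded_above_of_compact_support hs
  obtain ⟨M1, b1⟩ := h1.continuous.bounded_above_of_compact_support s1
  have p0 := (norm_nonneg _).trans (b0 0)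
  have p1 := (norm_nonneg _).trans (b1 0)
  have hd : ∀ x, HasFDerivAt G (fderiv ℝ G x) x := fun x => (h.differentiable (by simp) x).hasFDerivAt
  exact ⟨M0 + M1, by positivity, fun x => (b0 x).trans (by linarith), hd, h1, s1, 
    lip_of hd (fun x => (b1 x).trans (by linarith))⟩

lemma nice_of_cs {G : V → E} (h : ContDiff ℝ ((⊤ : ℕ∞) : WithTop ℕ∞) G) (hs : HasCompactSupport G) :
    ∃ M, Nice G (fderiv ℝ G) M := by
  obtain ⟨M0, p0, b0, d0, h1, s1, -⟩ := cs_fderiv h hs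
  obtain ⟨M1, p1, b1, d1, h2, s2, -⟩ := cs_fderiv h1 s1
  obtain ⟨M2, p2, b2, -, -, -, l2⟩ := cs_fderiv h2 s2
  refine ⟨M0 + M1 + M2, by positivity, fun x => (b0 x).trans (by linarith), 
    d0, fun x => (b1 x).trans (by linarith), 
    fderiv ℝ (fderiv ℝ G), d1, 
    fun x => (b2 x).trans (by linarith), fun x y => (l2 x y).trans (by gcongr; linarith)⟩

open scoped Manifold ContDiff in
lemma cutoff [FiniteDimensional ℝ V] {Ω K : Set V} (hΩ : IsOpen Ω) (hK : IsCompact K) (hKΩ : K ⊆ Ω) {J : V → E}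
    (hJ : ContDiffOn ℝ ((⊤ : ℕ∞) : WithTop ℕ∞) J Ω) : ∃ (G : V → E) (M ε : ℝ), 0 < ε ∧ Nice G (fderiv ℝ G) M ∧ 
      thickening ε K ⊆ Ω ∧ ∀ x ∈ thickening ε K, G x = J x := by
  have : ProperSpace V := FiniteDimensional.proper_real V
  obtain ⟨δ, hδ, hδΩ⟩ := hK.exists_cthickening_subset_open hΩ hKΩ
  obtain ⟨χ, hχ, -, hsupp, hone⟩ := exists_contMDiff_support_eq_eq_one_iff 𝓘(ℝ, V)
    (isOpen_thickening (δ := δ) (E := K)) (isClosed_cthickening (δ := δ / 2) (E := K))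
    (cthickening_subset_thickening' hδ (by linarith) K)
  have hχ' : ContDiff ℝ ((⊤ : ℕ∞) : WithTop ℕ∞) χ := hχ.contDiff
  have hts : tsupport χ ⊆ cthickening δ K := by
    rw [tsupport, hsupp]
    exact closure_thickening_subset_cthickening _ _
  have hcs : HasCompactSupport χ := 
    hK.cthickening.of_isClosed_subset (isClosed_tsupport _) hts
  have hG : ContDiff ℝ ((⊤ : ℕ∞) : WithTop ℕ∞) (fun x => χ x • J x) := by
    rw [contDiff_iff_contDiffAt]
    intro x
    by_cases hx : x ∈ Ω
    · exact hχ'.contDiffAt.smul (hJ.contDiffAt (hΩ.mem_nhds hx))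
    · have hx' : x ∈ (tsupport χ)ᶜ := fun h => hx (hδΩ (hts h))
      have : (fun x => χ x • J x) =ᶠ[𝓝 x] fun _ => 0 := by
        filter_upwards [(isClosed_tsupport χ).isOpen_compl.mem_nhds hx'] with y hy
        simp [image_eq_zero_of_notMem_tsupport hy]
      exact contDiffAt_const.congr_of_eventuallyEq this
  obtain ⟨M, hM⟩ := nice_of_cs hG hcs.smul_right
  refine ⟨_, M, δ / 2, by positivity, hM, fun x hx => hδΩ (thickening_subset_cthickening _ _ (thickening_mono (by linarith) _ hx)), fun x hx => ?_⟩
  have : χ x = 1 := (hone x).1 (thickening_subset_cthickening _ _ hx)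
  simp [this]
end

end KR

namespace KR
open MeasureTheory
section
variable {V : Type*} [NormedAddCommGroup V] [NormedSpace ℝ V] [FiniteDimensional ℝ V]

lemma emb (V : Type*) [NormedAddCommGroup V] [NormedSpace ℝ V] [FiniteDimensional ℝ V] : 
    ∃ (ι : V →L[ℝ] (Fin (Module.finrank ℝ V) → ℂ)) (ψ : (Fin (Module.finrank ℝ V) → ℂ) →L[ℝ] V), 
      (∀ x, ψ (ι x) = x) ∧ ∀ x, ψ (Complex.I • ι x) = 0 := by
  let b := Module.finBasis ℝ V
  let ι : V →ₗ[ℝ] (Fin (Module.finrank ℝ V) → ℂ) := 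
    LinearMap.pi fun j => Complex.ofRealCLM.toLinearMap ∘ₗ (b.coord j)
  let ψ : (Fin (Module.finrank ℝ V) → ℂ) →ₗ[ℝ] V := 
    ∑ j, (LinearMap.toSpanSingleton ℝ V (b j)) ∘ₗ Complex.reLm ∘ₗ LinearMap.proj j
  refine ⟨LinearMap.toContinuousLinearMap ι, LinearMap.toContinuousLinearMap ψ, fun x => ?_, fun x => ?_⟩
  · simp [ι, ψ, LinearMap.sum_apply, b.sum_repr]
  · simp [ι, ψ, LinearMap.sum_apply]

lemma compact_bound {f : ℂ → ℝ} {K : Set ℂ} (hK : IsCompact K) 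
    (h : ∀ z ∈ K, ∃ C : ℝ, ∀ᶠ w in 𝓝 z, f w ≤ C) : ∃ C, 0 ≤ C ∧ ∀ z ∈ K, f z ≤ C := by
  refine hK.induction_on (p := fun s => ∃ C, 0 ≤ C ∧ ∀ z ∈ s, f z ≤ C) ⟨0, le_rfl, by simp⟩ ?_ ?_ ?_
  · rintro s t hst ⟨C, h0, hC⟩; exact ⟨C, h0, fun z hz => hC z (hst hz)⟩
  · rintro s t ⟨C, h0, hC⟩ ⟨D, h1, hD⟩
    refine ⟨C + D, by positivity, ?_⟩
    rintro z (hz | hz)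
    · linarith [hC z hz]
    · linarith [hD z hz]
  · intro z hz
    obtain ⟨C, hC⟩ := h z hz
    exact ⟨_, mem_nhdsWithin_of_mem_nhds hC, |C|, abs_nonneg _, fun w hw => le_trans hw (le_abs_self C)⟩

set_option maxHeartbeats 1000000 in
lemma core {Ω : Set V} (hΩ : IsOpen Ω) {J : V → V →L[ℝ] V}
    (hJ : ContDiffOn ℝ ((⊤ : ℕ∞) : WithTop ℕ∞) J Ω) (hJ2 : ∀ x ∈ Ω, ∀ v, J x (J x v) = - v)
    {f : ℂ → V} (hf : ∀ z ∈ ball (0:ℂ) 1, f z ∈ Ω ∧ DifferentiableAt ℝ f z ∧ 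
      fderiv ℝ f z Complex.I = J (f z) (fderiv ℝ f z 1)) {s : ℝ} (hs0 : 0 < s) (hs1 : s < 1) :
    ∀ᶠ p : V × V in 𝓝 (f 0, s • fderiv ℝ f 0 1), ∃ g : ℂ → V, (∀ z ∈ ball (0:ℂ) 1, g z ∈ Ω ∧ DifferentiableAt ℝ g z ∧ 
      fderiv ℝ g z Complex.I = J (g z) (fderiv ℝ g z 1)) ∧ g 0 = p.1 ∧ fderiv ℝ g 0 1 = p.2 := by
  have : CompleteSpace V := FiniteDimensional.complete ℝ V
  obtain ⟨ι, ψ, hψι, hψI⟩ := emb V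
  have hgood : ∀ {K : Set V} {G : V → V →L[ℝ] V} {M ε : ℝ}, Nice G (fderiv ℝ G) M → thickening ε K ⊆ Ω → 
      (∀ x ∈ thickening ε K, G x = J x) → GoodOn J (thickening ε K) M M := by
    intro K G M ε hG hKΩ hGJ
    refine ⟨fun x hx => ⟨?_, hJ2 x (hKΩ hx)⟩, fun x hx y hy => ?_⟩
    · rw [← hGJ x hx]; exact hG.h0 x
    · rw [← hGJ x hx, ← hGJ y hy]; exact lip_of hG.hd hG.h1 x y
  have hloc : ∀ a ∈ Ω, LocGood J a := by
    intro a ha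
    obtain ⟨G, M, ε, hε, hG, h1, h2⟩ := cutoff hΩ (isCompact_singleton (x := a)) (by simpa using ha) hJ
    have := hgood hG h1 h2
    rw [thickening_singleton] at this
    exact ⟨M, M, ε, hG.hM, hG.hM, hε, this⟩
  have hreg := regIc ι ψ hψι hψI J (ball (0:ℂ) 1) isOpen_ball f 
    (fun z hz => ⟨(hf z hz).2.1, (hf z hz).2.2, hloc _ (hf z hz).1⟩)
  set ρ := (1 + s) / 2 with hρ
  have hsρ : s < ρ := by rw [hρ]; linarith
  have hρ1 : ρ < 1 := by rw [hρ]; linarith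
  have hsub : closedBall (0:ℂ) ρ ⊆ ball 0 1 := closedBall_subset_ball hρ1
  have hcb : IsCompact (closedBall (0:ℂ) ρ) := isCompact_closedBall _ _
  obtain ⟨Λ, hΛ0, hΛ⟩ := compact_bound hcb (fun z hz => hreg z (hsub hz))
  have hcont : ContinuousOn f (closedBall (0:ℂ) ρ) := fun z hz => 
    (hf z (hsub hz)).2.1.continuousAt.continuousWithinAt
  set K := f '' closedBall (0:ℂ) ρ with hKd
  have hK : IsCompact K := hcb.image_of_continuousOn hcont
  have hKΩ : K ⊆ Ω := by
    rintro _ ⟨z, hz, rfl⟩; exact (hf z (hsub hz)).1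
  obtain ⟨G, M, ε, hε, hG, hthΩ, hGJ⟩ := cutoff hΩ hK hKΩ hJ
  have hKt : K ⊆ thickening ε K := self_subset_thickening hε _
  obtain ⟨C, hC, hH⟩ := regId ι ψ hψι hψI J (thickening ε K) M M Λ s ρ hG.hM hG.hM hΛ0 hsρ (hgood hG hthΩ hGJ) f
    (fun z hz => ⟨(hf z (hsub (ball_subset_closedBall hz))).2.1, hΛ z (ball_subset_closedBall hz), 
      (hf z (hsub (ball_subset_closedBall hz))).2.2, hKt ⟨z, ball_subset_closedBall hz, rfl⟩⟩)
  -- rescaled disc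
  have hsn : ∀ z : ℂ, ‖z‖ < 1 → ‖s • z‖ < s := fun z hz => by
    rw [norm_smul, Real.norm_of_nonneg hs0.le]; nlinarith
  have hsm : ∀ z : ℂ, ‖z‖ < 1 → s • z ∈ closedBall (0:ℂ) ρ := fun z hz => by
    rw [mem_closedBall_zero_iff]; linarith [hsn z hz]
  set F : ℂ → V := fun z => f (s • z) with hF
  have hFd : ∀ z, ‖z‖ < 1 → HasFDerivAt F (s • fderiv ℝ f (s • z)) z := by
    intro z hz
    have h1 := (hf _ (hsub (hsm z hz))).2.1.hasFDerivAt
    have h2 : HasFDerivAt (fun z : ℂ => s • z) (s • ContinuousLinearMap.id ℝ ℂ) z := 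
      (hasFDerivAt_id z).const_smul s
    have h3 := h1.comp z h2
    refine h3.congr_fderiv ?_
    ext ξ
    simp
  have hFH : IsH F (‖F 0‖ + 2 * (s * Λ)) := isH_of_deriv (by positivity) fun z hz => ⟨(hFd z hz).differentiableAt, by
    rw [(hFd z hz).fderiv, norm_smul, Real.norm_of_nonneg hs0.le]
    have := hΛ _ (hsm z hz)
    gcongr⟩
  have hDH : IsH (fun z => s • fderiv ℝ f (s • z)) (Λ + C) := by
    refine ⟨by positivity, fun z hz => ?_, fun z w hz hw => ?_⟩
    · rw [norm_smul, Real.norm_of_nonneg hs0.le]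
      have := hΛ _ (hsm z hz)
      nlinarith [norm_nonneg (fderiv ℝ f (s • z))]
    · rw [← smul_sub, norm_smul, Real.norm_of_nonneg hs0.le]
      have h1 := hH _ _ (hsn z hz) (hsn w hw)
      have h2 : √‖s • z - s • w‖ ≤ √‖z - w‖ := by
        apply Real.sqrt_le_sqrt
        rw [← smul_sub, norm_smul, Real.norm_of_nonneg hs0.le]
        nlinarith [norm_nonneg (z - w)]
      have h3 := norm_nonneg (fderiv ℝ f (s • z) - fderiv ℝ f (s • w))
      have h4 := Real.sqrt_nonneg ‖z - w‖
      nlinarith [mul_le_mul_of_nonneg_left h2 hC, mul_nonneg hΛ0 h4]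
  obtain ⟨g1, -, hg1⟩ := exists_Y hFH
  obtain ⟨g2, -, hg2⟩ := exists_Y hDH
  have hmem : (g1, g2) ∈ Xsub V := by
    intro z hz
    change HasFDerivAt (ev g1) (ev g2 z) z
    rw [hg2 z hz]
    refine (hFd z hz).congr_of_eventuallyEq ?_
    have : ∀ᶠ w in 𝓝 z, ‖w‖ < 1 := (continuous_norm.tendsto z).eventually (gt_mem_nhds hz)
    filter_upwards [this] with w hw
    exact hg1 w hw
  have hFK : ∀ z, ‖z‖ < 1 → F z ∈ K := fun z hz => ⟨_, hsm z hz, rfl⟩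
  have hdef := deform ι ψ hψι hψI hG ⟨(g1, g2), hmem⟩ (fun z hz v => ?_) (fun z hz => ?_) ε hε
  · change ∀ᶠ p : V × V in 𝓝 (ev g1 0, ev g2 0 1), _ at hdef
    rw [hg1 0 (by simp), hg2 0 (by simp)] at hdef
    simp only [hF, smul_zero, ContinuousLinearMap.smul_apply] at hdef
    filter_upwards [hdef] with p hp
    obtain ⟨g, ha, hb, hc, hd⟩ := hp
    have hgd : ∀ z, ‖z‖ < 1 → HasFDerivAt (ev g.1.1) (ev g.1.2 z) z := g.2
    refine ⟨ev g.1.1, fun z hz => ?_, hc, ?_⟩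
    · rw [mem_ball_zero_iff] at hz
      have hin : ev g.1.1 z ∈ thickening ε K := by
        rw [mem_thickening_iff]
        refine ⟨F z, hFK z hz, ?_⟩
        rw [dist_eq_norm, ← hg1 z hz, ← ev_sub]
        exact (norm_ev_le _ _).trans_lt ha
      refine ⟨hthΩ hin, (hgd z hz).differentiableAt, ?_⟩
      rw [(hgd z hz).fderiv]
      have h1 := hb z hz
      rw [hGJ _ hin] at h1
      rw [eq_neg_of_add_eq_zero_left h1, map_neg, hJ2 _ (hthΩ hin), neg_neg]
    · rw [(hgd 0 (by simp)).fderiv]; exact hd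
  · change G (ev g1 z) (G (ev g1 z) v) = -v
    rw [hg1 z hz, hGJ _ (hKt (hFK z hz)), hJ2 _ (hKΩ (hFK z hz))]
  · change ev g2 z 1 + G (ev g1 z) (ev g2 z Complex.I) = 0
    rw [hg1 z hz, hg2 z hz, hGJ _ (hKt (hFK z hz))]
    have h1 := (hf _ (hsub (hsm z hz))).2.2
    simp only [ContinuousLinearMap.smul_apply, map_smul, h1, hF]
    rw [hJ2 _ (hf _ (hsub (hsm z hz))).1]
    simp
end

end KR

/-- the Kobayashi–Royden pseudonorm is upper semicontinuous on `Ω × ℂⁿ`. -/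
theorem kobayashiRoyden_upperSemicontinuous
    (n : ℕ) (hn : 1 ≤ n) (Ω : Set (Cn n)) (hΩ : IsOpen Ω) (hne : Ω.Nonempty)
    (J : Cn n → (Cn n →L[ℝ] Cn n)) (hJ : IsAlmostComplexOn n Ω J)
    (p : Cn n) (hp : p ∈ Ω) (v : Cn n) (c : ℝ≥0∞)
    (hc : kobayashiRoyden n Ω J p v < c) :
    ∃ U ∈ 𝓝 p, ∃ V ∈ 𝓝 v, U ⊆ Ω ∧
      ∀ q ∈ U, ∀ w ∈ V, kobayashiRoyden n Ω J q w < c := by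
  obtain ⟨hJs, hJ2⟩ := hJ
  have hJ2' : ∀ x ∈ Ω, ∀ v, J x (J x v) = - v := fun x hx v => by
    have := congrArg (fun T : Cn n →L[ℝ] Cn n => T v) (hJ2 x hx)
    simpa using this
  obtain ⟨_, ⟨r, hr, ⟨f, ⟨hf1, hf2⟩, hf0, hfv⟩, rfl⟩, hrc⟩ := sInf_lt_iff.1 hc
  obtain ⟨s, hs0, hs1, hsc⟩ : ∃ s : ℝ, 0 < s ∧ s < 1 ∧ ENNReal.ofReal (1 / (r * s)) < c := by
    have hcont : ContinuousAt (fun s : ℝ => ENNReal.ofReal (1 / (r * s))) 1 := by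
      refine ENNReal.continuous_ofReal.continuousAt.comp ?_
      exact continuousAt_const.div (continuousAt_const.mul continuousAt_id) (by simpa using hr.ne')
    have h1 : ∀ᶠ s in 𝓝 (1:ℝ), ENNReal.ofReal (1 / (r * s)) < c := 
      hcont.eventually (gt_mem_nhds (by simpa using hrc))
    have h2 : ∀ᶠ s in 𝓝 (1:ℝ), 0 < s := lt_mem_nhds one_pos
    have h3 : ∃ᶠ s in 𝓝 (1:ℝ), s < 1 := frequently_lt_nhds 1
    obtain ⟨s, h, h', h''⟩ := (h3.and_eventually (h2.and h1)).exists
    exact ⟨s, h', h, h''⟩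
  have hcore := KR.core (V := Cn n) hΩ hJs hJ2' (f := f) (fun z hz => ⟨hf1 hz, (hf2 z hz).1, by
    simpa using (hf2 z hz).2 1⟩) hs0 hs1
  rw [hf0, hfv] at hcore
  have hct : Continuous (fun t : Cn n × Cn n => (t.1, s • r • t.2)) := by fun_prop
  have hev := (hct.tendsto (p, v)).eventually hcore
  rw [nhds_prod_eq, eventually_prod_iff] at hev
  obtain ⟨P, hP, Q, hQ, hPQ⟩ := hev
  refine ⟨{q | P q} ∩ Ω, inter_mem hP (hΩ.mem_nhds hp), {w | Q w}, hQ, inter_subset_right, ?_⟩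
  rintro q ⟨hq, -⟩ w hw
  obtain ⟨g, hg, hg0, hg1⟩ := hPQ hq hw
  refine lt_of_le_of_lt (sInf_le ⟨r * s, by positivity, ⟨g, ⟨fun z hz => (hg z hz).1, fun z hz => ⟨(hg z hz).2.1, 
    fun ξ => ?_⟩⟩, hg0, ?_⟩, rfl⟩) hsc
  · obtain ⟨hgΩ, -, hgI⟩ := hg z hz
    have e1 : Complex.I * ξ = ξ.re • Complex.I + (-ξ.im) • (1:ℂ) := by
      apply Complex.ext <;> simp
    have e2 : ξ = ξ.re • (1:ℂ) + ξ.im • Complex.I := by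
      apply Complex.ext <;> simp
    have e3 : fderiv ℝ g z ξ = fderiv ℝ g z (ξ.re • (1:ℂ) + ξ.im • Complex.I) := congrArg (fderiv ℝ g z) e2
    rw [e1, e3]
    simp only [map_add, map_smul, hgI, hJ2' _ hgΩ]
    simp
  · rw [hg1]
    simp only [smul_smul, mul_comm]
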